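/- Let G be the generalized quaternion group Q_24 of order 24 (QuaternionGroup 6) and ZG = MonoidAlgebra ℤ Q_24. Consider the equivalence relation on finitely generated left ZG-modules generated by: P ∼ Q if there exists a group automorphism θ of Q_24 with Q ≅ P_θ, where P_θ is the ZG-module with the same underlying abelian group as P and action g • x = θ(g)x. Then the set of stably free rank-one ZG-modules (modules P with P ⊕ (ZG)^a ≅ (ZG)^(a+1) for some a) falls into exactly 2 classes under this equivalence; in particular the twisting action of Aut(Q_24) on the 3 isomorphism classes of stably free rank-one ZG-modules is non-trivial. -/

import Mathlib

/-!
STATEMENT 1: Over `ℤQ₂₄` (with `Q₂₄ = QuaternionGroup 6`), the stably free rank one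
modules fall into exactly 2 classes under the equivalence generated by
`P ∼ Q ↔ ∃ θ ∈ Aut(Q₂₄), Q ≅ P_θ` (where `P_θ` is `P` with the action twisted by `θ`);
in particular, since there are exactly 3 isomorphism classes, the twisting action of
`Aut(Q₂₄)` on them is non-trivial.
-/

noncomputable section

open CategoryTheory

/-- The quaternion group of order 24. -/
abbrev Q24 : Type := QuaternionGroup 6

/-- The integral group ring `ℤQ₂₄`. -/
abbrev ZQ24 : Type := MonoidAlgebra ℤ Q24

/-- The ring endomorphism of `ℤG` induced by a group automorphism `θ`. -/
def twistRingHom (θ : Q24 ≃* Q24) : ZQ24 →+* ZQ24 :=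
  MonoidAlgebra.mapDomainRingHom ℤ θ.toMonoidHom

/-- `Twist θ M` is the `ℤQ₂₄`-module `M_θ`: the same underlying abelian group as `M`,
with action `g • x = θ(g) • x`. -/
def Twist (_θ : Q24 ≃* Q24) (M : Type) [AddCommGroup M] [Module ZQ24 M] : Type := M

instance (θ : Q24 ≃* Q24) (M : Type) [AddCommGroup M] [Module ZQ24 M] :
    AddCommGroup (Twist θ M) := inferInstanceAs (AddCommGroup M)

noncomputable instance (θ : Q24 ≃* Q24) (M : Type) [AddCommGroup M] [Module ZQ24 M] :
    Module ZQ24 (Twist θ M) := Module.compHom M (twistRingHom θ)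

/-- A `ℤQ₂₄`-module is stably free of rank one if `P ⊕ (ℤQ₂₄)^a ≅ (ℤQ₂₄)^(a+1)` for some
natural number `a`. -/
def IsStablyFreeOfRankOne (P : ModuleCat.{0} ZQ24) : Prop :=
  ∃ a : ℕ, Nonempty ((↥P × (Fin a → ZQ24)) ≃ₗ[ZQ24] (Fin (a + 1) → ZQ24))

/-- The generator of order 12 of `Q24`, as an element of the group ring. -/
def gx : ZQ24 := MonoidAlgebra.single (QuaternionGroup.a 1) 1

/-- The generator of order 4 of `Q24`, as an element of the group ring. -/
def gy : ZQ24 := MonoidAlgebra.single (QuaternionGroup.xa 0) 1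

theorem single_a (i : ZMod 12)
    : (MonoidAlgebra.single (QuaternionGroup.a i) 1 : ZQ24) = gx ^ i.val := by
  rw [gx, MonoidAlgebra.single_pow, one_pow, QuaternionGroup.a_one_pow]
  congr 2
  exact (ZMod.natCast_zmod_val i).symm

theorem single_xa (i : ZMod 12) :
    (MonoidAlgebra.single (QuaternionGroup.xa i) 1 : ZQ24) = gy * gx ^ i.val := by
  rw [← single_a, gy, MonoidAlgebra.single_mul_single, mul_one, QuaternionGroup.xa_mul_a]
  congr 2
  exact (zero_add i).symm

section quatLift
variable {B : Type*} [Ring B]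

theorem pow_mul_of_mul_mul {X Y : B} (h12 : X ^ 12 = 1) (hc : X * Y * X = Y) (n : ℕ) :
    X ^ n * Y = Y * X ^ (11 * n) := by
  have h1 : X * Y = Y * X ^ 11 := by
    calc X * Y = X * Y * X ^ 12 := by rw [h12, mul_one]
      _ = X * Y * X * X ^ 11 := by rw [pow_succ' X 11, ← mul_assoc]
      _ = _ := by rw [hc]
  induction n with
  | zero => simp
  | succ n ih =>
    rw [pow_succ, mul_assoc, h1, ← mul_assoc, ih, mul_assoc, ← pow_add]
    congr 2

/-- The map on `Q24` underlying `quatLift`. -/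
def quatFun (X Y : B) : Q24 → B
  | .a i => X ^ i.val
  | .xa i => Y * X ^ i.val

/-- The monoid homomorphism out of `Q24` given by images of the generators. -/
def quatMonoidHom (X Y : B) (h12 : X ^ 12 = 1) (h6 : Y * Y = X ^ 6) (hc : X * Y * X = Y) :
    Q24 →* B where
  toFun := quatFun X Y
  map_one' := by
    change X ^ (0 : ZMod 12).val = 1
    simp
  map_mul' := by
    have key := pow_mul_of_mul_mul h12 hc
    rintro (i | i) (j | j)
    · change X ^ (i + j : ZMod 12).val = X ^ (i : ZMod 12).val * X ^ (j : ZMod 12).val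
      rw [← pow_add]
      exact pow_eq_pow_of_modEq (by rw [Nat.ModEq, ZMod.val_add, Nat.mod_mod]) h12
    · change Y * X ^ (j - i : ZMod 12).val = X ^ (i : ZMod 12).val * (Y * X ^ (j : ZMod 12).val)
      rw [← mul_assoc, key, mul_assoc, ← pow_add]
      congr 1
      refine pow_eq_pow_of_modEq ?_ h12
      revert i j; decide
    · change Y * X ^ (i + j : ZMod 12).val = Y * X ^ (i : ZMod 12).val * X ^ (j : ZMod 12).val
      rw [mul_assoc, ← pow_add]
      congr 1
      exact pow_eq_pow_of_modEq (by rw [Nat.ModEq, ZMod.val_add, Nat.mod_mod]) h12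
    · change X ^ (6 + j - i : ZMod 12).val =
        Y * X ^ (i : ZMod 12).val * (Y * X ^ (j : ZMod 12).val)
      rw [mul_assoc, ← mul_assoc (X ^ _) Y, key, mul_assoc, ← pow_add, ← mul_assoc, h6, ← pow_add]
      refine pow_eq_pow_of_modEq ?_ h12
      revert i j; decide

/-- The ring homomorphism out of `ℤQ₂₄` given by images of the generators. -/
def quatLift (X Y : B) (h12 : X ^ 12 = 1) (h6 : Y * Y = X ^ 6) (hc : X * Y * X = Y) :
    ZQ24 →+* B :=
  (MonoidAlgebra.lift ℤ B Q24 (quatMonoidHom X Y h12 h6 hc) : ZQ24 →ₐ[ℤ] B).toRingHom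

variable {X Y : B} {h12 : X ^ 12 = 1} {h6 : Y * Y = X ^ 6} {hc : X * Y * X = Y}

@[simp] theorem quatLift_gx : quatLift X Y h12 h6 hc gx = X := by
  have : quatLift X Y h12 h6 hc gx = X ^ (1 : ZMod 12).val := by
    simp [quatLift, gx, MonoidAlgebra.lift_single, quatMonoidHom, quatFun]
  rw [this]; exact pow_one X

@[simp] theorem quatLift_gy : quatLift X Y h12 h6 hc gy = Y := by
  have : quatLift X Y h12 h6 hc gy = Y * X ^ (0 : ZMod 12).val := by
    simp [quatLift, gy, MonoidAlgebra.lift_single, quatMonoidHom, quatFun]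
  rw [this]; simp

theorem ZQ24_hom_ext {f g : ZQ24 →+* B} (hx : f gx = g gx) (hy : f gy = g gy) : f = g := by
  refine MonoidAlgebra.ringHom_ext (fun r => ?_) ?_
  · have (h : ZQ24 →+* B) : h (MonoidAlgebra.single 1 r) = (r : B) := by
      rw [← map_intCast h]; congr 1
    rw [this, this]
  · rintro (i | i)
    · rw [single_a i, map_pow, map_pow, hx]
    · rw [single_xa i, map_mul, map_mul, map_pow, map_pow, hx, hy]

end quatLift

section bdet
set_option linter.unusedSectionVars false
open Matrix

variable {D D' A A' κ ι m n k : Type*} [Ring D] [Ring D'] [CommRing A] [CommRing A']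
  [Fintype κ] [DecidableEq κ] [Fintype ι] [DecidableEq ι] [Fintype m] [DecidableEq m]
  [Fintype n] [DecidableEq n] [Fintype k] [DecidableEq k]

theorem comp_mul' {l : Type*} [Fintype l] (M : Matrix m n (Matrix κ κ A))
    (N : Matrix n l (Matrix κ κ A)) :
    Matrix.comp _ _ _ _ _ (M * N) = Matrix.comp _ _ _ _ _ M * Matrix.comp _ _ _ _ _ N := by
  ext ⟨i, a⟩ ⟨j, b⟩
  simp [Matrix.mul_apply, Matrix.sum_apply, Fintype.sum_prod_type]

theorem comp_one' : Matrix.comp m m κ κ A 1 = 1 := by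
  ext ⟨i, a⟩ ⟨j, b⟩
  by_cases h : i = j
  · subst h; simp [Matrix.one_apply]
  · simp [h]

/-- The determinant of a matrix over `D` after flattening along a matrix representation of `D`. -/
def bdet (ρ : D →+* Matrix κ κ A) (M : Matrix m m D) : A :=
  (Matrix.comp m m κ κ A (M.map ρ)).det

theorem bdet_mul (ρ : D →+* Matrix κ κ A) (M N : Matrix m m D) :
    bdet ρ (M * N) = bdet ρ M * bdet ρ N := by
  rw [bdet, Matrix.map_mul, comp_mul', det_mul, bdet, bdet]

theorem bdet_one (ρ : D →+* Matrix κ κ A) : bdet ρ (1 : Matrix m m D) = 1 := by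
  rw [bdet, Matrix.map_one _ (map_zero _) (map_one _), comp_one', det_one]

theorem bdet_submatrix (ρ : D →+* Matrix κ κ A) (e : m ≃ n) (M : Matrix n n D) :
    bdet ρ (M.submatrix e e) = bdet ρ M :=
  det_submatrix_equiv_self (e.prodCongr (Equiv.refl κ)) (Matrix.comp n n κ κ A (M.map ρ))

theorem bdet_fromBlocks_zero₁₂ (ρ : D →+* Matrix κ κ A) (a : Matrix m m D) (c : Matrix n m D)
    (d : Matrix n n D) : bdet ρ (fromBlocks a 0 c d) = bdet ρ a * bdet ρ d := by
  rw [bdet, bdet, bdet, ← det_fromBlocks_zero₁₂ _ (Matrix.comp _ _ _ _ _ (c.map ρ)),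
    ← det_submatrix_equiv_self (Equiv.sumProdDistrib m n κ).symm]
  congr 1
  ext (⟨i, s⟩ | ⟨i, s⟩) (⟨j, t⟩ | ⟨j, t⟩) <;> simp [Equiv.sumProdDistrib]

theorem bdet_fromBlocks_zero₂₁ (ρ : D →+* Matrix κ κ A) (a : Matrix m m D) (b : Matrix m n D)
    (d : Matrix n n D) : bdet ρ (fromBlocks a b 0 d) = bdet ρ a * bdet ρ d := by
  rw [bdet, bdet, bdet, ← det_fromBlocks_zero₂₁ _ (Matrix.comp _ _ _ _ _ (b.map ρ)),
    ← det_submatrix_equiv_self (Equiv.sumProdDistrib m n κ).symm]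
  congr 1
  ext (⟨i, s⟩ | ⟨i, s⟩) (⟨j, t⟩ | ⟨j, t⟩) <;> simp [Equiv.sumProdDistrib]

theorem bdet_unit (ρ : D →+* Matrix κ κ A) (g : Matrix Unit Unit D) :
    bdet ρ g = (ρ (g () ())).det :=
  (det_submatrix_equiv_self (Equiv.punitProd κ).symm _).symm

theorem bdet_comp (ρ : D' →+* Matrix κ κ A) (φ : D →+* D') (M : Matrix m m D) :
    bdet (ρ.comp φ) M = bdet ρ (M.map φ) := rfl

theorem map_bdet (f : A →+* A') (ρ : D →+* Matrix κ κ A) (M : Matrix m m D) :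
    f (bdet ρ M) = bdet ((f.mapMatrix).comp ρ) M := by
  rw [bdet, RingHom.map_det]
  rfl

theorem bdet_conj {ρ ρ' : D →+* Matrix κ κ A} {G H : Matrix κ κ A} (hGH : G * H = 1)
    (h : ∀ r, G * ρ r = ρ' r * G) (M : Matrix m m D) : bdet ρ M = bdet ρ' M := by
  have h1 : diagonal (fun _ => G) * M.map ρ = M.map ρ' * diagonal (fun _ : m => G) := by
    ext i j : 2
    simp [h]
  have h2 : (Matrix.comp m m κ κ A (diagonal (fun _ => G))).det *
      (Matrix.comp m m κ κ A (diagonal (fun _ => H))).det = 1 := by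
    rw [← det_mul, ← comp_mul', diagonal_mul_diagonal, hGH]
    exact (congrArg det comp_one').trans det_one
  have h3 := congrArg (fun X => (Matrix.comp m m κ κ A X).det) h1
  simp only [comp_mul', det_mul] at h3
  rw [mul_comm (det _)] at h3
  have := congrArg (· * (Matrix.comp m m κ κ A (diagonal (fun _ => H))).det) h3
  simpa [mul_assoc, h2, bdet] using this

theorem fromCols_mul_eq (c : Matrix m n D) (g : Matrix n n D) (C : Matrix m k D) :
    fromCols (c * g) C =
      fromCols c C * (fromBlocks g 0 0 1 : Matrix (n ⊕ k) (n ⊕ k) D) := by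
  simp [fromCols_mul_fromBlocks]

theorem bdet_fromCols_mul (ρ : D →+* Matrix κ κ A) (c : Matrix (Unit ⊕ k) Unit D)
    (g : Matrix Unit Unit D) (C : Matrix (Unit ⊕ k) k D) :
    bdet ρ (fromCols (c * g) C) = bdet ρ (fromCols c C) * (ρ (g () ())).det := by
  rw [fromCols_mul_eq, bdet_mul, bdet_fromBlocks_zero₁₂, bdet_one, mul_one, bdet_unit]

theorem map_fromCols {α β : Type*} (f : α → β) (c : Matrix m n α) (C : Matrix m k α) :
    (fromCols c C).map f = fromCols (c.map f) (C.map f) := by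
  ext i (j | j) <;> rfl

theorem exists_splitting {N : Matrix k (Unit ⊕ k) D} {C : Matrix (Unit ⊕ k) k D}
    {c : Matrix (Unit ⊕ k) Unit D} (hNC : N * C = 1) (hNc : N * c = 0)
    {X : Matrix (Unit ⊕ k) (Unit ⊕ k) D} (hX : X * fromCols c C = 1) (hX' : fromCols c C * X = 1) :
    ∃ V : Matrix Unit (Unit ⊕ k) D, V * c = 1 ∧ V * C = 0 ∧ c * V + C * N = 1 := by
  obtain ⟨V, W, rfl⟩ : ∃ V W, X = fromRows V W := ⟨_, _, (fromRows_toRows X).symm⟩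
  rw [fromRows_mul_fromCols, ← fromBlocks_one, fromBlocks_inj] at hX
  rw [fromCols_mul_fromRows] at hX'
  refine ⟨V, hX.1, hX.2.1, ?_⟩
  have : N = W := by
    have := congrArg (N * ·) hX'
    simp only [Matrix.mul_add, ← Matrix.mul_assoc, hNC, hNc, Matrix.zero_mul, Matrix.one_mul,
      Matrix.mul_one, zero_add] at this
    exact this.symm
  rw [this, hX']

/-- Over a commutative ring, a split surjection onto `k`-space from `(1 + k)`-space has kernel
generated by a vector completing the section to a matrix of determinant one. -/
theorem exists_kernel_column {N : Matrix k (Unit ⊕ k) A} {C : Matrix (Unit ⊕ k) k A}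
    (hNC : N * C = 1) :
    ∃ c : Matrix (Unit ⊕ k) Unit A, N * c = 0 ∧ (fromCols c C).det = 1 := by
  have hadj : ∀ c : Matrix (Unit ⊕ k) Unit A,
      (fromCols (((1 : Matrix (Unit ⊕ k) (Unit ⊕ k) A) - C * N) * c) C).det =
        (fromCols c C).det := by
    intro c
    have hcol : fromCols (((1 : Matrix (Unit ⊕ k) (Unit ⊕ k) A) - C * N) * c) C =
        fromCols c C * fromBlocks 1 0 (-(N * c)) 1 := by
      rw [fromCols_mul_fromBlocks, Matrix.sub_mul, Matrix.mul_neg, Matrix.mul_assoc]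
      simp [sub_eq_add_neg]
    rw [hcol, det_mul, det_fromBlocks_zero₁₂, det_one, det_one, mul_one, mul_one]
  have hker : ∀ c : Matrix (Unit ⊕ k) Unit A,
    N * (((1 : Matrix (Unit ⊕ k) (Unit ⊕ k) A) - C * N) * c) = 0 := by
    intro c
    rw [← Matrix.mul_assoc, Matrix.mul_sub, ← Matrix.mul_assoc, hNC]; simp
  have hprod : ∀ (r : Matrix Unit (Unit ⊕ k) A) (c : Matrix (Unit ⊕ k) Unit A),
      (fromRows r N).det * (fromCols c C).det =
        (r * ((1 : Matrix (Unit ⊕ k) (Unit ⊕ k) A) - C * N) * c) () () := by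
    intro r c
    rw [← hadj c, ← det_mul, fromRows_mul_fromCols, hker, hNC, det_fromBlocks_zero₂₁, det_one,
      mul_one, det_unique, ← Matrix.mul_assoc]
  let u : (Unit ⊕ k) → A := fun i => (fromRows (replicateRow Unit (Pi.single i 1)) N).det
  let v : (Unit ⊕ k) → A := fun i => (fromCols (replicateCol Unit (Pi.single i 1)) C).det
  have huv : ∑ i, u i * v i = 1 := by
    have h1 : ∀ i, u i * v i = ((1 : Matrix (Unit ⊕ k) (Unit ⊕ k) A) - C * N) i i := by
      intro i
      simp only [u, v]
      rw [hprod]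
      simp [Matrix.mul_apply, replicateRow, replicateCol, Pi.single_apply]
    simp only [h1]
    change trace ((1 : Matrix (Unit ⊕ k) (Unit ⊕ k) A) - C * N) = 1
    rw [trace_sub, trace_mul_comm, hNC, trace_one, trace_one]
    simp
  have hlin : ∀ x : (Unit ⊕ k) → A, (fromCols (replicateCol Unit x) C).det = ∑ i, x i * v i := by
    intro x
    have hup : ∀ x : (Unit ⊕ k) → A, fromCols (replicateCol Unit x) C =
        (updateCol (fromCols (replicateCol Unit 0) C) (Sum.inl ()) x) := by
      intro x; ext i (j | j) <;> simp
    let f : ((Unit ⊕ k) → A) →ₗ[A] A :=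
      { toFun := fun x => (fromCols (replicateCol Unit x) C).det
        map_add' := fun x y => by rw [hup, hup x, hup y, det_updateCol_add]
        map_smul' := fun a x => by rw [hup, hup x, det_updateCol_smul]; rfl }
    change f x = _
    rw [LinearMap.pi_apply_eq_sum_univ f x]
    refine Finset.sum_congr rfl fun i _ => ?_
    rw [smul_eq_mul]
    congr 1
    change f _ = f _
    congr 1
    ext j
    simp [Pi.single_apply, eq_comm]
  refine ⟨((1 : Matrix (Unit ⊕ k) (Unit ⊕ k) A) - C * N) * replicateCol Unit u, hker _, ?_⟩
  rw [hadj, hlin, huv]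

end bdet

section elimination
open Matrix

theorem exists_isUnit_of_isUnit_sum {D ι : Type*} [Ring D] [Nonempty ι]
    (hloc : ∀ a b : D, IsUnit (a + b) → IsUnit a ∨ IsUnit b) (f : ι → D) (s : Finset ι)
    (h : IsUnit (∑ i ∈ s, f i)) : ∃ i, IsUnit (f i) := by
  classical
  induction s using Finset.induction_on with
  | empty =>
    rw [Finset.sum_empty, isUnit_zero_iff] at h
    have := subsingleton_of_zero_eq_one h
    exact ⟨Classical.arbitrary ι, isUnit_of_subsingleton _⟩
  | insert a s ha ih =>
    rw [Finset.sum_insert ha] at h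
    exact (hloc _ _ h).elim (fun h => ⟨a, h⟩) ih

/-- Over a local ring, every invertible matrix has the same determinant as a unit, for
all matrix representations of the ring simultaneously. -/
theorem exists_isUnit_forall_bdet_eq {D : Type} [Ring D]
    (hloc : ∀ a b : D, IsUnit (a + b) → IsUnit a ∨ IsUnit b)
    (hfin : ∀ a b : D, a * b = 1 → b * a = 1) (n : ℕ) :
    ∀ (m : Type) [Fintype m] [DecidableEq m], Fintype.card m = n →
    ∀ M X : Matrix m m D, X * M = 1 → ∃ d : D, IsUnit d ∧
      ∀ (A κ : Type) [CommRing A] [Fintype κ] [DecidableEq κ] (ρ : D →+* Matrix κ κ A),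
        bdet ρ M = (ρ d).det := by
  induction n with
  | zero =>
    intro m _ _ hm M X h
    have : IsEmpty m := Fintype.card_eq_zero_iff.1 hm
    refine ⟨1, isUnit_one, fun A κ _ _ _ ρ => ?_⟩
    rw [Subsingleton.elim M 1, bdet_one, map_one, det_one]
  | succ n ih =>
    intro m _ _ hm M X h
    have e : Unit ⊕ Fin n ≃ m := Fintype.equivOfCardEq (by simp [hm, add_comm])
    obtain ⟨M₁, hM₁⟩ : ∃ M₁, M₁ = M.submatrix e e := ⟨_, rfl⟩
    obtain ⟨X₁, hX₁⟩ : ∃ X₁, X₁ = X.submatrix e e := ⟨_, rfl⟩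
    have h₁ : X₁ * M₁ = 1 := by
      rw [hM₁, hX₁, submatrix_mul_equiv, h, submatrix_one_equiv]
    have hcol : ∃ i, IsUnit (M₁ i (Sum.inl ())) := by
      have hs : IsUnit (∑ i, X₁ (Sum.inl ()) i * M₁ i (Sum.inl ())) := by
        rw [← Matrix.mul_apply, h₁, one_apply_eq]; exact isUnit_one
      obtain ⟨i, u, hu⟩ := exists_isUnit_of_isUnit_sum hloc _ _ hs
      have h2 : (↑u⁻¹ * X₁ (Sum.inl ()) i) * M₁ i (Sum.inl ()) = 1 := by
        rw [mul_assoc, ← hu, Units.inv_mul]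
      exact ⟨i, ⟨⟨_, _, hfin _ _ h2, h2⟩, rfl⟩⟩
    have hE : ∃ E E' : Matrix (Unit ⊕ Fin n) (Unit ⊕ Fin n) D, E' * E = 1 ∧
        IsUnit ((E * M₁) (Sum.inl ()) (Sum.inl ())) ∧
        ∀ (A κ : Type) [CommRing A] [Fintype κ] [DecidableEq κ] (ρ : D →+* Matrix κ κ A),
          bdet ρ E = 1 := by
      by_cases h0 : IsUnit (M₁ (Sum.inl ()) (Sum.inl ()))
      · exact ⟨1, 1, by simp, by simpa using h0, fun A κ _ _ _ ρ => bdet_one ρ⟩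
      · obtain ⟨i | j, hi⟩ := hcol
        · exact absurd hi h0
        · refine ⟨fromBlocks 1 (replicateRow Unit (Pi.single j 1)) 0 1,
            fromBlocks 1 (-replicateRow Unit (Pi.single j 1)) 0 1, ?_, ?_, ?_⟩
          · simp [fromBlocks_multiply]
          · have h3 : ((fromBlocks 1 (replicateRow Unit (Pi.single j 1)) 0 1 :
              Matrix (Unit ⊕ Fin n) (Unit ⊕ Fin n) D) * M₁)
                (Sum.inl ()) (Sum.inl ()) = M₁ (Sum.inl ()) (Sum.inl ()) +
                  M₁ (Sum.inr j) (Sum.inl ()) := by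
              rw [Matrix.mul_apply, Fintype.sum_sum_type]
              simp [Pi.single_apply]
            rw [h3]
            by_contra h4
            exact h4 (((hloc _ (-M₁ (Sum.inl ()) (Sum.inl ())) (by simpa using hi))).resolve_right
              (by rwa [IsUnit.neg_iff]))
          · intro A κ _ _ _ ρ
            rw [bdet_fromBlocks_zero₂₁, bdet_one, bdet_one, one_mul]
    obtain ⟨E, E', hEE, hunit, hdet⟩ := hE
    obtain ⟨M₂, hM₂⟩ : ∃ M₂, M₂ = E * M₁ := ⟨_, rfl⟩
    rw [← hM₂] at hunit
    obtain ⟨a, b, c, d, rfl⟩ : ∃ a b c d, M₂ = fromBlocks a b c d :=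
      ⟨_, _, _, _, (fromBlocks_toBlocks M₂).symm⟩
    obtain ⟨u, hu⟩ := hunit
    have hu' : (u : D) = a () () := hu
    obtain ⟨v, hv⟩ : ∃ v : Matrix Unit Unit D, v = fun _ _ => ↑u⁻¹ := ⟨_, rfl⟩
    have hva : v * a = 1 := by
      ext i j
      rw [Matrix.mul_apply, hv]
      simp [← hu']
    have hav : a * v = 1 := by
      ext i j
      rw [Matrix.mul_apply, hv]
      simp [← hu']
    have hfac : fromBlocks a b c d = fromBlocks 1 0 (c * v) 1 *
        (fromBlocks a 0 0 (d - c * v * b) * fromBlocks 1 (v * b) 0 1) := by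
      simp only [fromBlocks_multiply, Matrix.one_mul, Matrix.mul_one, Matrix.zero_mul,
        Matrix.mul_zero, add_zero, zero_add, ← Matrix.mul_assoc, hav]
      rw [Matrix.mul_assoc c v a, hva, Matrix.mul_one]
      congr 1
      abel
    obtain ⟨Y, hY⟩ : ∃ Y, Y = fromBlocks 1 (v * b) 0 1 * (X₁ * E' * fromBlocks 1 0 (c * v) 1) :=
      ⟨_, rfl⟩
    have hYM : Y * fromBlocks a 0 0 (d - c * v * b) = 1 := by
      have hU : (fromBlocks 1 (v * b) 0 1 : Matrix (Unit ⊕ Fin n) (Unit ⊕ Fin n) D) *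
          fromBlocks 1 (-(v * b)) 0 1 = 1 := by
        simp [fromBlocks_multiply]
      have h5 : X₁ * E' * fromBlocks 1 0 (c * v) 1 * fromBlocks a 0 0 (d - c * v * b) *
          fromBlocks 1 (v * b) 0 1 = 1 := by
        rw [Matrix.mul_assoc, Matrix.mul_assoc, ← hfac, hM₂, Matrix.mul_assoc,
          ← Matrix.mul_assoc E' E, hEE, Matrix.one_mul, h₁]
      calc Y * fromBlocks a 0 0 (d - c * v * b)
          = fromBlocks 1 (v * b) 0 1 * (X₁ * E' * fromBlocks 1 0 (c * v) 1 *
              fromBlocks a 0 0 (d - c * v * b) * fromBlocks 1 (v * b) 0 1) *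
                fromBlocks 1 (-(v * b)) 0 1 := by
            rw [hY]; simp only [Matrix.mul_assoc, hU, Matrix.mul_one]
        _ = 1 := by rw [h5, Matrix.mul_one, hU]
    obtain ⟨d', hd', hdet'⟩ := ih (Fin n) (Fintype.card_fin n) (d - c * v * b) Y.toBlocks₂₂ (by
      have := congrArg toBlocks₂₂ hYM
      rw [← fromBlocks_toBlocks Y, fromBlocks_multiply, ← fromBlocks_one] at this
      simpa only [toBlocks_fromBlocks₂₂, Matrix.mul_zero, zero_add] using this)
    refine ⟨u * d', u.isUnit.mul hd', fun A κ _ _ _ ρ => ?_⟩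
    have h6 := congrArg (bdet ρ) hfac
    rw [hM₂, bdet_mul, hdet, one_mul, hM₁, bdet_submatrix, bdet_mul, bdet_mul,
      bdet_fromBlocks_zero₁₂, bdet_fromBlocks_zero₁₂, bdet_fromBlocks_zero₂₁, bdet_one, bdet_one,
      hdet', bdet_unit, ← hu'] at h6
    rw [h6, map_mul, det_mul]
    ring

end elimination

section PID
open Matrix

/-- Over matrices over a principal ideal domain, the kernel of a split surjection is completed by a
column to a matrix of determinant one. -/
theorem exists_kernel_column_of_isPrincipalIdealRing {A κ k : Type*} [CommRing A] [IsDomain A]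
    [IsPrincipalIdealRing A] [Fintype κ] [DecidableEq κ] [Nonempty κ] [Fintype k] [DecidableEq k]
    {N : Matrix k (Unit ⊕ k) (Matrix κ κ A)} {C : Matrix (Unit ⊕ k) k (Matrix κ κ A)}
    (hNC : N * C = 1) :
    ∃ K : Matrix (Unit ⊕ k) Unit (Matrix κ κ A), N * K = 0 ∧
      bdet (RingHom.id _) (fromCols K C) = 1 := by
  obtain ⟨N', hN'⟩ : ∃ N', N' = Matrix.comp _ _ _ _ _ N := ⟨_, rfl⟩
  obtain ⟨C', hC'⟩ : ∃ C', C' = Matrix.comp _ _ _ _ _ C := ⟨_, rfl⟩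
  have hNC' : N' * C' = 1 := by rw [hN', hC', ← comp_mul', hNC, comp_one']
  have hrange : LinearMap.range N'.mulVecLin = ⊤ := by
    rw [LinearMap.range_eq_top]
    intro v
    exact ⟨C' *ᵥ v, by simp [hNC']⟩
  have hrank : Module.finrank A (LinearMap.ker N'.mulVecLin) = Fintype.card κ := by
    have := Submodule.finrank_quotient_add_finrank (LinearMap.ker N'.mulVecLin)
    rw [(LinearMap.quotKerEquivOfSurjective _ (LinearMap.range_eq_top.1 hrange)).finrank_eq] at this
    simp only [Module.finrank_fintype_fun_eq_card, Fintype.card_prod, Fintype.card_sum,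
      Fintype.card_unit] at this
    rw [add_mul, one_mul] at this
    omega
  let bas : Module.Basis κ A (LinearMap.ker N'.mulVecLin) :=
    (Module.finBasisOfFinrankEq A _ hrank).reindex (Fintype.equivFin κ).symm
  let K : Matrix (Unit ⊕ k) Unit (Matrix κ κ A) :=
    of fun i _ => of fun s t => (bas t : _ → A) (i, s)
  have hNv (v) : N' *ᵥ (v - C' *ᵥ (N' *ᵥ v)) = 0 := by
    rw [mulVec_sub, mulVec_mulVec, hNC', one_mulVec, sub_self]
  let Z : Matrix Unit (Unit ⊕ k) (Matrix κ κ A) := of fun _ j => of fun t s =>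
    bas.repr ⟨Pi.single (j, s) 1 - C' *ᵥ (N' *ᵥ Pi.single (j, s) 1), hNv _⟩ t
  have hNK : N * K = 0 := by
    ext i j s t
    have := congrFun (show N' *ᵥ (bas t : _ → A) = 0 from (bas t).2) (i, s)
    simpa [hN', Matrix.mulVec, dotProduct, Fintype.sum_prod_type, Matrix.mul_apply,
      Matrix.sum_apply, K] using this
  have hKZ : K * Z + C * N = 1 := by
    apply (Matrix.comp _ _ _ _ _).injective
    rw [comp_one']
    ext ⟨i, s⟩ ⟨j, t⟩
    have h1 := congrArg (fun v : LinearMap.ker N'.mulVecLin => (v : _ → A) (i, s))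
      (bas.sum_repr ⟨Pi.single (j, t) 1 - C' *ᵥ (N' *ᵥ Pi.single (j, t) 1), hNv _⟩)
    have h2 : (C' *ᵥ (N' *ᵥ Pi.single (j, t) 1)) (i, s) =
      Matrix.comp _ _ _ _ _ (C * N) (i, s) (j, t) := by
      rw [comp_mul', ← hN', ← hC', mulVec_mulVec]
      simp
    have h3 : Matrix.comp _ _ _ _ _ (K * Z) (i, s) (j, t) =
        (Pi.single (j, t) (1 : A) : _ → A) (i, s) - (C' *ᵥ (N' *ᵥ Pi.single (j, t) 1)) (i, s) := by
      change _ = (Pi.single (j, t) (1 : A) - C' *ᵥ (N' *ᵥ Pi.single (j, t) 1) : _ → A) (i, s)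
      refine Eq.trans ?_ h1
      simp [-Module.Basis.sum_repr, Matrix.mul_apply, K, Z, mul_comm, Finset.sum_apply]
    have h4 : Matrix.comp _ _ _ _ _ (K * Z + C * N) (i, s) (j, t) =
      Matrix.comp _ _ _ _ _ (K * Z) (i, s) (j, t) + Matrix.comp _ _ _ _ _ (C * N) (i, s) (j, t) :=
        rfl
    rw [h4, h3, h2, sub_add_cancel, Pi.single_apply, Matrix.one_apply]
  obtain ⟨u, hu⟩ : ∃ u, bdet (RingHom.id _) (fromCols K C) * u = 1 :=
    ⟨bdet (RingHom.id _) (fromRows Z N), by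
      rw [← bdet_mul, fromCols_mul_fromRows, hKZ, bdet_one]⟩
  let i₀ : κ := Classical.arbitrary κ
  refine ⟨K * (of fun _ _ => diagonal (Function.update 1 i₀ u) : Matrix Unit Unit (Matrix κ κ A)),
    ?_, ?_⟩
  · rw [← Matrix.mul_assoc, hNK, Matrix.zero_mul]
  · rw [bdet_fromCols_mul, RingHom.id_apply, of_apply, det_diagonal,
      Finset.prod_update_of_mem (Finset.mem_univ _)]
    simpa using hu

end PID

/-- The quaternion order `A[i, j]` with `i² = b i - 1`, `j² = -1` and `j i = (b - i) j`. -/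
abbrev Lam (A : Type*) [CommRing A] (b : A) : Type _ := QuaternionAlgebra A (-1) b (-1)

/-- The quadratic extension `A[i]` with `i² = b i - 1`. -/
abbrev Sq (A : Type*) [CommRing A] (b : A) : Type _ := QuadraticAlgebra A (-1) b

section Lam
open Matrix
variable {A A' A'' : Type*} [CommRing A] [CommRing A'] [CommRing A''] {b : A} {b' : A'} {b'' : A''}

/-- The quaternion `α + β j`. -/
def lamMk (α β : Sq A b) : Lam A b := ⟨α.re, α.im, β.re, β.im⟩

/-- The component `α` of `α + β j`. -/
def lamFst (q : Lam A b) : Sq A b := ⟨q.re, q.imI⟩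

/-- The component `β` of `α + β j`. -/
def lamSnd (q : Lam A b) : Sq A b := ⟨q.imJ, q.imK⟩

@[simp] theorem lamFst_lamMk (α β : Sq A b) : lamFst (lamMk α β) = α := rfl
@[simp] theorem lamSnd_lamMk (α β : Sq A b) : lamSnd (lamMk α β) = β := rfl
@[simp] theorem lamMk_fst_snd (q : Lam A b) : lamMk (lamFst q) (lamSnd q) = q := rfl

@[simp] theorem lamFst_zero : lamFst (0 : Lam A b) = 0 := rfl
@[simp] theorem lamSnd_zero : lamSnd (0 : Lam A b) = 0 := rfl
@[simp] theorem lamFst_one : lamFst (1 : Lam A b) = 1 := rfl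
@[simp] theorem lamSnd_one : lamSnd (1 : Lam A b) = 0 := rfl

theorem lamFst_mul (p q : Lam A b) :
    lamFst (p * q) = lamFst p * lamFst q - lamSnd p * star (lamSnd q) := by
  ext <;> simp [lamFst, lamSnd] <;> ring

theorem lamSnd_mul (p q : Lam A b) :
    lamSnd (p * q) = lamFst p * lamSnd q + lamSnd p * star (lamFst q) := by
  ext <;> simp [lamFst, lamSnd] <;> ring

/-- The left regular representation of `Lam A b` over `Sq A b`. -/
def quatRep : Lam A b →+* Matrix (Fin 2) (Fin 2) (Sq A b) where
  toFun q := !![lamFst q, lamSnd q; -star (lamSnd q), star (lamFst q)]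
  map_one' := by
    ext i j <;> fin_cases i <;> fin_cases j <;>
      simp [lamFst, lamSnd, QuadraticAlgebra.re_one, QuadraticAlgebra.im_one]
  map_zero' := by
    ext i j <;> fin_cases i <;> fin_cases j <;> simp [lamFst, lamSnd]
  map_add' p q := by
    ext i j <;> fin_cases i <;> fin_cases j <;> simp [lamFst, lamSnd] <;> ring
  map_mul' p q := by
    rw [lamFst_mul, lamSnd_mul]
    ext1 i j
    fin_cases i <;> fin_cases j <;> simp [Matrix.mul_apply, Fin.sum_univ_two] <;> ring

theorem quatRep_apply (q : Lam A b) :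
    quatRep q = !![lamFst q, lamSnd q; -star (lamSnd q), star (lamFst q)] := rfl

/-- The reduced norm. -/
def nr (q : Lam A b) : A := (lamFst q).norm + (lamSnd q).norm

theorem det_quatRep (q : Lam A b) : (quatRep q).det = algebraMap A _ (nr q) := by
  rw [quatRep_apply, det_fin_two_of, nr, map_add, QuadraticAlgebra.algebraMap_norm_eq_mul_star,
    QuadraticAlgebra.algebraMap_norm_eq_mul_star]
  ring

theorem nr_mul (p q : Lam A b) : nr (p * q) = nr p * nr q := by
  apply QuadraticAlgebra.algebraMap_injective (a := (-1 : A)) (b := b)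
  rw [map_mul, ← det_quatRep, map_mul, det_mul, det_quatRep, det_quatRep]

theorem nr_one : nr (1 : Lam A b) = 1 := by
  apply QuadraticAlgebra.algebraMap_injective (a := (-1 : A)) (b := b)
  rw [← det_quatRep, map_one, det_one, map_one]

theorem nr_eq (q : Lam A b) : nr q =
    q.re * q.re + b * q.re * q.imI + q.imI * q.imI +
      (q.imJ * q.imJ + b * q.imJ * q.imK + q.imK * q.imK) := by
  simp [nr, lamFst, lamSnd, QuadraticAlgebra.norm_def]

theorem mul_star_eq_nr (q : Lam A b) : q * star q = algebraMap A _ (nr q) := by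
  rw [nr_eq]
  ext <;> simp [QuaternionAlgebra.algebraMap_eq] <;> ring

theorem star_mul_eq_nr (q : Lam A b) : star q * q = algebraMap A _ (nr q) := by
  rw [nr_eq]
  ext <;> simp [QuaternionAlgebra.algebraMap_eq] <;> ring

theorem isUnit_lam_iff {q : Lam A b} : IsUnit q ↔ IsUnit (nr q) := by
  constructor
  · rintro ⟨u, rfl⟩
    exact IsUnit.of_mul_eq_one (nr (↑u⁻¹ : Lam A b)) (by rw [← nr_mul, Units.mul_inv, nr_one])
  · rintro ⟨u, hu⟩
    refine ⟨⟨q, star q * algebraMap A _ (↑u⁻¹), ?_, ?_⟩, rfl⟩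
    · rw [← mul_assoc, mul_star_eq_nr, ← map_mul, ← hu, Units.mul_inv, map_one]
    · rw [mul_assoc, Algebra.commutes, ← mul_assoc, star_mul_eq_nr, ← map_mul, ← hu, Units.mul_inv,
        map_one]

theorem lam_mul_eq_one_comm (p q : Lam A b) (h : p * q = 1) : q * p = 1 := by
  have hp : IsUnit p := isUnit_lam_iff.2 (.of_mul_eq_one (nr q) (by rw [← nr_mul, h, nr_one]))
  obtain ⟨u, rfl⟩ := hp
  rw [Units.mul_eq_one_iff_inv_eq.1 h |>.symm, Units.inv_mul]

/-- Functoriality of `Sq` in the base ring. -/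
def sqMap (f : A →+* A') (h : f b = b') : Sq A b →+* Sq A' b' where
  toFun z := ⟨f z.re, f z.im⟩
  map_one' := by ext <;> simp [QuadraticAlgebra.re_one, QuadraticAlgebra.im_one]
  map_zero' := by ext <;> simp
  map_add' x y := by ext <;> simp
  map_mul' x y := by ext <;> simp [h]

/-- Functoriality of `Lam` in the base ring. -/
def lamMap (f : A →+* A') (h : f b = b') : Lam A b →+* Lam A' b' where
  toFun q := ⟨f q.re, f q.imI, f q.imJ, f q.imK⟩
  map_one' := by ext <;> simp
  map_zero' := by ext <;> simp
  map_add' x y := by ext <;> simp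
  map_mul' x y := by ext <;> simp [h]

theorem quatRep_lamMap (f : A →+* A') (h : f b = b') :
    (quatRep (A := A')).comp (lamMap f h) = ((sqMap f h).mapMatrix).comp quatRep := by
  ext q i j <;> fin_cases i <;> fin_cases j <;>
    simp [quatRep_apply, lamMap, sqMap, lamFst, lamSnd, h]

theorem nr_lamMap (f : A →+* A') (h : f b = b') (q : Lam A b) : nr (lamMap f h q) = f (nr q) := by
  simp [nr_eq, lamMap, h]

theorem quatRep_fst (q : Lam A b) : quatRep q 0 0 = lamFst q := rfl

theorem quatRep_snd (q : Lam A b) : quatRep q 0 1 = lamSnd q := rfl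

theorem lamFst_sum {ι : Type*} (s : Finset ι) (f : ι → Lam A b) :
    lamFst (∑ i ∈ s, f i) = ∑ i ∈ s, lamFst (f i) := by
  simp only [← quatRep_fst, map_sum, Matrix.sum_apply]

theorem lamSnd_sum {ι : Type*} (s : Finset ι) (f : ι → Lam A b) :
    lamSnd (∑ i ∈ s, f i) = ∑ i ∈ s, lamSnd (f i) := by
  simp only [← quatRep_snd, map_sum, Matrix.sum_apply]

theorem lam_ext {p q : Lam A b} (h1 : lamFst p = lamFst q) (h2 : lamSnd p = lamSnd q) : p = q := by
  rw [← lamMk_fst_snd p, h1, h2, lamMk_fst_snd]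

theorem exists_left_inverse_of_isUnit_bdet {m : Type*} [Fintype m] [DecidableEq m]
    {M : Matrix m m (Lam A b)} (h : IsUnit (bdet quatRep M)) : ∃ V, V * M = 1 := by
  obtain ⟨X, hX⟩ : ∃ X, X * Matrix.comp _ _ _ _ _ (M.map quatRep) = 1 :=
    ⟨_, nonsing_inv_mul _ h⟩
  refine ⟨of fun i j => lamMk (X (i, 0) (j, 0)) (X (i, 0) (j, 1)), ?_⟩
  ext1 i j
  have h0 := congrFun (congrFun hX (i, 0)) (j, 0)
  have h1 := congrFun (congrFun hX (i, 0)) (j, 1)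
  rw [Matrix.mul_apply, Fintype.sum_prod_type] at h0 h1
  rw [Matrix.mul_apply]
  apply lam_ext
  · rw [lamFst_sum]
    simp only [lamFst_mul, of_apply, lamFst_lamMk, lamSnd_lamMk]
    simp only [Fin.sum_univ_two, comp_apply, map_apply, quatRep_apply] at h0
    simp only [of_apply, cons_val', cons_val_zero, cons_val_one] at h0
    convert h0 using 1
    · simp [sub_eq_add_neg]
    · by_cases hij : i = j
      · subst hij; simp
      · simp [hij]
  · rw [lamSnd_sum]
    simp only [lamSnd_mul, of_apply, lamFst_lamMk, lamSnd_lamMk]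
    simp only [Fin.sum_univ_two, comp_apply, map_apply, quatRep_apply] at h1
    simp only [of_apply, cons_val', cons_val_zero, cons_val_one] at h1
    convert h1 using 1
    by_cases hij : i = j
    · subst hij; simp
    · simp [hij]

theorem exists_inverse_of_isUnit_bdet {m : Type*} [Fintype m] [DecidableEq m]
    {M : Matrix m m (Lam A b)} (h : IsUnit (bdet quatRep M)) : ∃ V, V * M = 1 ∧ M * V = 1 := by
  obtain ⟨V, hV⟩ := exists_left_inverse_of_isUnit_bdet h
  have h' : IsUnit (bdet quatRep V) :=
    .of_mul_eq_one (bdet quatRep M) (by rw [← bdet_mul, hV, bdet_one])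
  obtain ⟨W, hW⟩ := exists_left_inverse_of_isUnit_bdet h'
  have : W = M := by
    rw [← Matrix.mul_one W, ← hV, ← Matrix.mul_assoc, hW, Matrix.one_mul]
  exact ⟨V, hV, this ▸ hW⟩

end Lam

section Euclid
open QuadraticAlgebra

theorem isPrincipalIdealRing_of_norm {S : Type*} [CommRing S] (F : S → ℕ)
    (h : ∀ a d, d ≠ 0 → ∃ q, F (d * q + a) < F d) : IsPrincipalIdealRing S := by
  refine ⟨fun I => ?_⟩
  by_cases hI : ∃ d ∈ I, d ≠ 0
  · obtain ⟨d, ⟨hdI, hd⟩, hmin⟩ : ∃ d, (d ∈ I ∧ d ≠ 0) ∧ ∀ e, e ∈ I ∧ e ≠ 0 → F d ≤ F e := by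
      obtain ⟨d, hd⟩ := hI
      exact ⟨_, Function.argminOn_mem F {d | d ∈ I ∧ d ≠ 0} ⟨d, hd⟩,
        fun e he => Function.argminOn_le F {d | d ∈ I ∧ d ≠ 0} he⟩
    refine ⟨d, le_antisymm (fun a ha => ?_) ((Ideal.span_singleton_le_iff_mem I).2 hdI)⟩
    obtain ⟨q, hq⟩ := h a d hd
    have h0 : d * q + a = 0 := by
      by_contra h0
      exact absurd (hmin _ ⟨I.add_mem (I.mul_mem_right q hdI) ha, h0⟩) (by omega)
    exact Ideal.mem_span_singleton.2 ⟨-q, by linear_combination h0⟩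
  · push Not at hI
    refine ⟨0, le_antisymm (fun a ha => ?_) ?_⟩
    · rw [hI a ha]; exact Submodule.zero_mem _
    · simp

/-- The ring `ℤ[√3]`. -/
abbrev Zs : Type := QuadraticAlgebra ℤ 3 0

/-- The element `√3` of `ℤ[√3]`. -/
def srt : Zs := ⟨0, 1⟩

@[simp] theorem srt_re : srt.re = 0 := rfl
@[simp] theorem srt_im : srt.im = 1 := rfl

/-- A planar hexagonal form together with a linear form. -/
def hexLin (l₁ l₂ x y : ℚ) : ℚ := x ^ 2 + x * y + y ^ 2 + l₁ * x + l₂ * y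

theorem hexLin_neg (l₁ l₂ x y : ℚ) : hexLin (-l₁) (-l₂) x y = hexLin l₁ l₂ (-x) (-y) := by
  simp only [hexLin]; ring

theorem exists_hexLin_le_of_add_le_one (l₁ l₂ : ℚ) {x y : ℚ} (hx : 0 ≤ x) (hy : 0 ≤ y)
    (hxy : x + y ≤ 1) :
    hexLin l₁ l₂ x y ≤ 1 / 3 ∨ hexLin l₁ l₂ (x - 1) y ≤ 1 / 3 ∨ hexLin l₁ l₂ x (y - 1) ≤ 1 / 3 := by
  by_contra! h
  obtain ⟨h0, h1, h2⟩ := h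
  have hid : (1 - (x + y)) * (hexLin l₁ l₂ x y - 1 / 3) + x * (hexLin l₁ l₂ (x - 1) y - 1 / 3) +
      y * (hexLin l₁ l₂ x (y - 1) - 1 / 3) =
        - ((x - 1 / 3 + (y - 1 / 3) / 2) ^ 2 + 3 / 4 * (y - 1 / 3) ^ 2) := by
    simp only [hexLin]; ring
  have s0 := mul_nonneg (sub_nonneg.2 hxy) (sub_nonneg.2 h0.le)
  have s1 := mul_nonneg hx (sub_nonneg.2 h1.le)
  have s2 := mul_nonneg hy (sub_nonneg.2 h2.le)
  have q1 := sq_nonneg (x - 1 / 3 + (y - 1 / 3) / 2)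
  have q2 := sq_nonneg (y - 1 / 3)
  have hy' : y = 1 / 3 := by
    have : (y - 1 / 3) ^ 2 = 0 := by linarith
    linarith [pow_eq_zero_iff (two_ne_zero) |>.1 this]
  have hx' : x = 1 / 3 := by
    have : (x - 1 / 3 + (y - 1 / 3) / 2) ^ 2 = 0 := by linarith
    linarith [pow_eq_zero_iff (two_ne_zero) |>.1 this]
  subst hx' hy'
  linarith

theorem exists_shift_hexLin_le (l₁ l₂ p₁ p₂ : ℚ) :
    ∃ n₁ n₂ : ℤ, hexLin l₁ l₂ (p₁ + n₁) (p₂ + n₂) ≤ 1 / 3 := by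
  have e₁ := Int.self_sub_floor p₁
  have e₂ := Int.self_sub_floor p₂
  rcases le_total (Int.fract p₁ + Int.fract p₂) 1 with h | h
  · rcases exists_hexLin_le_of_add_le_one l₁ l₂ (Int.fract_nonneg p₁) (Int.fract_nonneg p₂) h
      with h | h | h
    · refine ⟨-⌊p₁⌋, -⌊p₂⌋, ?_⟩
      convert h using 2 <;> push_cast <;> linarith
    · refine ⟨-⌊p₁⌋ - 1, -⌊p₂⌋, ?_⟩
      convert h using 2 <;> push_cast <;> linarith
    · refine ⟨-⌊p₁⌋, -⌊p₂⌋ - 1, ?_⟩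
      convert h using 2 <;> push_cast <;> linarith
  · rcases exists_hexLin_le_of_add_le_one (-l₁) (-l₂)
      (sub_nonneg.2 (Int.fract_lt_one p₁).le) (sub_nonneg.2 (Int.fract_lt_one p₂).le)
      (by linarith) with h | h | h <;> rw [hexLin_neg] at h
    · refine ⟨-⌊p₁⌋ - 1, -⌊p₂⌋ - 1, ?_⟩
      convert h using 2 <;> push_cast <;> linarith
    · refine ⟨-⌊p₁⌋, -⌊p₂⌋ - 1, ?_⟩
      convert h using 2 <;> push_cast <;> linarith
    · refine ⟨-⌊p₁⌋ - 1, -⌊p₂⌋, ?_⟩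
      convert h using 2 <;> push_cast <;> linarith

theorem exists_norm_mul_add_le (a b : ℤ) (ha : 0 < a) (N : ℤ) (hN : 0 < N) (c : Sq Zs srt) :
    ∃ x : Sq Zs srt, 3 * (a * (norm ((N : Sq Zs srt) * x + c)).re +
      3 * b * (norm ((N : Sq Zs srt) * x + c)).im) ≤ 2 * a * N ^ 2 := by
  have ha' : (0 : ℚ) < a := by exact_mod_cast ha
  have hN' : (0 : ℚ) < N := by exact_mod_cast hN
  obtain ⟨m₁, m₂, hm⟩ := exists_shift_hexLin_le 0 0 ((c.im.re + c.re.im) / N : ℚ) (c.re.im / N)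
  set q₁ : ℚ := (c.im.re + c.re.im) / N + m₁ with hq₁
  set q₂ : ℚ := c.re.im / N + m₂ with hq₂
  set r : ℚ := 3 * b / a with hr
  obtain ⟨n₁, n₂, hn⟩ := exists_shift_hexLin_le (r * (q₁ + q₂)) (r * q₁)
    ((c.re.re + c.im.im) / N : ℚ) (c.im.im / N)
  set p₁ : ℚ := (c.re.re + c.im.im) / N + n₁ with hp₁
  set p₂ : ℚ := c.im.im / N + n₂ with hp₂
  have hre : ((c.re.re : ℚ) = N * (p₁ - p₂ - n₁ + n₂)) := by rw [hp₁, hp₂]; field_simp; ring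
  have hri : ((c.re.im : ℚ) = N * (q₂ - m₂)) := by rw [hq₂]; field_simp; ring
  have hir : ((c.im.re : ℚ) = N * (q₁ - q₂ - m₁ + m₂)) := by rw [hq₁, hq₂]; field_simp; ring
  have hii : ((c.im.im : ℚ) = N * (p₂ - n₂)) := by rw [hp₂]; field_simp; ring
  clear_value p₁ p₂ q₁ q₂ r
  obtain ⟨x, hx⟩ : ∃ x : Sq Zs srt, x = ⟨⟨n₁ - n₂, m₂⟩, ⟨m₁ - m₂, n₂⟩⟩ := ⟨_, rfl⟩
  refine ⟨x, ?_⟩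
  have hN1 : (N : Sq Zs srt).re = N := by simp
  have hN2 : (N : Sq Zs srt).im = 0 := by simp
  have hra : r * a = 3 * b := by rw [hr]; field_simp
  simp only [hexLin] at hm hn
  have key := mul_le_mul_of_nonneg_left (add_le_add hm hn)
    (show (0:ℚ) ≤ 3 * a * N ^ 2 by positivity)
  have key' : (3 * (a * (norm ((N : Sq Zs srt) * x + c)).re +
      3 * b * (norm ((N : Sq Zs srt) * x + c)).im) : ℚ) ≤
        2 * a * N ^ 2 := by
    refine le_trans (le_of_eq ?_) (key.trans (le_of_eq (by ring)))
    simp [hx, norm_def, hN1, hN2, hre, hri, hir, hii]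
    linear_combination (-3 * N ^ 2 * (p₁ * q₁ + p₁ * q₂ + p₂ * q₁)) * hra
  exact_mod_cast key'

/-- The two real embeddings of `ℤ[√3]`, indexed by a square root of `3`. -/
def zsReal (ρ : ℝ) (hρ : ρ * ρ = 3) : Zs →+* ℝ :=
  (QuadraticAlgebra.lift (R := ℤ) ⟨ρ, by simp [hρ]⟩ : Zs →ₐ[ℤ] ℝ)

theorem zsReal_apply (ρ : ℝ) (hρ : ρ * ρ = 3) (z : Zs) : zsReal ρ hρ z = z.re + z.im * ρ := by
  simp [zsReal, QuadraticAlgebra.lift]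

theorem sqrt_three_mul_self : √(3 : ℝ) * √3 = 3 := by norm_num

theorem neg_sqrt_three_mul_self : -√(3 : ℝ) * -√3 = 3 := by norm_num

theorem zsReal_eq_zero {ρ : ℝ} {hρ : ρ * ρ = 3} {z : Zs} (h : zsReal ρ hρ z = 0) : z = 0 := by
  have hirr : Irrational ρ := by
    have h3 : Irrational √(3 : ℝ) := by simpa using Nat.Prime.irrational_sqrt (p := 3) (by norm_num)
    have : (ρ - √3) * (ρ + √3) = 0 := by linear_combination hρ - sqrt_three_mul_self
    rcases mul_eq_zero.1 this with h | h
    · rwa [sub_eq_zero.1 h]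
    · rw [eq_neg_of_add_eq_zero_left h]; exact h3.neg
  rw [zsReal_apply] at h
  have him : z.im = 0 := by
    by_contra him
    exact (hirr.intCast_mul him).ne_int (-z.re) (by push_cast; linarith)
  ext
  · simpa [him] using h
  · exact him

/-- The inclusion of base rings respects the two real forms, so norms are totally nonnegative. -/
theorem map_norm_nonneg {A : Type*} [CommRing A] {b : A} (f : A →+* ℝ) (hb : f b ^ 2 < 4)
    (z : Sq A b) : 0 ≤ f z.norm := by
  simp only [norm_def, map_sub, map_add, map_mul, map_neg, map_one]
  nlinarith [sq_nonneg (2 * f z.re + f b * f z.im), sq_nonneg (f z.im),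
    mul_nonneg (sub_nonneg.2 hb.le) (sq_nonneg (f z.im))]

theorem zs_ringHom_sq (f : Zs →+* ℝ) : f srt ^ 2 < 4 := by
  have : f srt ^ 2 = 3 := by
    rw [← map_pow, show srt ^ 2 = 3 by ext <;> simp [pow_two, srt]]
    exact map_ofNat f 3
  linarith

theorem zs_norm_eq (z : Zs) : (z.norm : ℝ) =
    zsReal _ sqrt_three_mul_self z * zsReal _ neg_sqrt_three_mul_self z := by
  simp only [zsReal_apply, norm_def]
  push_cast
  linear_combination (z.im ^ 2 : ℝ) * sqrt_three_mul_self

theorem zs_re_nonneg {z : Zs} (h : ∀ f : Zs →+* ℝ, 0 ≤ f z) : 0 ≤ z.re := by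
  have h1 := h (zsReal _ sqrt_three_mul_self)
  have h2 := h (zsReal _ neg_sqrt_three_mul_self)
  rw [zsReal_apply] at h1 h2
  have : (0 : ℝ) ≤ z.re := by linarith
  exact_mod_cast this

theorem zs_norm_nonneg {z : Zs} (h : ∀ f : Zs →+* ℝ, 0 ≤ f z) : 0 ≤ z.norm := by
  have : (0 : ℝ) ≤ z.norm := by
    rw [zs_norm_eq]
    exact mul_nonneg (h _) (h _)
  exact_mod_cast this

theorem zs_norm_norm_nonneg (z : Sq Zs srt) : 0 ≤ z.norm.norm := by
  have : (0 : ℝ) ≤ z.norm.norm := by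
    rw [zs_norm_eq]
    exact mul_nonneg (map_norm_nonneg _ (zs_ringHom_sq _) _) (map_norm_nonneg _ (zs_ringHom_sq _) _)
  exact_mod_cast this

theorem zs_norm_eq_zero {z : Zs} (h : z.norm = 0) : z = 0 := by
  have h' : (z.norm : ℝ) = 0 := by exact_mod_cast h
  rw [zs_norm_eq] at h'
  rcases mul_eq_zero.1 h' with h | h <;> exact zsReal_eq_zero h

theorem zs_norm_norm_eq_zero {z : Sq Zs srt} (h : z.norm.norm = 0) : z = 0 := by
  have h' := congrArg QuadraticAlgebra.re (zs_norm_eq_zero h)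
  simp [norm_def] at h'
  have a1 : z.re.re + z.re.re + 3 * z.im.im = 0 := by
    nlinarith [sq_nonneg (2 * z.re.re + 3 * z.im.im), sq_nonneg (2 * z.im.re + 3 * z.re.im),
      sq_nonneg z.im.im, sq_nonneg z.re.im]
  have a2 : 2 * z.im.re + 3 * z.re.im = 0 := by
    nlinarith [sq_nonneg (2 * z.re.re + 3 * z.im.im), sq_nonneg (2 * z.im.re + 3 * z.re.im),
      sq_nonneg z.im.im, sq_nonneg z.re.im]
  have a3 : z.im.im = 0 := by
    nlinarith [sq_nonneg (2 * z.re.re + 3 * z.im.im), sq_nonneg (2 * z.im.re + 3 * z.re.im),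
      sq_nonneg z.im.im, sq_nonneg z.re.im]
  have a4 : z.re.im = 0 := by
    nlinarith [sq_nonneg (2 * z.re.re + 3 * z.im.im), sq_nonneg (2 * z.im.re + 3 * z.re.im),
      sq_nonneg z.im.im, sq_nonneg z.re.im]
  ext <;> simp <;> omega

theorem noZeroDivisors_of_norm {S : Type*} [CommRing S] [Nontrivial S] (F : S →* ℤ)
    (h0 : ∀ z, F z = 0 → z = 0) (h1 : F 0 = 0) : IsDomain S := by
  have : NoZeroDivisors S := ⟨fun {a b} hab => by
    have := congrArg F hab
    rw [map_mul, h1] at this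
    exact (mul_eq_zero.1 this).imp (h0 a) (h0 b)⟩
  exact NoZeroDivisors.to_isDomain S

instance : Nontrivial (Sq Zs srt) := ⟨0, 1, fun h => by simpa using congrArg (fun z => z.re.re) h⟩

instance : Nontrivial (Sq ℤ 0) := ⟨0, 1, fun h => by simpa using congrArg (fun z => z.re) h⟩

instance : IsDomain (Sq Zs srt) :=
  noZeroDivisors_of_norm ((QuadraticAlgebra.norm).comp QuadraticAlgebra.norm)
    (fun _ h => zs_norm_norm_eq_zero h) (by simp)

theorem int_norm_eq (z : Sq ℤ 0) : z.norm = z.re ^ 2 + z.im ^ 2 := by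
  simp [norm_def]; ring

theorem int_norm_eq_zero {z : Sq ℤ 0} (h : z.norm = 0) : z = 0 := by
  rw [int_norm_eq] at h
  have h1 : z.re = 0 := by nlinarith [sq_nonneg z.re, sq_nonneg z.im]
  have h2 : z.im = 0 := by nlinarith [sq_nonneg z.re, sq_nonneg z.im]
  ext <;> simp [h1, h2]

instance : IsDomain (Sq ℤ 0) :=
  noZeroDivisors_of_norm QuadraticAlgebra.norm (fun _ h => int_norm_eq_zero h) (by simp)

theorem exists_two_mul_abs_le (N : ℤ) (hN : 0 < N) (c : ℤ) : ∃ n, 2 * |N * n + c| ≤ N := by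
  refine ⟨-((2 * c + N) / (2 * N)), ?_⟩
  have h1 := Int.mul_ediv_add_emod (2 * c + N) (2 * N)
  have h2 := Int.emod_nonneg (2 * c + N) (show (2 * N) ≠ 0 by omega)
  have h3 := Int.emod_lt_of_pos (2 * c + N) (show 0 < 2 * N by omega)
  generalize (2 * c + N) / (2 * N) = q at *
  generalize (2 * c + N) % (2 * N) = r at *
  rcases abs_cases (N * -q + c) with ⟨h, _⟩ | ⟨h, _⟩ <;> rw [h] <;> nlinarith

theorem exists_int_norm_mul_add_le (N : ℤ) (hN : 0 < N) (c : Sq ℤ 0) :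
    ∃ x : Sq ℤ 0, 2 * (norm ((N : Sq ℤ 0) * x + c)) ≤ N ^ 2 := by
  obtain ⟨x, hx⟩ := exists_two_mul_abs_le N hN c.re
  obtain ⟨y, hy⟩ := exists_two_mul_abs_le N hN c.im
  refine ⟨⟨x, y⟩, ?_⟩
  have hN1 : (N : Sq ℤ 0).re = N := by simp
  have hN2 : (N : Sq ℤ 0).im = 0 := by simp
  rw [int_norm_eq]
  simp only [re_add, re_mul, im_add, im_mul, hN1, hN2]
  have e1 : N * x + -1 * 0 * y + c.re = N * x + c.re := by ring
  have e2 : N * y + 0 * x + 0 * 0 * y + c.im = N * y + c.im := by ring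
  rw [e1, e2, ← sq_abs (N * x + c.re), ← sq_abs (N * y + c.im)]
  nlinarith [abs_nonneg (N * x + c.re), abs_nonneg (N * y + c.im)]

instance : IsPrincipalIdealRing (Sq ℤ 0) := by
  refine isPrincipalIdealRing_of_norm (fun z => z.norm.natAbs) fun a d hd => ?_
  have hpos : 0 < d.norm := by
    refine lt_of_le_of_ne ?_ fun h => hd (int_norm_eq_zero h.symm)
    rw [int_norm_eq]; positivity
  obtain ⟨x, hx⟩ := exists_int_norm_mul_add_le d.norm hpos (star d * a)
  refine ⟨x, ?_⟩
  have h1 : ((d.norm : ℤ) : Sq ℤ 0) * x + star d * a = star d * (d * x + a) := by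
    have : ((d.norm : ℤ) : Sq ℤ 0) = d * star d := by
      rw [← algebraMap_norm_eq_mul_star]; simp
    rw [this]; ring
  rw [h1, map_mul, QuadraticAlgebra.norm_star] at hx
  have h2 : 0 ≤ (d * x + a).norm := by rw [int_norm_eq]; positivity
  have : (d * x + a).norm < d.norm := by nlinarith
  zify
  rwa [abs_of_nonneg h2, abs_of_pos hpos]

theorem zs_star_mul_self (z : Zs) : z * star z = ((z.norm : ℤ) : Zs) := by
  rw [← algebraMap_norm_eq_mul_star]; simp

instance : IsPrincipalIdealRing (Sq Zs srt) := by
  refine isPrincipalIdealRing_of_norm (fun z => z.norm.norm.natAbs) fun a d hd => ?_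
  have hpos : 0 < d.norm.norm :=
    lt_of_le_of_ne (zs_norm_norm_nonneg d) fun h => hd (zs_norm_norm_eq_zero h.symm)
  obtain ⟨e, he⟩ : ∃ e : Sq Zs srt, e = star d * algebraMap Zs _ (star d.norm) := ⟨_, rfl⟩
  obtain ⟨x, hx⟩ := exists_norm_mul_add_le 1 0 one_pos d.norm.norm hpos (e * a)
  refine ⟨x, ?_⟩
  have h1 : ((d.norm.norm : ℤ) : Sq Zs srt) * x + e * a = e * (d * x + a) := by
    have : ((d.norm.norm : ℤ) : Sq Zs srt) = d * e := by
      rw [he, ← mul_assoc, ← algebraMap_norm_eq_mul_star, ← map_mul, zs_star_mul_self]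
      simp
    rw [this]; ring
  have h2 := zs_norm_norm_nonneg (d * x + a)
  have h3 := zs_norm_norm_nonneg (e * (d * x + a))
  have h4 : (e * (d * x + a)).norm.norm = d.norm.norm ^ 3 * (d * x + a).norm.norm := by
    rw [map_mul, map_mul, he, map_mul, map_mul, QuadraticAlgebra.norm_star,
      QuadraticAlgebra.norm_algebraMap, map_pow,
      QuadraticAlgebra.norm_star]
    ring
  have h6 : 0 ≤ ((e * (d * x + a)).norm).re :=
    zs_re_nonneg fun f => map_norm_nonneg f (zs_ringHom_sq f) _
  have h5 : (e * (d * x + a)).norm.norm ≤ ((e * (d * x + a)).norm).re ^ 2 := by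
    rw [norm_def]
    nlinarith [sq_nonneg ((e * (d * x + a)).norm).im]
  rw [h1] at hx
  have : (d * x + a).norm.norm < d.norm.norm := by
    rw [h4] at h5
    generalize (d * x + a).norm.norm = u at *
    generalize d.norm.norm = N at *
    generalize ((e * (d * x + a)).norm).re = A at *
    have hA : A ^ 2 * 9 ≤ 4 * N ^ 4 := by nlinarith
    have h7 : N ^ 3 * (9 * u) ≤ N ^ 3 * (4 * N) := by nlinarith
    have := le_of_mul_le_mul_left h7 (by positivity)
    linarith
  zify
  rwa [abs_of_nonneg h2, abs_of_pos hpos]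

/-- The value at `(s, t)` of the binary hermitian form with Gram matrix `(α, β; star β, γ)`. -/
def herm {A : Type*} [CommRing A] {b : A} (α γ : A) (β s t : Sq A b) : A :=
  α * norm s + trace (s * star t * β) + γ * norm t

section
variable {A : Type*} [CommRing A] {b : A}

theorem herm_change (α γ : A) (β x s t : Sq A b) :
    herm (herm α γ β x 1) α (algebraMap A _ α * x + star β) s t = herm α γ β (s * x + t) s := by
  apply algebraMap_injective (a := (-1 : A)) (b := b)
  simp only [herm, map_add, map_mul, algebraMap_trace_eq_add_star, algebraMap_norm_eq_mul_star,
    star_add, star_mul', star_star, star_one]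
  have h : star (algebraMap A (Sq A b) α) = algebraMap A _ α := by ext <;> simp
  rw [h]
  ring

theorem herm_mul (α γ : A) (β x : Sq A b) :
    herm α γ β x 1 * α = norm (algebraMap A _ α * x + star β) + (α * γ - norm β) := by
  apply algebraMap_injective (a := (-1 : A)) (b := b)
  simp only [herm, map_add, map_sub, map_mul, algebraMap_trace_eq_add_star,
    algebraMap_norm_eq_mul_star,
    star_add, star_mul', star_star, star_one]
  have h : star (algebraMap A (Sq A b) α) = algebraMap A _ α := by ext <;> simp
  rw [h]
  ring

theorem herm_scale (α γ : A) (β μ ν s t : Sq A b) (h : μ * star ν = 1) :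
    herm (α * norm μ) (γ * norm ν) β s t = herm α γ β (μ * s) (ν * t) := by
  apply algebraMap_injective (a := (-1 : A)) (b := b)
  have h' : star μ * ν = 1 := by simpa [mul_comm] using congrArg star h
  simp only [herm, map_add, map_mul, algebraMap_trace_eq_add_star, algebraMap_norm_eq_mul_star,
    star_mul', star_star]
  linear_combination (-s * star t * β) * h - star s * t * star β * h'

theorem map_herm_nonneg (f : A →+* ℝ) (hb : f b ^ 2 < 4) {α γ : A} {β : Sq A b}
    (h : α * γ = norm β + 1) (hα : 0 ≤ f α) (x : Sq A b) : 0 ≤ f (herm α γ β x 1) := by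
  have h1 := congrArg f (herm_mul α γ β x)
  rw [h, map_mul, map_add] at h1
  have h2 := map_norm_nonneg f hb (algebraMap A _ α * x + star β)
  have h3 : f (norm β + 1 - norm β) = 1 := by simp
  rw [h3] at h1
  by_contra! h4
  nlinarith

theorem herm_one_one_zero (β : Sq A b) (γ : A) : herm 1 γ β 1 0 = 1 := by
  simp [herm]

end

theorem exists_herm_eq_one_int (α γ : ℤ) (β : Sq ℤ 0) (h : α * γ = norm β + 1)
    (hα : ∀ f : ℤ →+* ℝ, 0 ≤ f α) : ∃ s t, herm α γ β s t = 1 := by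
  obtain ⟨n, hn⟩ : ∃ n : ℕ, α.toNat = n := ⟨_, rfl⟩
  induction n using Nat.strong_induction_on generalizing α γ β with
  | _ n ih =>
    have hα0 : 0 ≤ α := by simpa using hα (Int.castRingHom ℝ)
    have hβ : 0 ≤ norm β := by rw [int_norm_eq]; positivity
    by_cases h1 : α = 1
    · exact ⟨1, 0, by rw [h1, herm_one_one_zero]⟩
    have h0 : α ≠ 0 := by rintro rfl; linarith
    obtain ⟨x, hx⟩ := exists_int_norm_mul_add_le α (by omega) (star β)
    have h2 := herm_mul α γ β x
    have h3 : (algebraMap ℤ (Sq ℤ 0) α) = (α : Sq ℤ 0) := by simp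
    rw [h3, h] at h2
    have h5 : 2 ≤ α := by omega
    have h4 : herm α γ β x 1 < α := by
      by_contra! h4
      nlinarith [mul_le_mul_of_nonneg_right h4 hα0]
    obtain ⟨s, t, hst⟩ := ih _ (by omega) (herm α γ β x 1) α (algebraMap ℤ _ α * x + star β)
      (by rw [herm_mul, h]; ring) (fun f => map_herm_nonneg f (by simp) h (hα f) x) rfl
    exact ⟨_, _, (herm_change _ _ _ _ _ _).symm.trans hst⟩

theorem exists_herm_eq_one_zs (α γ : Zs) (β : Sq Zs srt) (h : α * γ = norm β + 1)
    (hα : ∀ f : Zs →+* ℝ, 0 ≤ f α) : ∃ s t, herm α γ β s t = 1 := by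
  obtain ⟨n, hn⟩ : ∃ n : ℕ, α.re.toNat = n := ⟨_, rfl⟩
  induction n using Nat.strong_induction_on generalizing α γ β with
  | _ n ih =>
    have hne : α ≠ 0 := by
      rintro rfl
      have h1 := map_norm_nonneg (zsReal _ sqrt_three_mul_self) (zs_ringHom_sq _) β
      have h2 := congrArg (zsReal _ sqrt_three_mul_self) h
      simp only [zero_mul, map_zero, map_add, map_one] at h2
      linarith
    have hre := zs_re_nonneg hα
    have hN : 0 < α.norm :=
      lt_of_le_of_ne (zs_norm_nonneg hα) fun h => hne (zs_norm_eq_zero h.symm)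
    have hNe : α.norm = α.re ^ 2 - 3 * α.im ^ 2 := by simp [norm_def]; ring
    have hre0 : 0 < α.re := by
      refine lt_of_le_of_ne hre fun h => ?_
      rw [← h] at hNe
      nlinarith [sq_nonneg α.im]
    have scale (μ ν : Sq Zs srt) (h1 : μ * star ν = 1) (h2 : (α * norm μ).re < α.re) :
        ∃ s t, herm α γ β s t = 1 := by
      have h3 : norm μ * norm ν = 1 := by
        rw [← QuadraticAlgebra.norm_star ν, ← map_mul, h1, map_one]
      have hpos : ∀ f : Zs →+* ℝ, 0 ≤ f (α * norm μ) := fun f => by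
        rw [map_mul]
        exact mul_nonneg (hα f) (map_norm_nonneg f (zs_ringHom_sq f) μ)
      obtain ⟨s, t, hst⟩ := ih _ (by omega) (α * norm μ) (γ * norm ν) β
        (by rw [← h]; linear_combination (α * γ) * h3) hpos rfl
      exact ⟨_, _, (herm_scale _ _ _ _ _ _ _ h1).symm.trans hst⟩
    by_cases hb1 : α.re < 3 * α.im
    · refine scale ⟨1, -1⟩ (⟨1, -1⟩ * algebraMap Zs _ (2 + srt)) ?_ ?_
      · ext <;> simp
      · simp [norm_def]; omega
    by_cases hb2 : α.re < -(3 * α.im)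
    · refine scale ⟨1, 1⟩ (⟨1, 1⟩ * algebraMap Zs _ (2 - srt)) ?_ ?_
      · ext <;> simp
      · simp [norm_def]; omega
    by_cases h4 : α.norm < 4
    · have h5 : α.norm = 1 ∨ α.norm = 2 ∨ α.norm = 3 := by omega
      rw [hNe] at h5
      have h6 : α.im ^ 2 * 9 ≤ α.re ^ 2 := by nlinarith
      have h7 : α.im ^ 2 = 0 := by nlinarith [sq_nonneg α.im]
      have h8 : α.im = 0 := by simpa using h7
      rw [h8] at h5
      have h9 : α.re = 1 := by
        have : α.re < 2 := by nlinarith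
        omega
      have h10 : α = 1 := by ext <;> simp [h8, h9]
      exact ⟨1, 0, by rw [h10, herm_one_one_zero]⟩
    obtain ⟨x, hx⟩ := exists_norm_mul_add_le α.re α.im hre0 α.norm hN
      (star β * algebraMap Zs _ (star α))
    have h5 : ((α.norm : ℤ) : Sq Zs srt) * x + star β * algebraMap Zs _ (star α) =
        algebraMap Zs _ (star α) * (algebraMap Zs _ α * x + star β) := by
      have : ((α.norm : ℤ) : Sq Zs srt) = algebraMap Zs _ (star α) * algebraMap Zs _ α := by
        rw [← map_mul, mul_comm, zs_star_mul_self]; simp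
      rw [this]; ring
    have h6 : α * norm (algebraMap Zs _ (star α) * (algebraMap Zs _ α * x + star β)) =
        (α.norm : Zs) * ((α.norm : Zs) * herm α γ β x 1 - star α) := by
      rw [map_mul, QuadraticAlgebra.norm_algebraMap, ← zs_star_mul_self]
      have := herm_mul α γ β x
      rw [h] at this
      linear_combination (-α * star α ^ 2) * this
    have h7 := congrArg QuadraticAlgebra.re h6
    rw [h5] at hx
    generalize norm (algebraMap Zs _ (star α) * (algebraMap Zs _ α * x + star β)) = w at *
    have h8 : (herm α γ β x 1).re < α.re := by
      generalize herm α γ β x 1 = y at *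
      clear h5 h6
      simp at h7
      rw [h7] at hx
      generalize α.norm = N at *
      by_contra! h9
      have h10 := mul_le_mul_of_nonneg_left h9 hN.le
      have h11 : N * (3 * (N * y.re - α.re)) ≤ N * (2 * α.re * N) := by linarith
      have h12 := le_of_mul_le_mul_left h11 hN
      nlinarith
    obtain ⟨s, t, hst⟩ := ih _ (by omega) (herm α γ β x 1) α (algebraMap Zs _ α * x + star β)
      (by rw [herm_mul, h]; ring) (fun f => map_herm_nonneg f (zs_ringHom_sq f) h (hα f) x) rfl
    exact ⟨_, _, (herm_change _ _ _ _ _ _).symm.trans hst⟩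

end Euclid

section Unimod
open Matrix

theorem exists_inverse_of_isUnit_bdet_id {A κ m : Type*} [CommRing A] [Fintype κ] [DecidableEq κ]
    [Fintype m] [DecidableEq m] {M : Matrix m m (Matrix κ κ A)}
    (h : IsUnit (bdet (RingHom.id _) M)) : ∃ X, X * M = 1 ∧ M * X = 1 := by
  obtain ⟨X, hX⟩ : ∃ X, X * Matrix.comp _ _ _ _ _ M = 1 := ⟨_, nonsing_inv_mul _ h⟩
  have hX' := mul_eq_one_comm.1 hX
  refine ⟨(Matrix.comp _ _ _ _ _).symm X, ?_, ?_⟩ <;> apply (Matrix.comp _ _ _ _ _).injective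
  · rw [comp_mul', Equiv.apply_symm_apply, hX, comp_one']
  · rw [comp_mul', Equiv.apply_symm_apply, hX', comp_one']

variable {A : Type} [CommRing A] {b : A}

/-- The involution of `2 × 2` matrices whose fixed points are the quaternions. -/
def quatConj : Matrix (Fin 2) (Fin 2) (Sq A b) →+* Matrix (Fin 2) (Fin 2) (Sq A b) where
  toFun M := !![star (M 1 1), -star (M 1 0); -star (M 0 1), star (M 0 0)]
  map_one' := by ext1 i j; fin_cases i <;> fin_cases j <;> simp
  map_zero' := by ext1 i j; fin_cases i <;> fin_cases j <;> simp
  map_add' M N := by ext1 i j; fin_cases i <;> fin_cases j <;> simp <;> ring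
  map_mul' M N := by
    ext1 i j; fin_cases i <;> fin_cases j <;> simp [Matrix.mul_apply, Fin.sum_univ_two] <;> ring

theorem quatConj_apply (M : Matrix (Fin 2) (Fin 2) (Sq A b)) :
    quatConj M = !![star (M 1 1), -star (M 1 0); -star (M 0 1), star (M 0 0)] := rfl

theorem quatConj_quatConj (M : Matrix (Fin 2) (Fin 2) (Sq A b)) : quatConj (quatConj M) = M := by
  ext1 i j; fin_cases i <;> fin_cases j <;> simp [quatConj_apply]

theorem quatConj_quatRep (q : Lam A b) : quatConj (quatRep q) = quatRep q := by
  ext1 i j; fin_cases i <;> fin_cases j <;> simp [quatConj_apply, quatRep_apply]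

theorem quatRep_lamMk_of_quatConj_eq {M : Matrix (Fin 2) (Fin 2) (Sq A b)} (h : quatConj M = M) :
    quatRep (lamMk (M 0 0) (M 0 1)) = M := by
  have h0 := congrFun (congrFun h 1) 1
  have h1 := congrFun (congrFun h 1) 0
  simp [quatConj_apply] at h0 h1
  ext1 i j; fin_cases i <;> fin_cases j <;> simp [quatRep_apply, h0, h1]

theorem quatRep_injective : Function.Injective (quatRep (A := A) (b := b)) := fun _ _ h =>
  lam_ext (congrFun (congrFun h 0) 0) (congrFun (congrFun h 0) 1)

theorem bdet_quatConj {m : Type*} [Fintype m] [DecidableEq m]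
    (M : Matrix m m (Matrix (Fin 2) (Fin 2) (Sq A b))) :
    bdet quatConj M = star (bdet (RingHom.id _) M) := by
  have h := map_bdet (starRingEnd (Sq A b)) (RingHom.id _) M
  rw [starRingEnd_apply] at h
  rw [h]
  symm
  refine bdet_conj (G := !![0, -1; 1, 0]) (H := !![0, 1; -1, 0]) ?_ (fun r => ?_) M
  · ext1 i j; fin_cases i <;> fin_cases j <;> simp
  · ext1 i j; fin_cases i <;> fin_cases j <;>
      simp [quatConj_apply, Matrix.mul_apply, Fin.sum_univ_two, starRingEnd_apply]

theorem lam_isUnit_of_ne_zero {b : ℝ} (hb : b ^ 2 < 4) {q : Lam ℝ b} (hq : q ≠ 0) : IsUnit q := by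
  rw [isUnit_lam_iff, isUnit_iff_ne_zero]
  intro h
  apply hq
  rw [nr_eq] at h
  have a1 := sq_nonneg (2 * q.re + b * q.imI)
  have a2 := sq_nonneg (2 * q.imJ + b * q.imK)
  have a3 := mul_nonneg (sub_nonneg.2 hb.le) (sq_nonneg q.imI)
  have a4 := mul_nonneg (sub_nonneg.2 hb.le) (sq_nonneg q.imK)
  have b1 : q.imI = 0 := by
    have : (4 - b ^ 2) * q.imI ^ 2 = 0 := by nlinarith
    simpa [(sub_pos.2 hb).ne'] using this
  have b2 : q.imK = 0 := by
    have : (4 - b ^ 2) * q.imK ^ 2 = 0 := by nlinarith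
    simpa [(sub_pos.2 hb).ne'] using this
  rw [b1, b2] at h
  have b3 : q.re = 0 := by nlinarith [sq_nonneg q.re, sq_nonneg q.imJ]
  have b4 : q.imJ = 0 := by nlinarith [sq_nonneg q.re, sq_nonneg q.imJ]
  ext <;> simp [*]

theorem nr_nonneg_real {b : ℝ} (hb : b ^ 2 < 4) (q : Lam ℝ b) : 0 ≤ nr q :=
  add_nonneg (map_norm_nonneg (RingHom.id ℝ) hb _) (map_norm_nonneg (RingHom.id ℝ) hb _)

/-- The reduced norm of a matrix over the real quaternions is nonnegative. -/
theorem nonneg_of_bdet_eq {b : ℝ} (hb : b ^ 2 < 4) {m : Type} [Fintype m] [DecidableEq m]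
    (M : Matrix m m (Lam ℝ b)) {x : ℝ} (hx : x ≠ 0)
    (h : bdet quatRep M = algebraMap ℝ (Sq ℝ b) x) : 0 ≤ x := by
  have hu : IsUnit (bdet quatRep M) := by
    rw [h]; exact (isUnit_iff_ne_zero.2 hx).map _
  obtain ⟨X, hX, -⟩ := exists_inverse_of_isUnit_bdet hu
  obtain ⟨d, -, hd⟩ := exists_isUnit_forall_bdet_eq (D := Lam ℝ b)
    (fun p q hpq => by
      by_contra! hn
      have h1 : p = 0 := by_contra fun h => hn.1 (lam_isUnit_of_ne_zero hb h)
      have h2 : q = 0 := by_contra fun h => hn.2 (lam_isUnit_of_ne_zero hb h)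
      rw [h1, h2, add_zero] at hpq
      have := isUnit_lam_iff.1 hpq
      simp [nr_eq] at this)
    lam_mul_eq_one_comm _ m rfl M X hX
  rw [hd _ _ quatRep, det_quatRep] at h
  rw [← QuadraticAlgebra.algebraMap_injective h]
  exact nr_nonneg_real hb d

theorem exists_algebraMap_of_star_eq (h2 : ∀ x : A, x + x = 0 → x = 0) {z : Sq A b}
    (h : star z = z) : ∃ x, algebraMap A _ x = z := by
  have := congrArg QuadraticAlgebra.im h
  rw [QuadraticAlgebra.im_star] at this
  have him := h2 z.im (by linear_combination -this)
  exact ⟨z.re, by ext <;> simp [him]⟩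

theorem det_eq_herm {α γ : A} {β a' b' : Sq A b} {g h : Matrix (Fin 2) (Fin 2) (Sq A b)}
    (hg : g = !![algebraMap A _ γ, -star β; -β, algebraMap A _ α])
    (hh : h = !![a', -algebraMap A _ γ * star b' - star β * star a';
      b', β * star b' + algebraMap A _ α * star a']) (hdet : α * γ = QuadraticAlgebra.norm β + 1) :
    g * quatConj h = h ∧ h.det = algebraMap A _ (herm α γ β a' b') := by
  have hs (x : A) : star (algebraMap A (Sq A b) x) = algebraMap A _ x := by ext <;> simp
  have hdet' := congrArg (algebraMap A (Sq A b)) hdet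
  rw [map_add, QuadraticAlgebra.algebraMap_norm_eq_mul_star, map_mul, map_one] at hdet'
  constructor
  · rw [hg, hh]
    ext1 i j
    fin_cases i <;> fin_cases j <;> simp [quatConj_apply, Matrix.mul_apply, Fin.sum_univ_two, hs]
    · linear_combination a' * hdet'
    · ring
    · linear_combination b' * hdet'
  · rw [hh, det_fin_two_of, herm]
    simp only [map_add, map_mul, QuadraticAlgebra.algebraMap_norm_eq_mul_star,
      QuadraticAlgebra.algebraMap_trace_eq_add_star, star_mul', star_star]
    ring

/-- Over a quaternion order whose positive unimodular hermitian planes represent one, the kernel of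
a split surjection is completed by a column of reduced norm one. -/
theorem exists_kernel_column_quaternion [IsDomain (Sq A b)] [IsPrincipalIdealRing (Sq A b)]
    (h2 : ∀ x : A, x + x = 0 → x = 0) (hb : ∀ f : A →+* ℝ, f b ^ 2 < 4)
    (hherm : ∀ (α γ : A) (β : Sq A b), α * γ = QuadraticAlgebra.norm β + 1 →
      (∀ f : A →+* ℝ, 0 ≤ f α) → ∃ s t, herm α γ β s t = 1)
    {k : Type} [Fintype k] [DecidableEq k]
    {N : Matrix k (Unit ⊕ k) (Lam A b)} {C : Matrix (Unit ⊕ k) k (Lam A b)} (hNC : N * C = 1) :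
    ∃ c : Matrix (Unit ⊕ k) Unit (Lam A b), N * c = 0 ∧ bdet quatRep (fromCols c C) = 1 := by
  obtain ⟨N', hN'⟩ : ∃ N', N' = N.map quatRep := ⟨_, rfl⟩
  obtain ⟨C', hC'⟩ : ∃ C', C' = C.map quatRep := ⟨_, rfl⟩
  have hNC' : N' * C' = 1 := by
    rw [hN', hC', ← Matrix.map_mul, hNC, Matrix.map_one _ (map_zero _) (map_one _)]
  obtain ⟨K, hNK, hK⟩ := exists_kernel_column_of_isPrincipalIdealRing hNC'
  obtain ⟨X, hX, hX'⟩ := exists_inverse_of_isUnit_bdet_id (hK ▸ isUnit_one)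
  obtain ⟨V, hVK, hVC, hV⟩ := exists_splitting hNC' hNK hX hX'
  have hNmap : N'.map quatConj = N' := by
    rw [hN']; ext1 i j; simp only [map_apply, quatConj_quatRep]
  have hCmap : C'.map quatConj = C' := by
    rw [hC']; ext1 i j; simp only [map_apply, quatConj_quatRep]
  have hlift (H : Matrix (Unit ⊕ k) Unit (Matrix (Fin 2) (Fin 2) (Sq A b))) (hH : N' * H = 0) :
      H = K * (V * H) := by
    have := congrArg (· * H) hV
    simpa [Matrix.add_mul, Matrix.mul_assoc, hH] using this.symm
  have hNKψ : N' * K.map quatConj = 0 := by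
    rw [← hNmap, ← Matrix.map_mul, hNK, Matrix.map_zero _ (map_zero _)]
  obtain ⟨g, hg⟩ : ∃ g, g = V * K.map quatConj := ⟨_, rfl⟩
  have hKg : K.map quatConj = K * g := by rw [hg]; exact hlift _ hNKψ
  have hdetg : (g () ()).det = 1 := by
    have h1 := bdet_fromCols_mul (RingHom.id _) K g C'
    rw [← hKg, hK, one_mul, RingHom.id_apply] at h1
    rw [← h1]
    conv_lhs => rw [← hCmap]
    rw [← map_fromCols, ← bdet_comp, RingHom.id_comp, bdet_quatConj, hK, star_one]
  have hgg : g * g.map quatConj = 1 := by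
    have h1 := congrArg (fun M => Matrix.map M quatConj) hKg
    simp only [Matrix.map_mul, hKg] at h1
    have h3 : (K * g).map quatConj = K := by
      rw [← hKg]; ext1 i j; simp only [map_apply, quatConj_quatConj]
    rw [Matrix.map_mul, hKg] at h3
    have h4 := congrArg (V * ·) h3
    simpa [← Matrix.mul_assoc, hVK] using h4
  have hgg' : g () () * quatConj (g () ()) = 1 := by
    have := congrFun (congrFun hgg ()) ()
    simpa [Matrix.mul_apply] using this
  have hconj : quatConj (g () ()) = (g () ()).adjugate := by
    have h1 : (g () ()).adjugate * (g () () * quatConj (g () ())) = (g () ()).adjugate := by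
      rw [hgg', Matrix.mul_one]
    rwa [← Matrix.mul_assoc, adjugate_mul, hdetg, one_smul, Matrix.one_mul] at h1
  rw [quatConj_apply, adjugate_fin_two] at hconj
  have e00 := congrFun (congrFun hconj 0) 0
  have e01 := congrFun (congrFun hconj 0) 1
  have e11 := congrFun (congrFun hconj 1) 1
  simp at e00 e01 e11
  obtain ⟨α, hα⟩ := exists_algebraMap_of_star_eq h2 e00
  obtain ⟨γ, hγ⟩ := exists_algebraMap_of_star_eq h2 e11
  obtain ⟨β, hβ⟩ : ∃ β, β = -(g () () 1 0) := ⟨_, rfl⟩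
  have hgform : g () () = !![algebraMap A _ γ, -star β; -β, algebraMap A _ α] := by
    ext1 i j; fin_cases i <;> fin_cases j <;> simp [hα, hγ, hβ, e01]
  have hdet : α * γ = QuadraticAlgebra.norm β + 1 := by
    apply QuadraticAlgebra.algebraMap_injective (a := (-1 : A)) (b := b)
    rw [hgform, det_fin_two_of] at hdetg
    rw [map_add, map_mul, map_one, QuadraticAlgebra.algebraMap_norm_eq_mul_star]
    linear_combination hdetg
  have key (a' b' : Sq A b) : ∃ c : Matrix (Unit ⊕ k) Unit (Lam A b), N * c = 0 ∧
      bdet quatRep (fromCols c C) = algebraMap A _ (herm α γ β a' b') := by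
    obtain ⟨h, hh⟩ : ∃ h : Matrix (Fin 2) (Fin 2) (Sq A b), h =
      !![a', -algebraMap A _ γ * star b' - star β * star a';
      b', β * star b' + algebraMap A _ α * star a'] := ⟨_, rfl⟩
    obtain ⟨hgh, hdeth⟩ := det_eq_herm hgform hh hdet
    obtain ⟨H, hH⟩ : ∃ H, H = K * (of fun _ _ => h : Matrix Unit Unit _) := ⟨_, rfl⟩
    have hHψ : H.map quatConj = H := by
      rw [hH, Matrix.map_mul, hKg, Matrix.mul_assoc]
      congr 1
      ext1 i j
      simp [Matrix.mul_apply, hgh]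
    obtain ⟨c, hc⟩ : ∃ c : Matrix (Unit ⊕ k) Unit (Lam A b), c.map quatRep = H := by
      refine ⟨of fun i j => lamMk (H i j 0 0) (H i j 0 1), ?_⟩
      ext1 i j
      exact quatRep_lamMk_of_quatConj_eq (congrFun (congrFun hHψ i) j)
    refine ⟨c, ?_, ?_⟩
    · apply Matrix.map_injective quatRep_injective
      beta_reduce
      rw [Matrix.map_mul, hc, ← hN', hH, ← Matrix.mul_assoc, hNK, Matrix.zero_mul,
        Matrix.map_zero _ (map_zero _)]
    · rw [← RingHom.id_comp quatRep, bdet_comp, map_fromCols, hc, ← hC', hH, bdet_fromCols_mul, hK,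
        one_mul, RingHom.id_apply, of_apply, hdeth]
  have hpos (f : A →+* ℝ) : 0 ≤ f α := by
    obtain ⟨c, -, hc⟩ := key 1 0
    have h1 : herm α γ β 1 0 = α := by simp [herm]
    rw [h1] at hc
    have h3 := map_bdet (sqMap f rfl) quatRep (fromCols c C)
    rw [← quatRep_lamMap f rfl, bdet_comp, hc] at h3
    refine nonneg_of_bdet_eq (hb f) ((fromCols c C).map (lamMap f rfl)) ?_ (h3.symm.trans ?_)
    · intro h0
      have h4 := congrArg f hdet
      have h5 := map_norm_nonneg f (hb f) β
      rw [map_mul, h0, map_add, map_one] at h4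
      linarith
    · ext <;> simp [sqMap]
  obtain ⟨s, t, hst⟩ := hherm α γ β hdet hpos
  obtain ⟨c, hc, hc'⟩ := key s t
  exact ⟨c, hc, by rw [hc', hst, map_one]⟩

variable {k : Type} [Fintype k] [DecidableEq k]

theorem exists_kernel_column_int {N : Matrix k (Unit ⊕ k) (Lam ℤ 0)}
    {C : Matrix (Unit ⊕ k) k (Lam ℤ 0)} (hNC : N * C = 1) :
    ∃ c : Matrix (Unit ⊕ k) Unit (Lam ℤ 0), N * c = 0 ∧ bdet quatRep (fromCols c C) = 1 :=
  exists_kernel_column_quaternion (fun x hx => by omega) (by simp) exists_herm_eq_one_int hNC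

theorem exists_kernel_column_zs {N : Matrix k (Unit ⊕ k) (Lam Zs srt)}
    {C : Matrix (Unit ⊕ k) k (Lam Zs srt)} (hNC : N * C = 1) :
    ∃ c : Matrix (Unit ⊕ k) Unit (Lam Zs srt), N * c = 0 ∧ bdet quatRep (fromCols c C) = 1 :=
  exists_kernel_column_quaternion (fun x hx => by
    have h1 := congrArg QuadraticAlgebra.re hx
    have h2 := congrArg QuadraticAlgebra.im hx
    simp at h1 h2
    ext <;> simp [h1, h2]) zs_ringHom_sq exists_herm_eq_one_zs hNC

end Unimod

section Components
open Matrix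

instance {R : Type*} [DecidableEq R] {a b c : R} : DecidableEq (QuaternionAlgebra R a b c) :=
  fun p q => decidable_of_iff (p.re = q.re ∧ p.imI = q.imI ∧ p.imJ = q.imJ ∧ p.imK = q.imK)
    (QuaternionAlgebra.ext_iff (x := p) (y := q)).symm

/-- The group ring of the abelianization of the image of `Q24` in characters of exponent two. -/
abbrev Kl (A : Type) [CommRing A] : Type := QuadraticAlgebra (QuadraticAlgebra A 1 0) 1 0

/-- The ring `ℤ[c]/(c² - 1)`. -/
abbrev Cyc (A : Type) [CommRing A] : Type := QuadraticAlgebra A 1 0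

/-- A matrix of order three. -/
def matW (A : Type) [CommRing A] : Matrix (Fin 2) (Fin 2) A := !![1, 1; -3, -2]

/-- A reflection inverting `matW`. -/
def matY (A : Type) [CommRing A] : Matrix (Fin 2) (Fin 2) A := !![1, 1; 0, -1]

/-- The order four element of the quaternions. -/
def lamI (A : Type) [CommRing A] (b : A) : Lam A b := ⟨0, 1, 0, 0⟩

/-- The element `j`. -/
def lamJ (A : Type) [CommRing A] (b : A) : Lam A b := ⟨0, 0, 1, 0⟩

def pC : ZQ24 →+* Kl ℤ := quatLift ⟨⟨0, 1⟩, 0⟩ ⟨0, 1⟩ (by decide +kernel)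
  (by decide +kernel) (by decide +kernel)

def pT : ZQ24 →+* Matrix (Fin 2) (Fin 2) (Cyc ℤ) :=
  quatLift ((⟨0, 1⟩ : Cyc ℤ) • matW _) (matY _) (by decide +kernel)
  (by decide +kernel) (by decide +kernel)

def pF : ZQ24 →+* Lam ℤ 0 := quatLift (lamI _ _) (lamJ _ _) (by decide +kernel)
  (by decide +kernel) (by decide +kernel)

def pG : ZQ24 →+* Lam Zs srt := quatLift (lamI _ _) (lamJ _ _) (by decide +kernel)
  (by decide +kernel) (by decide +kernel)


/-- The evaluations of `ℤ[c]/(c² - 1)` at a square root of one. -/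
def cycEval (ε : ℤ) (h : ε * ε = 1) : Cyc ℤ →+* ℤ :=
  (QuadraticAlgebra.lift (R := ℤ) ⟨ε, by simp [h]⟩ : Cyc ℤ →ₐ[ℤ] ℤ)

theorem cycEval_apply (ε : ℤ) (h : ε * ε = 1) (z : Cyc ℤ) : cycEval ε h z = z.re + z.im * ε := by
  simp [cycEval, QuadraticAlgebra.lift]

def pP : ZQ24 →+* Matrix (Fin 2) (Fin 2) ℤ := (cycEval 1 (by norm_num)).mapMatrix.comp pT

def pQ : ZQ24 →+* Matrix (Fin 2) (Fin 2) ℤ := (cycEval (-1) (by norm_num)).mapMatrix.comp pT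

@[simp] theorem pC_gx : pC gx = ⟨⟨0, 1⟩, 0⟩ := quatLift_gx
@[simp] theorem pC_gy : pC gy = ⟨0, 1⟩ := quatLift_gy
@[simp] theorem pT_gx : pT gx = (⟨0, 1⟩ : Cyc ℤ) • matW _ := quatLift_gx
@[simp] theorem pT_gy : pT gy = matY _ := quatLift_gy
@[simp] theorem pF_gx : pF gx = lamI _ _ := quatLift_gx
@[simp] theorem pF_gy : pF gy = lamJ _ _ := quatLift_gy
@[simp] theorem pG_gx : pG gx = lamI _ _ := quatLift_gx
@[simp] theorem pG_gy : pG gy = lamJ _ _ := quatLift_gy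

@[simp] theorem pP_gx : pP gx = matW ℤ := by
  rw [show pP gx = (pT gx).map (cycEval _ (by norm_num)) from rfl, pT_gx]
  ext1 i j
  simp only [Matrix.map_apply, cycEval_apply]
  fin_cases i <;> fin_cases j <;> decide +kernel
@[simp] theorem pP_gy : pP gy = matY ℤ := by
  rw [show pP gy = (pT gy).map (cycEval _ (by norm_num)) from rfl, pT_gy]
  ext1 i j
  simp only [Matrix.map_apply, cycEval_apply]
  fin_cases i <;> fin_cases j <;> decide +kernel
@[simp] theorem pQ_gx : pQ gx = -matW ℤ := by
  rw [show pQ gx = (pT gx).map (cycEval _ (by norm_num)) from rfl, pT_gx]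
  ext1 i j
  simp only [Matrix.map_apply, cycEval_apply]
  fin_cases i <;> fin_cases j <;> decide +kernel
@[simp] theorem pQ_gy : pQ gy = matY ℤ := by
  rw [show pQ gy = (pT gy).map (cycEval _ (by norm_num)) from rfl, pT_gy]
  ext1 i j
  simp only [Matrix.map_apply, cycEval_apply]
  fin_cases i <;> fin_cases j <;> decide +kernel

/-- The trace form recovering the coefficient of the identity from the components. -/
def coeffFun (z₁ : Kl ℤ) (z₂ z₃ : Matrix (Fin 2) (Fin 2) ℤ) (z₄ : Lam ℤ 0) (z₅ : Lam Zs srt) : ℤ :=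
  4 * z₁.re.re + 2 * (z₂ 0 0 + z₂ 1 1) + 2 * (z₃ 0 0 + z₃ 1 1) + 4 * z₄.re +
    4 * (2 * z₅.re.re + 3 * z₅.imI.im)

theorem coeffFun_components (z : ZQ24) :
    coeffFun (pC z) (pP z) (pQ z) (pF z) (pG z) = 24 * z.coeff 1 := by
  let f : ZQ24 →+ ℤ := AddMonoidHom.mk'
    (fun z => coeffFun (pC z) (pP z) (pQ z) (pF z) (pG z) - 24 * z.coeff 1) (fun a b => by
      simp [coeffFun]; ring)
  have hf : f = 0 := by
    refine MonoidAlgebra.addHom_ext' fun g => AddMonoidHom.ext_int ?_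
    change coeffFun (pC (MonoidAlgebra.single g 1)) (pP (MonoidAlgebra.single g 1))
      (pQ (MonoidAlgebra.single g 1)) (pF (MonoidAlgebra.single g 1))
      (pG (MonoidAlgebra.single g 1)) - 24 * (MonoidAlgebra.single g (1 : ℤ) : ZQ24).coeff 1 = 0
    rw [MonoidAlgebra.coeff_single, Finsupp.single_apply]
    cases g with
    | a i =>
      rw [single_a]
      simp only [map_pow, pC_gx, pP_gx, pQ_gx, pF_gx, pG_gx]
      revert i
      decide +kernel
    | xa i =>
      rw [single_xa]
      simp only [map_pow, map_mul, pC_gx, pP_gx, pQ_gx, pF_gx, pG_gx, pC_gy, pP_gy, pQ_gy, pF_gy,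
        pG_gy]
      revert i
      decide +kernel
  exact sub_eq_zero.1 (DFunLike.congr_fun hf z)

theorem components_injective {z : ZQ24} (hC : pC z = 0) (hP : pP z = 0) (hQ : pQ z = 0)
    (hF : pF z = 0) (hG : pG z = 0) : z = 0 := by
  refine MonoidAlgebra.ext (Finsupp.ext fun g => ?_)
  have h := coeffFun_components (z * MonoidAlgebra.single g⁻¹ 1)
  simp only [map_mul, hC, hP, hQ, hF, hG, zero_mul] at h
  rw [show (z * MonoidAlgebra.single g⁻¹ (1 : ℤ)).coeff 1 = z.coeff g by simp] at h
  simp [coeffFun] at h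
  simpa using h

end Components

section Gluing
open Matrix

theorem ZQ24_induction {p : ZQ24 → Prop} (hx : p gx) (hy : p gy) (h1 : p 1)
    (hneg : ∀ a, p a → p (-a)) (hadd : ∀ a b, p a → p b → p (a + b))
    (hmul : ∀ a b, p a → p b → p (a * b)) (r : ZQ24) : p r := by
  let S : Subring ZQ24 :=
    { carrier := {r | p r}
      mul_mem' := hmul _ _
      one_mem' := h1
      add_mem' := hadd _ _
      zero_mem' := by
        have := hadd _ _ h1 (hneg _ h1)
        rwa [add_neg_cancel] at this
      neg_mem' := hneg _ }
  have hx' : gx ∈ S := hx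
  have hy' : gy ∈ S := hy
  suffices h : r ∈ S from h
  induction r using MonoidAlgebra.induction_linear with
  | zero => exact S.zero_mem
  | add f g hf hg => exact S.add_mem hf hg
  | single g n =>
    have : (MonoidAlgebra.single g n : ZQ24) = n • MonoidAlgebra.single g 1 := by
      rw [MonoidAlgebra.smul_single]; simp
    rw [this]
    refine S.zsmul_mem ?_ n
    cases g with
    | a i => rw [single_a]; exact S.pow_mem hx' _
    | xa i => rw [single_xa]; exact S.mul_mem hy' (S.pow_mem hx' _)

theorem intertwine {B : Type*} [Ring B] {f g : ZQ24 →+* B} {G : B} (hx : G * f gx = g gx * G)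
    (hy : G * f gy = g gy * G) (r : ZQ24) : G * f r = g r * G := by
  induction r using ZQ24_induction with
  | hx => exact hx
  | hy => exact hy
  | h1 => simp
  | hneg a ha => simp [ha]
  | hadd a b ha hb => simp [mul_add, add_mul, ha, hb]
  | hmul a b ha hb => rw [map_mul, map_mul, ← mul_assoc, ha, mul_assoc, hb, mul_assoc]

/-- Reduction of `Kl ℤ` modulo two. -/
def klRed : Kl ℤ →+* Kl (ZMod 2) where
  toFun z := ⟨⟨z.re.re, z.re.im⟩, ⟨z.im.re, z.im.im⟩⟩
  map_one' := by decide +kernel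
  map_zero' := by decide +kernel
  map_add' x y := by ext <;> simp
  map_mul' x y := by ext <;> simp

/-- The evaluations of `Kl ℤ` at square roots of one. -/
def klEval {A : Type} [CommRing A] (ε δ : A) (hε : ε * ε = 1) (hδ : δ * δ = 1) : Kl ℤ →+* A where
  toFun z := (z.re.re + z.re.im * ε) + (z.im.re + z.im.im * ε) * δ
  map_one' := by simp [QuadraticAlgebra.re_one, QuadraticAlgebra.im_one]
  map_zero' := by simp
  map_add' x y := by simp; ring
  map_mul' x y := by
    simp
    linear_combination (-(x.re.im * y.re.im : A) - x.im.im * y.im.im - x.re.im * y.im.im * δ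
      - x.im.im * y.re.im * δ - x.im.im * y.im.im * (δ * δ - 1)) * hε
      - (x.im.re * y.im.re + x.im.re * y.im.im * ε + x.im.im * y.im.re * ε + x.im.im * y.im.im) * hδ

/-- The quaternions in characteristic two map onto `Kl`. -/
def lamKl {A : Type} [CommRing A] (f : A →+* ZMod 2) : Lam A 0 →+* Kl (ZMod 2) where
  toFun q := ⟨⟨f q.re, f q.imI⟩, ⟨f q.imJ, f q.imK⟩⟩
  map_one' := by ext <;> simp [QuadraticAlgebra.re_one, QuadraticAlgebra.im_one]
  map_zero' := by ext <;> simp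
  map_add' x y := by ext <;> simp
  map_mul' x y := by
    ext <;> simp [CharTwo.neg_eq, sub_eq_add_neg] <;> ring

/-- The map `ℤ[√3] → ℤ/3` killing `√3`. -/
def zsMod : Zs →+* ZMod 3 where
  toFun z := z.re
  map_one' := by simp [QuadraticAlgebra.re_one]
  map_zero' := by simp
  map_add' x y := by simp
  map_mul' x y := by simp; left; left; decide

/-- The map `ℤ[√3] → 𝔽₂[c]/(c² - 1)` sending `√3` to `c`. -/
def zsCyc : Zs →+* Cyc (ZMod 2) where
  toFun z := ⟨z.re, z.im⟩
  map_one' := by ext <;> simp [QuadraticAlgebra.re_one, QuadraticAlgebra.im_one]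
  map_zero' := by ext <;> simp
  map_add' x y := by ext <;> simp
  map_mul' x y := by ext <;> simp [show (3 : ZMod 2) = 1 by decide]

/-- Reduction of `ℤ[c]/(c² - 1)` modulo two. -/
def cycRed : Cyc ℤ →+* Cyc (ZMod 2) where
  toFun z := ⟨z.re, z.im⟩
  map_one' := by ext <;> simp [QuadraticAlgebra.re_one, QuadraticAlgebra.im_one]
  map_zero' := by ext <;> simp
  map_add' x y := by ext <;> simp
  map_mul' x y := by ext <;> simp

/-- The element `c` of `𝔽₂[c]/(c² - 1)`. -/
abbrev cGen : Cyc (ZMod 2) := ⟨0, 1⟩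

/-- Reduction of the Hurwitz type order over `ℤ[√3]` modulo `√3`. -/
def lamGMod : Lam Zs srt →+* Lam (ZMod 3) 0 := lamMap zsMod (by simp [zsMod])

/-- Reduction of the Lipschitz quaternions modulo three. -/
def lamFMod : Lam ℤ 0 →+* Lam (ZMod 3) 0 := lamMap (Int.castRingHom _) (by simp)

/-- Reduction of the Lipschitz quaternions modulo two. -/
def lamFKl : Lam ℤ 0 →+* Kl (ZMod 2) := lamKl (Int.castRingHom _)

/-- Reduction modulo two of the order over `ℤ[√3]`. -/
def lamGCyc : Lam Zs srt →+* Lam (Cyc (ZMod 2)) cGen := lamMap zsCyc (by simp [zsCyc])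

theorem klRed_comp_pC : klRed.comp pC = lamFKl.comp pF := by
  refine ZQ24_hom_ext ?_ ?_
  · simp only [RingHom.comp_apply, pC_gx, pF_gx]; decide +kernel
  · simp only [RingHom.comp_apply, pC_gy, pF_gy]; decide +kernel

theorem lamFMod_comp_pF : lamFMod.comp pF = lamGMod.comp pG := by
  refine ZQ24_hom_ext ?_ ?_
  · simp only [RingHom.comp_apply, pG_gx, pF_gx]; decide +kernel
  · simp only [RingHom.comp_apply, pG_gy, pF_gy]; decide +kernel

theorem pC_surjective : Function.Surjective pC := fun z =>
  ⟨z.re.re + z.re.im * gx + gy * (z.im.re + z.im.im * gx), by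
    simp only [map_add, map_mul, map_intCast, pC_gx, pC_gy]; ext <;> simp⟩

theorem pF_surjective : Function.Surjective pF := fun z =>
  ⟨z.re + z.imI * gx + (z.imJ + z.imK * gx) * gy, by
    simp only [map_add, map_mul, map_intCast, pF_gx, pF_gy]; ext <;> simp [lamI, lamJ]⟩

theorem pG_srt : pG (gx + gx ^ 11) = algebraMap Zs _ srt := by
  simp only [map_add, map_pow, pG_gx]; decide +kernel

theorem zs_eq (z : Zs) : z = z.re + z.im * srt := by
  ext <;> simp

theorem pG_surjective : Function.Surjective pG := fun z => by
  have h (w : Zs) : ∃ r, pG r = algebraMap Zs _ w := by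
    refine ⟨w.re + w.im * (gx + gx ^ 11), ?_⟩
    rw [map_add, map_mul, pG_srt, map_intCast, map_intCast]
    conv_rhs => rw [zs_eq w]
    rw [map_add, map_mul, map_intCast, map_intCast]
  choose f hf using h
  refine ⟨f z.re + f z.imI * gx + (f z.imJ + f z.imK * gx) * gy, ?_⟩
  simp only [map_add, map_mul, hf, pG_gx, pG_gy]
  ext1 <;> simp [lamI, lamJ]

theorem exists_pF_eq_two_mul (τ : Lam ℤ 0) : ∃ r, pC r = 0 ∧ pF r = 2 * τ := by
  obtain ⟨t, rfl⟩ := pF_surjective τ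
  refine ⟨(1 - gx ^ 2) * t, ?_, ?_⟩
  · rw [map_mul, map_sub, map_pow, map_one, pC_gx,
      show (1 : Kl ℤ) - ⟨⟨0, 1⟩, 0⟩ ^ 2 = 0 by decide +kernel, zero_mul]
  · rw [map_mul, map_sub, map_pow, map_one, pF_gx,
      show (1 : Lam ℤ 0) - lamI ℤ 0 ^ 2 = 2 by decide +kernel]

theorem exists_pG_eq_srt_mul (τ : Lam Zs srt) :
    ∃ r, pC r = 0 ∧ pF r = 0 ∧ pG r = algebraMap Zs _ srt * τ := by
  obtain ⟨t, rfl⟩ := pG_surjective τ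
  refine ⟨(gx ^ 4 - 1) * gx ^ 7 * t, ?_, ?_, ?_⟩
  · rw [map_mul, map_mul, map_sub, map_pow, map_one, pC_gx,
      show (⟨⟨0, 1⟩, 0⟩ ^ 4 : Kl ℤ) - 1 = 0 by decide +kernel, zero_mul, zero_mul]
  · rw [map_mul, map_mul, map_sub, map_pow, map_one, pF_gx,
      show lamI ℤ 0 ^ 4 - 1 = 0 by decide +kernel, zero_mul, zero_mul]
  · rw [map_mul, map_mul, map_sub, map_pow, map_pow, map_one, pG_gx,
      show (lamI Zs srt ^ 4 - 1) * lamI Zs srt ^ 7 = algebraMap Zs _ srt by decide +kernel]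

theorem exists_eq_two_mul {z : Lam ℤ 0} (h : lamFKl z = 0) : ∃ τ, z = 2 * τ := by
  have h' : ((z.re : ZMod 2) = 0 ∧ (z.imI : ZMod 2) = 0) ∧ (z.imJ : ZMod 2) = 0 ∧
      (z.imK : ZMod 2) = 0 := by
    simpa [QuadraticAlgebra.ext_iff, lamFKl, lamKl] using h
  simp only [ZMod.intCast_zmod_eq_zero_iff_dvd] at h'
  obtain ⟨⟨⟨a, ha⟩, b, hb⟩, ⟨c, hc⟩, d, hd⟩ := h'
  refine ⟨⟨a, b, c, d⟩, ?_⟩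
  rw [two_mul]
  ext <;> simp [ha, hb, hc, hd, two_mul]

theorem zsMod_eq_zero {z : Zs} (h : zsMod z = 0) : ∃ w, z = srt * w := by
  have h' : (z.re : ZMod 3) = 0 := h
  rw [ZMod.intCast_zmod_eq_zero_iff_dvd] at h'
  obtain ⟨a, ha⟩ := h'
  refine ⟨⟨z.im, a⟩, ?_⟩
  ext <;> simp_all

theorem exists_eq_srt_mul {z : Lam Zs srt} (h : lamGMod z = 0) :
    ∃ τ, z = algebraMap Zs _ srt * τ := by
  have h' : zsMod z.re = 0 ∧ zsMod z.imI = 0 ∧ zsMod z.imJ = 0 ∧ zsMod z.imK = 0 := by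
    simpa [QuaternionAlgebra.ext_iff, lamGMod, lamMap] using h
  obtain ⟨ha, hb, hc, hd⟩ := h'
  obtain ⟨a, ha⟩ := zsMod_eq_zero ha
  obtain ⟨b, hb⟩ := zsMod_eq_zero hb
  obtain ⟨c, hc⟩ := zsMod_eq_zero hc
  obtain ⟨d, hd⟩ := zsMod_eq_zero hd
  refine ⟨⟨a, b, c, d⟩, ?_⟩
  ext1 <;> simp_all

theorem exists_lift {x : Kl ℤ} {y : Lam ℤ 0} {z : Lam Zs srt} (h1 : klRed x = lamFKl y)
    (h2 : lamFMod y = lamGMod z) : ∃ r, pC r = x ∧ pF r = y ∧ pG r = z := by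
  obtain ⟨r, rfl⟩ := pC_surjective x
  obtain ⟨τ, hτ⟩ := exists_eq_two_mul (z := y - pF r) (by
    rw [map_sub, ← h1, sub_eq_zero]
    exact RingHom.congr_fun klRed_comp_pC r)
  obtain ⟨t, ht1, ht2⟩ := exists_pF_eq_two_mul τ
  have hy : pF (r + t) = y := by rw [map_add, ht2, ← hτ]; abel
  obtain ⟨σ, hσ⟩ := exists_eq_srt_mul (z := z - pG (r + t)) (by
    rw [map_sub, ← h2, sub_eq_zero, ← hy]
    exact RingHom.congr_fun lamFMod_comp_pF (r + t))
  obtain ⟨s, hs1, hs2, hs3⟩ := exists_pG_eq_srt_mul σ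
  refine ⟨r + t + s, ?_, ?_, ?_⟩
  · rw [map_add, map_add, ht1, hs1]; simp
  · rw [map_add, hs2, hy, add_zero]
  · rw [map_add, hs3, ← hσ]; abel

end Gluing

section MatrixComponents
open Matrix

theorem exists_pP_eq (B : Matrix (Fin 2) (Fin 2) ℤ) :
    ∃ r, pC r = 0 ∧ pF r = 0 ∧ pG r = 0 ∧ pQ r = 0 ∧ pP r = (12 : ℤ) • B := by
  let κ : ZQ24 := (gx - 1) * (1 + gx ^ 3 + gx ^ 6 + gx ^ 9)
  let α : ℤ := -B 0 0 - B 1 1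
  let β : ℤ := B 0 0 + B 1 0 - 3 * B 0 1 - 2 * B 1 1
  let γ : ℤ := -B 0 0 - B 1 0 + B 1 1
  let δ : ℤ := -2 * B 0 0 - B 1 0 + 3 * B 0 1 + 2 * B 1 1
  have h1 : pC κ = 0 := by
    simp only [κ, map_mul, map_sub, map_add, map_pow, map_one, pC_gx]; decide +kernel
  have h2 : pF κ = 0 := by
    simp only [κ, map_mul, map_sub, map_add, map_pow, map_one, pF_gx]; decide +kernel
  have h3 : pG κ = 0 := by
    simp only [κ, map_mul, map_sub, map_add, map_pow, map_one, pG_gx]; decide +kernel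
  have h4 : pQ κ = 0 := by
    simp only [κ, map_mul, map_sub, map_add, map_pow, map_one, pQ_gx]; decide +kernel
  have h5 : pP κ = !![0, 4; -12, -12] := by
    simp only [κ, map_mul, map_sub, map_add, map_pow, map_one, pP_gx]; decide +kernel
  refine ⟨κ * (α • 1 + β • gx + (γ • 1 + δ • gx) * gy), ?_, ?_, ?_, ?_, ?_⟩
  · rw [map_mul, h1, zero_mul]
  · rw [map_mul, h2, zero_mul]
  · rw [map_mul, h3, zero_mul]
  · rw [map_mul, h4, zero_mul]
  · simp only [map_mul, h5, map_add, map_zsmul, map_one, pP_gx, pP_gy]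
    ext i j
    fin_cases i <;> fin_cases j <;>
    simp [-zsmul_eq_mul, -Int.zsmul_eq_mul, -zsmul_one, Matrix.mul_apply, Fin.sum_univ_two,
      smul_eq_mul, matW,
      matY, α, β, γ, δ] <;> ring

theorem exists_pQ_eq (B : Matrix (Fin 2) (Fin 2) ℤ) :
    ∃ r, pC r = 0 ∧ pF r = 0 ∧ pG r = 0 ∧ pP r = 0 ∧ pQ r = (12 : ℤ) • B := by
  let κ : ZQ24 := (-gx - 1) * (1 - gx ^ 3 + gx ^ 6 - gx ^ 9)
  let α : ℤ := -B 0 0 - B 1 1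
  let β : ℤ := B 0 0 + B 1 0 - 3 * B 0 1 - 2 * B 1 1
  let γ : ℤ := -B 0 0 - B 1 0 + B 1 1
  let δ : ℤ := -2 * B 0 0 - B 1 0 + 3 * B 0 1 + 2 * B 1 1
  have h1 : pC κ = 0 := by
    simp only [κ, map_mul, map_sub, map_add, map_neg, map_pow, map_one, pC_gx]; decide +kernel
  have h2 : pF κ = 0 := by
    simp only [κ, map_mul, map_sub, map_add, map_neg, map_pow, map_one, pF_gx]; decide +kernel
  have h3 : pG κ = 0 := by
    simp only [κ, map_mul, map_sub, map_add, map_neg, map_pow, map_one, pG_gx]; decide +kernel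
  have h4 : pP κ = 0 := by
    simp only [κ, map_mul, map_sub, map_add, map_neg, map_pow, map_one, pP_gx]; decide +kernel
  have h5 : pQ κ = !![0, 4; -12, -12] := by
    simp only [κ, map_mul, map_sub, map_add, map_neg, map_pow, map_one, pQ_gx]; decide +kernel
  refine ⟨κ * (α • 1 - β • gx + (γ • 1 - δ • gx) * gy), ?_, ?_, ?_, ?_, ?_⟩
  · rw [map_mul, h1, zero_mul]
  · rw [map_mul, h2, zero_mul]
  · rw [map_mul, h3, zero_mul]
  · rw [map_mul, h4, zero_mul]
  · simp only [map_mul, h5, map_add, map_sub, map_zsmul, map_one, pQ_gx, pQ_gy]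
    ext i j
    fin_cases i <;> fin_cases j <;>
    simp [-zsmul_eq_mul, -Int.zsmul_eq_mul, -zsmul_one, Matrix.mul_apply, Fin.sum_univ_two,
      smul_eq_mul, matW,
      matY, α, β, γ, δ] <;> ring

theorem exists_swap_sign : ∃ r, pC r = 1 ∧ pF r = 1 ∧ pG r = 1 ∧ (pP r).det = 31 ∧
    (pQ r).det = 43 := by
  refine ⟨1 + (gx ^ 4 - 1) * (gx ^ 4 - gx ^ 2 + 1) * (gx ^ 4 - 1) * gx, ?_, ?_, ?_, ?_, ?_⟩
  · simp only [map_mul, map_sub, map_add, map_pow, map_one, pC_gx]; decide +kernel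
  · simp only [map_mul, map_sub, map_add, map_pow, map_one, pF_gx]; decide +kernel
  · simp only [map_mul, map_sub, map_add, map_pow, map_one, pG_gx]; decide +kernel
  · simp only [map_mul, map_sub, map_add, map_pow, map_one, pP_gx]
    rw [det_fin_two]; decide +kernel
  · simp only [map_mul, map_sub, map_add, map_pow, map_one, pQ_gx]
    rw [det_fin_two]; decide +kernel

/-- The reduction of `ℤ[c]/(c² - 1)` modulo two, as a subring of the overlap of the last component
with the matrix component. -/
def cycSq : Cyc ℤ →+* Sq (Cyc (ZMod 2)) cGen := (algebraMap _ _).comp cycRed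

theorem bdet_overlap {m : Type*} [Fintype m] [DecidableEq m] (M : Matrix m m ZQ24) :
    bdet (quatRep.comp (lamGCyc.comp pG)) M = cycSq (bdet pT M) := by
  have hx : (!![⟨0, cGen⟩, ⟨1, cGen⟩; 1, 1] : Matrix (Fin 2) (Fin 2) (Sq (Cyc (ZMod 2)) cGen)) *
      (quatRep.comp (lamGCyc.comp pG)) gx = (cycSq.mapMatrix.comp pT) gx *
      !![⟨0, cGen⟩, ⟨1, cGen⟩; 1, 1] := by
    simp only [RingHom.comp_apply, pG_gx, pT_gx]
    decide +kernel
  have hy : (!![⟨0, cGen⟩, ⟨1, cGen⟩; 1, 1] : Matrix (Fin 2) (Fin 2) (Sq (Cyc (ZMod 2)) cGen)) *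
      (quatRep.comp (lamGCyc.comp pG)) gy = (cycSq.mapMatrix.comp pT) gy *
      !![⟨0, cGen⟩, ⟨1, cGen⟩; 1, 1] := by
    simp only [RingHom.comp_apply, pG_gy, pT_gy]
    decide +kernel
  rw [map_bdet]
  refine bdet_conj (G := !![⟨0, cGen⟩, ⟨1, cGen⟩; 1, 1]) (H := !![1, ⟨1, cGen⟩; 1, ⟨0, cGen⟩]) ?_
    (fun r => ?_) M
  · decide +kernel
  · exact intertwine hx hy r

theorem bdet_upper_triangular {D A m : Type*} [Ring D] [CommRing A] [Fintype m] [DecidableEq m]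
    (ρ : D →+* Matrix (Fin 2) (Fin 2) A) (χ ψ : D →+* A)
    (h : ∀ r, ρ r 1 0 = 0 ∧ ρ r 0 0 = χ r ∧ ρ r 1 1 = ψ r) (M : Matrix m m D) :
    bdet ρ M = (M.map χ).det * (M.map ψ).det := by
  let s : m ⊕ m ≃ m × Fin 2 :=
    (Equiv.boolProdEquivSum m).symm.trans ((Equiv.prodComm _ _).trans
      ((Equiv.refl m).prodCongr finTwoEquiv.symm))
  rw [bdet, ← det_submatrix_equiv_self s,
    ← det_fromBlocks_zero₂₁ (M.map χ) (M.map fun r => ρ r 0 1)]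
  congr 1
  ext (i | i) (j | j) <;>
    simp [s, h, show finTwoEquiv.symm false = 0 from rfl, show finTwoEquiv.symm true = 1 from rfl]

theorem pP_triangular (r : ZQ24) :
    ((Int.castRingHom (ZMod 3)).mapMatrix.comp pP) r 1 0 = 0 ∧
    ((Int.castRingHom (ZMod 3)).mapMatrix.comp pP) r 0 0 =
      ((klEval 1 1 (by decide) (by decide)).comp pC) r ∧
    ((Int.castRingHom (ZMod 3)).mapMatrix.comp pP) r 1 1 =
      ((klEval 1 (-1) (by decide) (by decide)).comp pC) r := by
  induction r using ZQ24_induction with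
  | hx => simp only [RingHom.comp_apply, pP_gx, pC_gx]; decide +kernel
  | hy => simp only [RingHom.comp_apply, pP_gy, pC_gy]; decide +kernel
  | h1 => simp
  | hneg a ha => simp only [map_neg, Matrix.neg_apply, ha, neg_zero, and_self]
  | hadd a b ha hb => simp only [map_add, Matrix.add_apply, ha, hb, add_zero, and_self]
  | hmul a b ha hb => simp only [map_mul, Matrix.mul_apply, Fin.sum_univ_two, ha, hb, zero_mul,
      mul_zero, add_zero, zero_add, and_self]

theorem pQ_triangular (r : ZQ24) :
    ((Int.castRingHom (ZMod 3)).mapMatrix.comp pQ) r 1 0 = 0 ∧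
    ((Int.castRingHom (ZMod 3)).mapMatrix.comp pQ) r 0 0 =
      ((klEval (-1) 1 (by decide) (by decide)).comp pC) r ∧
    ((Int.castRingHom (ZMod 3)).mapMatrix.comp pQ) r 1 1 =
      ((klEval (-1) (-1) (by decide) (by decide)).comp pC) r := by
  induction r using ZQ24_induction with
  | hx => simp only [RingHom.comp_apply, pQ_gx, pC_gx]; decide +kernel
  | hy => simp only [RingHom.comp_apply, pQ_gy, pC_gy]; decide +kernel
  | h1 => simp
  | hneg a ha => simp only [map_neg, Matrix.neg_apply, ha, neg_zero, and_self]
  | hadd a b ha hb => simp only [map_add, Matrix.add_apply, ha, hb, add_zero, and_self]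
  | hmul a b ha hb => simp only [map_mul, Matrix.mul_apply, Fin.sum_univ_two, ha, hb, zero_mul,
      mul_zero, add_zero, zero_add, and_self]

/-- If the determinant in the commutative component is one, then the determinants in the matrix
components are one modulo three. -/
theorem bdet_mod_three {m : Type*} [Fintype m] [DecidableEq m] (M : Matrix m m ZQ24)
    (h : (M.map pC).det = 1) :
    ((bdet pP M : ℤ) : ZMod 3) = 1 ∧ ((bdet pQ M : ℤ) : ZMod 3) = 1 := by
  have key (f : Kl ℤ →+* ZMod 3) : (M.map (f.comp pC)).det = 1 := by
    have := congrArg f h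
    rw [RingHom.map_det, map_one] at this
    exact this
  constructor
  · refine (map_bdet (Int.castRingHom (ZMod 3)) pP M).trans ?_
    rw [bdet_upper_triangular _ _ _ pP_triangular, key, key, one_mul]
  · refine (map_bdet (Int.castRingHom (ZMod 3)) pQ M).trans ?_
    rw [bdet_upper_triangular _ _ _ pQ_triangular, key, key, one_mul]

/-- If the determinant in the last component is one modulo two, then the determinants in the matrix
components are odd and agree modulo four. -/
theorem bdet_mod_four {m : Type*} [Fintype m] [DecidableEq m] (M : Matrix m m ZQ24)
    (h : bdet (quatRep.comp (lamGCyc.comp pG)) M = 1) :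
    bdet pP M % 4 = bdet pQ M % 4 ∧ bdet pP M % 2 = 1 := by
  rw [bdet_overlap] at h
  have hP : bdet pP M = cycEval 1 (by norm_num) (bdet pT M) := (map_bdet _ _ _).symm
  have hQ : bdet pQ M = cycEval (-1) (by norm_num) (bdet pT M) := (map_bdet _ _ _).symm
  rw [cycEval_apply] at hP hQ
  generalize bdet pT M = z at *
  have h' : ((z.re : ZMod 2) = 1 ∧ (z.im : ZMod 2) = 0) := by
    have := congrArg QuadraticAlgebra.re h
    simpa [cycSq, cycRed, QuadraticAlgebra.ext_iff, QuadraticAlgebra.re_one,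
      QuadraticAlgebra.im_one] using this
  have h1 : z.re % 2 = 1 := by
    have : ((z.re : ℤ) : ZMod 2) = ((1 : ℤ) : ZMod 2) := by simpa using h'.1
    simpa using (ZMod.intCast_eq_intCast_iff' _ _ 2).1 this
  have h2 : z.im % 2 = 0 := by
    have : ((z.im : ℤ) : ZMod 2) = ((0 : ℤ) : ZMod 2) := by simpa using h'.2
    simpa using (ZMod.intCast_eq_intCast_iff' _ _ 2).1 this
  omega

end MatrixComponents

section SpecialLinear
open Matrix

theorem exists_eq_mul_upper_triangular (g : Matrix (Fin 2) (Fin 2) ℤ) :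
    ∃ U : Matrix (Fin 2) (Fin 2) ℤ, U.det = 1 ∧ ∃ a b d : ℤ, g = U * !![a, b; 0, d] := by
  obtain ⟨x, z, hx, hz, hu⟩ := extract_gcd (g 0 0) (g 1 0)
  obtain ⟨u, v, huv⟩ : IsCoprime x z := by rwa [← gcd_isUnit_iff]
  obtain ⟨e, he⟩ : ∃ e, e = gcd (g 0 0) (g 1 0) := ⟨_, rfl⟩
  rw [← he] at hx hz
  refine ⟨!![x, -v; z, u], by rw [det_fin_two_of]; linear_combination huv, e,
    u * g 0 1 + v * g 1 1, -z * g 0 1 + x * g 1 1, ?_⟩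
  ext i j
  fin_cases i <;> fin_cases j <;> simp [Matrix.mul_apply, Fin.sum_univ_two]
  · linear_combination hx
  · linear_combination -g 0 1 * huv
  · linear_combination hz
  · linear_combination -g 1 1 * huv

theorem exists_det_eq_one_of_modEq (n : ℤ) (g : Matrix (Fin 2) (Fin 2) ℤ) (hg : n ∣ g.det - 1) :
    ∃ h B : Matrix (Fin 2) (Fin 2) ℤ, h.det = 1 ∧ g = h + n • B := by
  obtain ⟨U, hU, a, b, d, rfl⟩ := exists_eq_mul_upper_triangular g
  obtain ⟨t, ht⟩ := hg
  rw [det_mul, hU, one_mul, det_fin_two_of] at ht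
  refine ⟨U * (!![2 * a - a * a * d, a * d - 1; 1 - a * d, d] * !![1, d * b; 0, 1]),
    U * !![a * t, a * d * b * t - t - t * b; t, t * d * b], ?_, ?_⟩
  · rw [det_mul, det_mul, hU, det_fin_two_of, det_fin_two_of]; ring
  · rw [← Matrix.mul_smul, ← mul_add]
    congr 1
    ext i j
    fin_cases i <;> fin_cases j <;> simp [Matrix.mul_apply, Fin.sum_univ_two]
    · linear_combination a * ht
    · linear_combination (a * d * b - 1 - b) * ht
    · linear_combination ht
    · linear_combination d * b * ht

end SpecialLinear

section Classification
open Matrix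

/-- An element of `2Λ`. -/
def lamU : Lam Zs srt := ⟨-2, 2, 2, 0⟩

/-- An element of `2Λ`. -/
def lamW : Lam Zs srt := ⟨0, 2, -2, -2⟩

/-- Representatives of the three classes. -/
def gam : Fin 3 → Lam Zs srt := ![1, 1 + lamU * lamW, 1 - lamU * lamW]

variable {k : Type} [Fintype k] [DecidableEq k]

theorem bdet_scalar {A m : Type*} [CommRing A] [Fintype m] [DecidableEq m] (M : Matrix m m A) :
    bdet (scalar Unit) M = M.det := by
  rw [bdet, ← det_submatrix_equiv_self (Equiv.prodPUnit m).symm]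
  congr 1

theorem kernel_column_unique {A : Type*} [CommRing A] {N : Matrix k (Unit ⊕ k) A}
    {C : Matrix (Unit ⊕ k) k A} (hNC : N * C = 1) {c c' : Matrix (Unit ⊕ k) Unit A}
    (hc : N * c = 0) (hc' : N * c' = 0) (hd : (fromCols c C).det = 1)
    (hd' : (fromCols c' C).det = 1) : c = c' := by
  have hu : IsUnit (fromCols c C).det := by rw [hd]; exact isUnit_one
  obtain ⟨V, -, -, hV⟩ := exists_splitting hNC hc (nonsing_inv_mul _ hu) (mul_nonsing_inv _ hu)
  have h1 : c' = c * (V * c') := by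
    have := congrArg (· * c') hV
    simp only [Matrix.add_mul, Matrix.mul_assoc, hc', Matrix.mul_zero, add_zero,
      Matrix.one_mul] at this
    exact this.symm
  have h2 : (V * c') () () = 1 := by
    have := bdet_fromCols_mul (scalar Unit) c (V * c') C
    rw [← h1, bdet_scalar, bdet_scalar, hd, hd'] at this
    simpa using this.symm
  have h3 : V * c' = 1 := by ext ⟨⟩ ⟨⟩; simpa using h2
  rw [h3, Matrix.mul_one] at h1
  exact h1.symm

theorem kernel_column_eq_mul {A : Type*} [CommRing A] {b : A} {N : Matrix k (Unit ⊕ k) (Lam A b)}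
    {C : Matrix (Unit ⊕ k) k (Lam A b)} (hNC : N * C = 1) {c c' : Matrix (Unit ⊕ k) Unit (Lam A b)}
    (hc : N * c = 0) (hc' : N * c' = 0) (hd : bdet quatRep (fromCols c C) = 1)
    (hd' : bdet quatRep (fromCols c' C) = 1) :
    ∃ g : Matrix Unit Unit (Lam A b), c' = c * g ∧ nr (g () ()) = 1 := by
  have hu : IsUnit (bdet quatRep (fromCols c C)) := by rw [hd]; exact isUnit_one
  obtain ⟨X, hX, hX'⟩ := exists_inverse_of_isUnit_bdet hu
  obtain ⟨V, -, -, hV⟩ := exists_splitting hNC hc hX hX'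
  have h1 : c' = c * (V * c') := by
    have := congrArg (· * c') hV
    simp only [Matrix.add_mul, Matrix.mul_assoc, hc', Matrix.mul_zero, add_zero,
      Matrix.one_mul] at this
    exact this.symm
  refine ⟨V * c', h1, ?_⟩
  have := bdet_fromCols_mul quatRep c (V * c') C
  rw [← h1, hd, hd', det_quatRep, one_mul] at this
  apply QuadraticAlgebra.algebraMap_injective (a := (-1 : A)) (b := b)
  rw [← this, map_one]

theorem bdet_quatRep_map {A A' : Type*} [CommRing A] [CommRing A'] {b : A} {b' : A'} (f : A →+* A')
    (h : f b = b') {m : Type*} [Fintype m] [DecidableEq m] (M : Matrix m m (Lam A b)) :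
    bdet quatRep (M.map (lamMap f h)) = sqMap f h (bdet quatRep M) := by
  rw [map_bdet, ← quatRep_lamMap]; rfl

/-- Reduction of the Lipschitz quaternions modulo four. -/
def lamFour : Lam ℤ 0 →+* Lam (ZMod 4) 0 := lamMap (Int.castRingHom _) (by simp)

/-- The reduction of quaternions modulo four to `Kl`. -/
def lamFourKl : Lam (ZMod 4) 0 →+* Kl (ZMod 2) := lamKl (ZMod.castHom (by decide) (ZMod 2))

theorem lamFourKl_comp : lamFourKl.comp lamFour = lamFKl := by
  ext z <;> simp [lamFourKl, lamFour, lamFKl, lamKl, lamMap]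

theorem lam_four_isUnit_iff (q : Lam (ZMod 4) 0) :
    IsUnit q ↔ ZMod.castHom (by decide : 2 ∣ 4) (ZMod 2) (q.re + q.imI + q.imJ + q.imK) ≠ 0 := by
  rw [isUnit_lam_iff, isUnit_iff_exists_inv, nr_eq]
  obtain ⟨x, y, z, w⟩ := q
  simp only
  revert x y z w
  decide +kernel

theorem lam_four_isLocal (a b : Lam (ZMod 4) 0) (h : IsUnit (a + b)) : IsUnit a ∨ IsUnit b := by
  rw [lam_four_isUnit_iff] at h ⊢
  rw [lam_four_isUnit_iff]
  by_contra! h'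
  apply h
  simp only [map_add, QuaternionAlgebra.re_add, QuaternionAlgebra.imI_add,
    QuaternionAlgebra.imJ_add, QuaternionAlgebra.imK_add] at h' ⊢
  linear_combination h'.1 + h'.2

theorem exists_lamFKl_inverse (d : Lam (ZMod 4) 0) (h : nr d = 1) :
    ∃ u : Lam ℤ 0, nr u = 1 ∧ lamFourKl d * lamFKl u = 1 := by
  have key : ∀ x y z w : ZMod 4, nr (⟨x, y, z, w⟩ : Lam (ZMod 4) 0) = 1 →
      ∃ u ∈ [(1 : Lam ℤ 0), ⟨0, 1, 0, 0⟩, ⟨0, 0, 1, 0⟩, ⟨0, 0, 0, 1⟩],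
        nr u = 1 ∧ lamFourKl ⟨x, y, z, w⟩ * lamFKl u = 1 := by
    decide +kernel
  obtain ⟨u, -, hu⟩ := key d.re d.imI d.imJ d.imK h
  exact ⟨u, hu⟩

theorem exists_lamGMod_inverse (g : Lam (ZMod 3) 0) (h : nr g = 1) :
    ∃ (u : Lam Zs srt) (i : Fin 3), nr u = 1 ∧ g * lamGMod u * lamGMod (gam i) = 1 := by
  have key : ∀ x y z w : ZMod 3, nr (⟨x, y, z, w⟩ : Lam (ZMod 3) 0) = 1 →
      ∃ u ∈ [(1 : Lam Zs srt), ⟨0, 1, 0, 0⟩, ⟨0, 0, 1, 0⟩, ⟨0, 0, 0, 1⟩, -1, ⟨0, -1, 0, 0⟩,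
        ⟨0, 0, -1, 0⟩, ⟨0, 0, 0, -1⟩], ∃ i : Fin 3,
        nr u = 1 ∧ ⟨x, y, z, w⟩ * lamGMod u * lamGMod (gam i) = 1 := by
    decide +kernel
  obtain ⟨u, -, i, hu⟩ := key g.re g.imI g.imJ g.imK h
  exact ⟨u, i, hu⟩

/-- The one by one matrix with a given entry. -/
abbrev one1 {D : Type*} (d : D) : Matrix Unit Unit D := of fun _ _ => d

theorem map_map_of_comp {A B B' D : Type*} [Ring A] [Ring B] [Ring B'] [Ring D] {m n : Type*}
    {f : B →+* D} {g : A →+* B} {f' : B' →+* D} {g' : A →+* B'} (h : f.comp g = f'.comp g')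
    (M : Matrix m n A) : (M.map g).map f = (M.map g').map f' := by
  ext i j
  exact RingHom.congr_fun h (M i j)

theorem matrix_map_mul_eq_one {A B : Type*} [Ring A] [Ring B] (f : A →+* B)
    {N : Matrix k (Unit ⊕ k) A}
    {C : Matrix (Unit ⊕ k) k A} (hNC : N * C = 1) : N.map f * C.map f = 1 := by
  rw [← Matrix.map_mul, hNC, Matrix.map_one _ (map_zero f) (map_one f)]

theorem matrix_map_mul_eq_zero {A B : Type*} [Ring A] [Ring B] (f : A →+* B)
    {N : Matrix k (Unit ⊕ k) A}
    {c : Matrix (Unit ⊕ k) Unit A} (hNC : N * c = 0) : N.map f * c.map f = 0 := by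
  rw [← Matrix.map_mul, hNC, Matrix.map_zero _ (map_zero f)]

/-- Compatible generators of the kernel over the first two components. -/
theorem exists_columns_CF {N : Matrix k (Unit ⊕ k) ZQ24} {C : Matrix (Unit ⊕ k) k ZQ24}
    (hNC : N * C = 1) :
    ∃ (cC : Matrix (Unit ⊕ k) Unit (Kl ℤ)) (cF : Matrix (Unit ⊕ k) Unit (Lam ℤ 0)),
      N.map pC * cC = 0 ∧ N.map pF * cF = 0 ∧ (fromCols cC (C.map pC)).det = 1 ∧
      bdet quatRep (fromCols cF (C.map pF)) = 1 ∧ cC.map klRed = cF.map lamFKl := by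
  obtain ⟨cC, hcC, hdC⟩ := exists_kernel_column (matrix_map_mul_eq_one pC hNC)
  obtain ⟨c, hc, hd⟩ := exists_kernel_column_int (matrix_map_mul_eq_one pF hNC)
  obtain ⟨V, hV, -⟩ := exists_inverse_of_isUnit_bdet (M := fromCols c (C.map pF))
    (by rw [hd]; exact isUnit_one)
  obtain ⟨d, -, hρ⟩ := exists_isUnit_forall_bdet_eq lam_four_isLocal lam_mul_eq_one_comm _
    (Unit ⊕ k) rfl ((fromCols c (C.map pF)).map lamFour) (V.map lamFour)
    (by rw [← Matrix.map_mul, hV, Matrix.map_one _ (map_zero _) (map_one _)])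
  have hnr : nr d = 1 := by
    have h1 := hρ _ _ quatRep
    rw [lamFour, bdet_quatRep_map, hd, map_one, det_quatRep] at h1
    apply QuadraticAlgebra.algebraMap_injective (a := (-1 : ZMod 4)) (b := 0)
    rw [← h1, map_one]
  obtain ⟨u, hu, hdu⟩ := exists_lamFKl_inverse d hnr
  have hF : bdet ((scalar Unit).comp lamFKl) (fromCols c (C.map pF)) = lamFourKl d := by
    have h1 := hρ _ _ ((scalar Unit).comp lamFourKl)
    rw [← bdet_comp, RingHom.comp_assoc, lamFourKl_comp] at h1
    simpa using h1
  have hNc : N.map pF * (c * one1 u) = 0 := by rw [← Matrix.mul_assoc, hc, Matrix.zero_mul]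
  refine ⟨cC, c * one1 u, hcC, hNc, hdC, ?_, ?_⟩
  · rw [bdet_fromCols_mul, hd, det_quatRep, one_mul]
    simp [hu]
  · have hmap : (N.map pC).map klRed = (N.map pF).map lamFKl := map_map_of_comp klRed_comp_pC N
    have hmap' : (C.map pC).map klRed = (C.map pF).map lamFKl := map_map_of_comp klRed_comp_pC C
    refine kernel_column_unique (N := (N.map pC).map klRed) (C := (C.map pC).map klRed)
      (matrix_map_mul_eq_one _ (matrix_map_mul_eq_one _ hNC)) (matrix_map_mul_eq_zero _ hcC)
        ?_ ?_ ?_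
    · rw [hmap]; exact matrix_map_mul_eq_zero _ hNc
    · have := congrArg klRed hdC
      rw [RingHom.map_det, map_one] at this
      rw [← map_fromCols]; exact this
    · rw [hmap', ← map_fromCols, ← bdet_scalar, ← bdet_comp, bdet_fromCols_mul, hF, ← hdu]
      simp

theorem exists_columns_CFG {N : Matrix k (Unit ⊕ k) ZQ24} {C : Matrix (Unit ⊕ k) k ZQ24}
    (hNC : N * C = 1) :
    ∃ (i : Fin 3) (c : Matrix (Unit ⊕ k) Unit ZQ24) (c' : Matrix (Unit ⊕ k) Unit (Lam Zs srt)),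
      N * c = 0 ∧ ((fromCols c C).map pC).det = 1 ∧ bdet (quatRep.comp pF) (fromCols c C) = 1 ∧
      c.map pG = c' * one1 (gam i) ∧ bdet quatRep (fromCols c' (C.map pG)) = 1 := by
  obtain ⟨cC, cF, hC, hF, hdC, hdF, hCF⟩ := exists_columns_CF hNC
  obtain ⟨cG, hG, hdG⟩ := exists_kernel_column_zs (matrix_map_mul_eq_one pG hNC)
  have hN : (N.map pF).map lamFMod = (N.map pG).map lamGMod := map_map_of_comp lamFMod_comp_pF N
  have hC' : (C.map pF).map lamFMod = (C.map pG).map lamGMod := map_map_of_comp lamFMod_comp_pF C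
  obtain ⟨g, hg, hgn⟩ := kernel_column_eq_mul (N := (N.map pF).map lamFMod)
    (C := (C.map pF).map lamFMod) (c := cF.map lamFMod) (c' := cG.map lamGMod)
    (matrix_map_mul_eq_one _ (matrix_map_mul_eq_one _ hNC)) (matrix_map_mul_eq_zero _ hF)
    (by rw [hN]; exact matrix_map_mul_eq_zero _ hG)
    (by rw [← map_fromCols, lamFMod, bdet_quatRep_map, hdF, map_one])
    (by rw [hC', ← map_fromCols, lamGMod, bdet_quatRep_map, hdG, map_one])
  obtain ⟨u, i, hu, hgu⟩ := exists_lamGMod_inverse _ hgn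
  have hlift (s : Unit ⊕ k) : ∃ r, pC r = cC s () ∧ pF r = cF s () ∧
      pG r = (cG * one1 u * one1 (gam i)) s () := by
    refine exists_lift (congrFun₂ hCF s ()) ?_
    have h1 := congrFun₂ hg s ()
    simp only [Matrix.mul_apply, Matrix.map_apply, of_apply, Finset.univ_unique,
      Finset.sum_singleton] at h1 ⊢
    rw [map_mul, map_mul, h1, mul_assoc (lamFMod _), mul_assoc (lamFMod _)]
    erw [hgu]
    rw [mul_one]
  choose c₀ h₀C h₀F h₀G using hlift
  have e1 : (of fun s _ => c₀ s : Matrix (Unit ⊕ k) Unit ZQ24).map pC = cC := by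
    ext1 s t; exact h₀C s
  have e2 : (of fun s _ => c₀ s : Matrix (Unit ⊕ k) Unit ZQ24).map pF = cF := by
    ext1 s t; exact h₀F s
  have e3 : (of fun s _ => c₀ s : Matrix (Unit ⊕ k) Unit ZQ24).map pG =
      cG * one1 u * one1 (gam i) := by
    ext1 s t; exact h₀G s
  generalize (of fun s _ => c₀ s : Matrix (Unit ⊕ k) Unit ZQ24) = c at e1 e2 e3
  have hproj {B : Type} [Ring B] (f : ZQ24 →+* B) (h : N.map f * c.map f = 0) :
      (((1 : Matrix (Unit ⊕ k) (Unit ⊕ k) ZQ24) - C * N) * c).map f = c.map f := by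
    rw [Matrix.sub_mul, Matrix.one_mul, Matrix.mul_assoc, Matrix.map_sub _ (map_sub f),
      Matrix.map_mul, Matrix.map_mul, h, Matrix.mul_zero, sub_zero]
  refine ⟨i, ((1 : Matrix (Unit ⊕ k) (Unit ⊕ k) ZQ24) - C * N) * c, cG * one1 u, ?_, ?_, ?_, ?_, ?_⟩
  · rw [← Matrix.mul_assoc, Matrix.mul_sub, ← Matrix.mul_assoc, hNC, Matrix.mul_one,
      Matrix.one_mul, sub_self, Matrix.zero_mul]
  · rw [map_fromCols, hproj pC (by rw [e1, hC]), e1, hdC]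
  · rw [bdet_comp, map_fromCols, hproj pF (by rw [e2, hF]), e2, hdF]
  · rw [hproj pG, e3]
    rw [e3, ← Matrix.mul_assoc, ← Matrix.mul_assoc, hG, Matrix.zero_mul, Matrix.zero_mul]
  · rw [bdet_fromCols_mul, hdG, det_quatRep, one_mul]
    simp [hu]

end Classification

section GoodColumn
open Matrix

variable {k : Type} [Fintype k] [DecidableEq k]

theorem kernel_column_eq_mul_matrix {A κ : Type*} [CommRing A] [Fintype κ] [DecidableEq κ]
    {N : Matrix k (Unit ⊕ k) (Matrix κ κ A)}
    {C : Matrix (Unit ⊕ k) k (Matrix κ κ A)} (hNC : N * C = 1)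
    {c c' : Matrix (Unit ⊕ k) Unit (Matrix κ κ A)}
    (hc : N * c = 0) (hc' : N * c' = 0) (hd : bdet (RingHom.id _) (fromCols c C) = 1) :
    ∃ g : Matrix κ κ A, c' = c * one1 g ∧ bdet (RingHom.id _) (fromCols c' C) = g.det := by
  obtain ⟨X, hX, hX'⟩ := exists_inverse_of_isUnit_bdet_id (M := fromCols c C)
    (by rw [hd]; exact isUnit_one)
  obtain ⟨V, -, -, hV⟩ := exists_splitting hNC hc hX hX'
  have h1 : c' = c * (V * c') := by
    have := congrArg (· * c') hV
    simp only [Matrix.add_mul, Matrix.mul_assoc, hc', Matrix.mul_zero, add_zero,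
      Matrix.one_mul] at this
    exact this.symm
  have h2 : V * c' = one1 ((V * c') () ()) := by ext1 ⟨⟩ ⟨⟩; rfl
  refine ⟨(V * c') () (), by rw [← h2, ← h1], ?_⟩
  have := bdet_fromCols_mul (RingHom.id _) c (V * c') C
  rw [← h1, hd, one_mul] at this
  exact this

theorem bdet_fromCols_one1 {D A κ : Type*} [Ring D] [CommRing A] [Fintype κ] [DecidableEq κ]
    (ρ : D →+* Matrix κ κ A) (c : Matrix (Unit ⊕ k) Unit D) (d : D) (C : Matrix (Unit ⊕ k) k D) :
    bdet ρ (fromCols (c * one1 d) C) = bdet ρ (fromCols c C) * (ρ d).det :=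
  bdet_fromCols_mul ρ c (one1 d) C

theorem exists_columns_adjusted {N : Matrix k (Unit ⊕ k) ZQ24} {C : Matrix (Unit ⊕ k) k ZQ24}
    (hNC : N * C = 1) :
    ∃ (i : Fin 3) (c : Matrix (Unit ⊕ k) Unit ZQ24) (c' : Matrix (Unit ⊕ k) Unit (Lam Zs srt)),
      N * c = 0 ∧ ((fromCols c C).map pC).det = 1 ∧ bdet (quatRep.comp pF) (fromCols c C) = 1 ∧
      c.map pG = c' * one1 (gam i) ∧ bdet quatRep (fromCols c' (C.map pG)) = 1 ∧
      12 ∣ bdet pP (fromCols c C) - 1 ∧ 12 ∣ bdet pQ (fromCols c C) - 1 := by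
  obtain ⟨i, c, c', hN, hdC, hdF, hG, hdG⟩ := exists_columns_CFG hNC
  have h4 : bdet (quatRep.comp (lamGCyc.comp pG)) (fromCols c C) = 1 := by
    rw [← RingHom.comp_assoc, bdet_comp, map_fromCols, hG, bdet_fromCols_one1]
    rw [lamGCyc, quatRep_lamMap, ← map_bdet, hdG, map_one, one_mul, RingHom.comp_apply,
      ← RingHom.map_det, det_quatRep]
    have key : ∀ i : Fin 3, sqMap zsCyc (by simp [zsCyc]) (algebraMap Zs (Sq Zs srt) (nr (gam i))) =
        (1 : Sq (Cyc (ZMod 2)) cGen) := by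
      decide +kernel
    exact key i
  obtain ⟨h4a, h4b⟩ := bdet_mod_four _ h4
  obtain ⟨h3a, h3b⟩ := bdet_mod_three _ hdC
  have h3a' : bdet pP (fromCols c C) % 3 = 1 := by
    simpa using (ZMod.intCast_eq_intCast_iff' _ 1 3).1 (by simpa using h3a)
  have h3b' : bdet pQ (fromCols c C) % 3 = 1 := by
    simpa using (ZMod.intCast_eq_intCast_iff' _ 1 3).1 (by simpa using h3b)
  by_cases h : bdet pP (fromCols c C) % 4 = 1
  · exact ⟨i, c, c', hN, hdC, hdF, hG, hdG, by omega, by omega⟩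
  · obtain ⟨r, hrC, hrF, hrG, hrP, hrQ⟩ := exists_swap_sign
    have hmap {B : Type} [Ring B] (f : ZQ24 →+* B) (hf : f r = 1) :
        (c * one1 r).map f = c.map f := by
      have : (one1 r).map f = 1 := by ext1 ⟨⟩ ⟨⟩; simpa using hf
      rw [Matrix.map_mul, this, Matrix.mul_one]
    refine ⟨i, c * one1 r, c', ?_, ?_, ?_, ?_, hdG, ?_, ?_⟩
    · rw [← Matrix.mul_assoc, hN, Matrix.zero_mul]
    · rw [map_fromCols, hmap pC hrC, ← map_fromCols, hdC]
    · rw [bdet_comp, map_fromCols, hmap pF hrF, ← map_fromCols, ← bdet_comp, hdF]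
    · rw [hmap pG hrG, hG]
    · rw [bdet_fromCols_one1, hrP]; omega
    · rw [bdet_fromCols_one1, hrQ]; omega

theorem exists_good_column {N : Matrix k (Unit ⊕ k) ZQ24} {C : Matrix (Unit ⊕ k) k ZQ24}
    (hNC : N * C = 1) :
    ∃ (i : Fin 3) (c : Matrix (Unit ⊕ k) Unit ZQ24) (c' : Matrix (Unit ⊕ k) Unit (Lam Zs srt)),
      N * c = 0 ∧ ((fromCols c C).map pC).det = 1 ∧ bdet (quatRep.comp pF) (fromCols c C) = 1 ∧
      c.map pG = c' * one1 (gam i) ∧ bdet quatRep (fromCols c' (C.map pG)) = 1 ∧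
      bdet pP (fromCols c C) = 1 ∧ bdet pQ (fromCols c C) = 1 := by
  obtain ⟨i, c, c', hN, hdC, hdF, hG, hdG, hP, hQ⟩ := exists_columns_adjusted hNC
  have key (f : ZQ24 →+* Matrix (Fin 2) (Fin 2) ℤ) (hf : 12 ∣ bdet f (fromCols c C) - 1) :
      ∃ (K : Matrix (Unit ⊕ k) Unit (Matrix (Fin 2) (Fin 2) ℤ))
        (B : Matrix (Unit ⊕ k) Unit (Matrix (Fin 2) (Fin 2) ℤ)), N.map f * K = 0 ∧
        c.map f = K + (12 : ℤ) • B ∧ bdet (RingHom.id _) (fromCols K (C.map f)) = 1 := by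
    obtain ⟨K, hNK, hK⟩ := exists_kernel_column_of_isPrincipalIdealRing
      (matrix_map_mul_eq_one f hNC)
    obtain ⟨g, hg, hdet⟩ := kernel_column_eq_mul_matrix (matrix_map_mul_eq_one f hNC) hNK
      (matrix_map_mul_eq_zero f hN) hK
    rw [← map_fromCols, ← bdet_comp, RingHom.id_comp] at hdet
    rw [hdet] at hf
    obtain ⟨h, B, hh, rfl⟩ := exists_det_eq_one_of_modEq 12 g hf
    refine ⟨K * one1 h, K * one1 B, ?_, ?_, ?_⟩
    · rw [← Matrix.mul_assoc, hNK, Matrix.zero_mul]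
    · rw [hg, ← Matrix.mul_smul, ← Matrix.mul_add]
      rfl
    · rw [bdet_fromCols_mul, hK, one_mul]
      exact hh
  obtain ⟨K₁, B₁, hNK₁, hc₁, hd₁⟩ := key pP hP
  obtain ⟨K₂, B₂, hNK₂, hc₂, hd₂⟩ := key pQ hQ
  choose r₁ r₁C r₁F r₁G r₁Q r₁P using fun s => exists_pP_eq (B₁ s ())
  choose r₂ r₂C r₂F r₂G r₂P r₂Q using fun s => exists_pQ_eq (B₂ s ())
  obtain ⟨c₀, hc₀⟩ : ∃ c₀ : Matrix (Unit ⊕ k) Unit ZQ24,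
      c₀ = of fun s _ => c s () - r₁ s - r₂ s := ⟨_, rfl⟩
  have eC : c₀.map pC = c.map pC := by ext1 s ⟨⟩; simp [hc₀, r₁C, r₂C]
  have eF : c₀.map pF = c.map pF := by ext1 s ⟨⟩; simp [hc₀, r₁F, r₂F]
  have eG : c₀.map pG = c.map pG := by ext1 s ⟨⟩; simp [hc₀, r₁G, r₂G]
  have eP : c₀.map pP = K₁ := by
    ext1 s ⟨⟩
    have := congrFun₂ hc₁ s ()
    simp only [Matrix.map_apply, Matrix.add_apply, Matrix.smul_apply] at this
    simp only [hc₀, Matrix.map_apply, of_apply, map_sub, r₁P, r₂P, this, sub_zero,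
      add_sub_cancel_right]
  have eQ : c₀.map pQ = K₂ := by
    ext1 s ⟨⟩
    have := congrFun₂ hc₂ s ()
    simp only [Matrix.map_apply, Matrix.add_apply, Matrix.smul_apply] at this
    simp only [hc₀, Matrix.map_apply, of_apply, map_sub, r₁Q, r₂Q, this, sub_zero,
      add_sub_cancel_right]
  have hproj {B : Type} [Ring B] (f : ZQ24 →+* B) (h : N.map f * c₀.map f = 0) :
      (((1 : Matrix (Unit ⊕ k) (Unit ⊕ k) ZQ24) - C * N) * c₀).map f = c₀.map f := by
    rw [Matrix.sub_mul, Matrix.one_mul, Matrix.mul_assoc, Matrix.map_sub _ (map_sub f),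
      Matrix.map_mul, Matrix.map_mul, h, Matrix.mul_zero, sub_zero]
  refine ⟨i, ((1 : Matrix (Unit ⊕ k) (Unit ⊕ k) ZQ24) - C * N) * c₀, c',
    ?_, ?_, ?_, ?_, hdG, ?_, ?_⟩
  · rw [← Matrix.mul_assoc, Matrix.mul_sub, ← Matrix.mul_assoc, hNC, Matrix.mul_one,
      Matrix.one_mul, sub_self, Matrix.zero_mul]
  · rw [map_fromCols, hproj pC (by rw [eC]; exact matrix_map_mul_eq_zero _ hN), eC, ← map_fromCols,
      hdC]
  · rw [bdet_comp, map_fromCols, hproj pF (by rw [eF]; exact matrix_map_mul_eq_zero _ hN), eF,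
      ← map_fromCols, ← bdet_comp, hdF]
  · rw [hproj pG (by rw [eG]; exact matrix_map_mul_eq_zero _ hN), eG, hG]
  · rw [← RingHom.id_comp pP, bdet_comp, map_fromCols, hproj pP (by rw [eP, hNK₁]), eP, hd₁]
  · rw [← RingHom.id_comp pQ, bdet_comp, map_fromCols, hproj pQ (by rw [eQ, hNK₂]), eQ, hd₂]

end GoodColumn

section IsoIdeal
open Matrix

/-- The left ideal of elements whose component in `Λ` is a left multiple of `γ`. -/
def glueIdeal (γ : Lam Zs srt) : Submodule ZQ24 ZQ24 where
  carrier := {r | ∃ l, pG r = l * γ}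
  add_mem' := by
    rintro a b ⟨l, hl⟩ ⟨m, hm⟩
    exact ⟨l + m, by rw [map_add, hl, hm, add_mul]⟩
  zero_mem' := ⟨0, by simp⟩
  smul_mem' := by
    rintro c a ⟨l, hl⟩
    exact ⟨pG c * l, by rw [smul_eq_mul, map_mul, hl, mul_assoc]⟩

theorem nr_gam_ne_zero (i : Fin 3) : nr (gam i) ≠ 0 := by
  revert i
  decide +kernel

instance : IsDomain Zs :=
  (QuadraticAlgebra.algebraMap_injective (a := (-1 : Zs)) (b := srt)).isDomain
    (algebraMap Zs (Sq Zs srt))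

theorem eq_zero_of_mul_gam {x : Lam Zs srt} {i : Fin 3} (h : x * gam i = 0) : x = 0 := by
  have h1 : x * (gam i * star (gam i)) = 0 := by rw [← mul_assoc, h, zero_mul]
  rw [mul_star_eq_nr] at h1
  have h0 := nr_gam_ne_zero i
  have h2 := QuaternionAlgebra.ext_iff.1 h1
  simp only [QuaternionAlgebra.coe_algebraMap] at h2
  simp at h2
  have h3 {a : Zs} (h : a = 0 ∨ nr (gam i) = 0) : a = 0 := h.resolve_right h0
  exact QuaternionAlgebra.ext (h3 h2.1) (h3 h2.2.1) (h3 h2.2.2.1) (h3 h2.2.2.2)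

theorem exists_int_matrix_inverse {m D : Type*} [Ring D] [Fintype m] [DecidableEq m]
    (f g : D →+* Matrix m m ℤ) (M : D) (hf : (f M).det = 1) (hg : (g M).det = 1) :
    ∃ X : D, f X * f M = 1 ∧ g X * g M = 1 := by
  let q : Polynomial ℤ := (f M).charpoly * (g M).charpoly
  have h0 : q.coeff 0 = 1 := by
    have h1 := det_eq_sign_charpoly_coeff (f M)
    have h2 := det_eq_sign_charpoly_coeff (g M)
    rw [Polynomial.mul_coeff_zero]
    rw [hf] at h1
    rw [hg] at h2
    calc _ = ((-1) ^ Fintype.card m * (-1) ^ Fintype.card m) *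
          ((f M).charpoly.coeff 0 * (g M).charpoly.coeff 0) := by
            rw [← mul_pow]; simp
      _ = ((-1) ^ Fintype.card m * (f M).charpoly.coeff 0) *
          ((-1) ^ Fintype.card m * (g M).charpoly.coeff 0) := by ring
      _ = 1 := by rw [← h1, ← h2, one_mul]
  have hq : q.divX * Polynomial.X + 1 = q := by
    have := Polynomial.divX_mul_X_add q
    rwa [h0, Polynomial.C_1] at this
  have key (φ : D →+* Matrix m m ℤ) (h : Polynomial.aeval (φ M) q = 0) :
      φ (-Polynomial.aeval M q.divX) * φ M = 1 := by
    have e : φ (Polynomial.aeval M q.divX) = Polynomial.aeval (φ M) q.divX := by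
      rw [Polynomial.aeval_def, Polynomial.hom_eval₂, Polynomial.aeval_def]
      congr 1
      exact RingHom.ext_int _ _
    rw [← hq, map_add, map_mul, map_one, Polynomial.aeval_X, ← e] at h
    rw [map_neg, neg_mul]
    exact (eq_neg_of_add_eq_zero_right h).symm
  refine ⟨-Polynomial.aeval M q.divX, key f ?_, key g ?_⟩
  · rw [map_mul, aeval_self_charpoly, zero_mul]
  · rw [map_mul, aeval_self_charpoly, mul_zero]

variable {k : Type} [Fintype k] [DecidableEq k]

theorem exists_left_inverse_PQ (M : Matrix (Unit ⊕ k) (Unit ⊕ k) ZQ24) (hP : bdet pP M = 1)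
    (hQ : bdet pQ M = 1) : ∃ X : Matrix (Unit ⊕ k) (Unit ⊕ k) ZQ24,
      (X * M).map pP = 1 ∧ (X * M).map pQ = 1 := by
  let F (φ : ZQ24 →+* Matrix (Fin 2) (Fin 2) ℤ) : Matrix (Unit ⊕ k) (Unit ⊕ k) ZQ24 →+*
      Matrix ((Unit ⊕ k) × Fin 2) ((Unit ⊕ k) × Fin 2) ℤ :=
    (Matrix.compRingEquiv _ _ _ : _ ≃+* _).toRingHom.comp φ.mapMatrix
  obtain ⟨X, hX, hX'⟩ := exists_int_matrix_inverse (F pP) (F pQ) M hP hQ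
  refine ⟨X, ?_, ?_⟩
  · rw [← map_mul] at hX
    exact (Matrix.compRingEquiv (Unit ⊕ k) (Fin 2) ℤ).injective (hX.trans (map_one _).symm)
  · rw [← map_mul] at hX'
    exact (Matrix.compRingEquiv (Unit ⊕ k) (Fin 2) ℤ).injective (hX'.trans (map_one _).symm)

theorem map_eq_zero_of_left_inverse {A : Type*} [Ring A] {m n : Type*} [Fintype m] [Fintype n]
    [DecidableEq m] {M : Matrix m n A} {V : Matrix n m A} (h : M * V = 1) {l : Type*}
    {w : Matrix l m A} (hw : w * M = 0) : w = 0 := by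
  rw [← Matrix.mul_one w, ← h, ← Matrix.mul_assoc, hw, Matrix.zero_mul]

theorem matrix_eq_zero_of_components {m n : Type*} {w : Matrix m n ZQ24} (hC : w.map pC = 0)
    (hP : w.map pP = 0) (hQ : w.map pQ = 0) (hF : w.map pF = 0) (hG : w.map pG = 0) : w = 0 := by
  ext1 i j
  exact components_injective (congrFun₂ hC i j) (congrFun₂ hP i j) (congrFun₂ hQ i j)
    (congrFun₂ hF i j) (congrFun₂ hG i j)

variable {C : Matrix (Unit ⊕ k) k ZQ24} {i : Fin 3}
  {c : Matrix (Unit ⊕ k) Unit ZQ24} {c' : Matrix (Unit ⊕ k) Unit (Lam Zs srt)}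

theorem row_eq_zero (hC : ((fromCols c C).map pC).det = 1)
    (hF : bdet (quatRep.comp pF) (fromCols c C) = 1) (hc : c.map pG = c' * one1 (gam i))
    (hG : bdet quatRep (fromCols c' (C.map pG)) = 1)
    (hP : bdet pP (fromCols c C) = 1) (hQ : bdet pQ (fromCols c C) = 1)
    {w : Matrix Unit (Unit ⊕ k) ZQ24} (hwc : w * c = 0) (hwC : w * C = 0) : w = 0 := by
  have hw : w * fromCols c C = 0 := by rw [Matrix.mul_fromCols, hwc, hwC, fromCols_zero]
  have hmap {B : Type} [Ring B] (f : ZQ24 →+* B) : w.map f * (fromCols c C).map f = 0 := by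
    rw [← Matrix.map_mul, hw, Matrix.map_zero _ (map_zero f)]
  have h1 {κ A : Type} [Fintype κ] [DecidableEq κ] [CommRing A] (f : ZQ24 →+* Matrix κ κ A)
      (hf : bdet f (fromCols c C) = 1) : w.map f = 0 := by
    obtain ⟨V, -, hV⟩ := exists_inverse_of_isUnit_bdet_id (M := (fromCols c C).map f)
      (by rw [← bdet_comp, RingHom.id_comp, hf]; exact isUnit_one)
    exact map_eq_zero_of_left_inverse hV (hmap f)
  refine matrix_eq_zero_of_components ?_ (h1 pP hP) (h1 pQ hQ) ?_ ?_
  · exact map_eq_zero_of_left_inverse (mul_nonsing_inv _ (by rw [hC]; exact isUnit_one)) (hmap pC)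
  · obtain ⟨V, -, hV⟩ := exists_inverse_of_isUnit_bdet (M := (fromCols c C).map pF)
      (by rw [← bdet_comp, hF]; exact isUnit_one)
    exact map_eq_zero_of_left_inverse hV (hmap pF)
  · obtain ⟨V, -, hV⟩ := exists_inverse_of_isUnit_bdet (by rw [hG]; exact isUnit_one)
    refine map_eq_zero_of_left_inverse hV ?_
    rw [Matrix.mul_fromCols, ← Matrix.map_mul, hwC, Matrix.map_zero _ (map_zero pG)]
    have h2 : w.map pG * c' = 0 := by
      have h3 : w.map pG * c' * one1 (gam i) = 0 := by
        rw [Matrix.mul_assoc, ← hc, ← Matrix.map_mul, hwc, Matrix.map_zero _ (map_zero pG)]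
      ext1 s t
      have h4 := congrFun₂ h3 s t
      rw [Matrix.mul_apply, Finset.univ_unique, Finset.sum_singleton] at h4
      exact eq_zero_of_mul_gam h4
    rw [h2, fromCols_zero]

theorem eq_of_mul_eq {A : Type*} [Ring A] {m n l : Type*} [Fintype m] [Fintype n]
    [DecidableEq m] {M : Matrix m n A} {V : Matrix n m A} (h : M * V = 1)
    {w w' : Matrix l m A} (hw : w * M = w' * M) : w = w' := by
  rw [← Matrix.mul_one w, ← h, ← Matrix.mul_assoc, hw, Matrix.mul_assoc, h, Matrix.mul_one]

theorem exists_row (hC : ((fromCols c C).map pC).det = 1)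
    (hF : bdet (quatRep.comp pF) (fromCols c C) = 1) (hc : c.map pG = c' * one1 (gam i))
    (hG : bdet quatRep (fromCols c' (C.map pG)) = 1)
    (hP : bdet pP (fromCols c C) = 1) (hQ : bdet pQ (fromCols c C) = 1)
    {r : ZQ24} (hr : r ∈ glueIdeal (gam i))
    (ρ : Matrix Unit k ZQ24) :
    ∃ w : Matrix Unit (Unit ⊕ k) ZQ24, w * c = one1 r ∧ w * C = ρ := by
  obtain ⟨l, hl⟩ := hr
  obtain ⟨t, ht⟩ : ∃ t : Matrix Unit (Unit ⊕ k) ZQ24, t = fromCols (one1 r) ρ := ⟨_, rfl⟩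
  suffices h : ∃ w : Matrix Unit (Unit ⊕ k) ZQ24, w * fromCols c C = t by
    obtain ⟨w, hw⟩ := h
    rw [Matrix.mul_fromCols, ht] at hw
    exact ⟨w, (fromCols_inj hw).1, (fromCols_inj hw).2⟩
  obtain ⟨U, hU, hU'⟩ : ∃ U, U * (fromCols c C).map pC = 1 ∧ (fromCols c C).map pC * U = 1 :=
    have hu : IsUnit ((fromCols c C).map pC).det := by rw [hC]; exact isUnit_one
    ⟨_, nonsing_inv_mul _ hu, mul_nonsing_inv _ hu⟩
  obtain ⟨V, hV, hV'⟩ := exists_inverse_of_isUnit_bdet (M := (fromCols c C).map pF)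
      (by rw [← bdet_comp, hF]; exact isUnit_one)
  obtain ⟨W, hW, hW'⟩ := exists_inverse_of_isUnit_bdet (M := fromCols c' (C.map pG))
    (by rw [hG]; exact isUnit_one)
  have hwG : (fromCols (one1 l) (ρ.map pG) : Matrix Unit (Unit ⊕ k) _) * W * (fromCols c C).map pG =
      t.map pG := by
    have h1 : (fromCols (one1 l) (ρ.map pG) : Matrix Unit (Unit ⊕ k) _) * W * c' = one1 l ∧
        (fromCols (one1 l) (ρ.map pG) : Matrix Unit (Unit ⊕ k) _) * W * C.map pG = ρ.map pG := by
      apply fromCols_inj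
      rw [← Matrix.mul_fromCols, Matrix.mul_assoc, hW, Matrix.mul_one]
    rw [map_fromCols, ht, map_fromCols, Matrix.mul_fromCols, hc, ← Matrix.mul_assoc, h1.1, h1.2]
    congr 1
    ext1 s t
    simp [Matrix.mul_apply, hl]
  have hcomp : (t.map pC * U).map klRed = (t.map pF * V).map lamFKl := by
    refine eq_of_mul_eq (M := ((fromCols c C).map pC).map klRed) (V := U.map klRed) ?_ ?_
    · rw [← Matrix.map_mul, hU', Matrix.map_one _ (map_zero _) (map_one _)]
    · rw [← Matrix.map_mul, Matrix.mul_assoc, hU, Matrix.mul_one,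
        map_map_of_comp klRed_comp_pC, map_map_of_comp klRed_comp_pC, ← Matrix.map_mul,
        Matrix.mul_assoc, hV, Matrix.mul_one]
  have hcomp' : (t.map pF * V).map lamFMod =
      ((fromCols (one1 l) (ρ.map pG) : Matrix Unit (Unit ⊕ k) _) * W).map lamGMod := by
    refine eq_of_mul_eq (M := ((fromCols c C).map pF).map lamFMod) (V := V.map lamFMod) ?_ ?_
    · rw [← Matrix.map_mul, hV', Matrix.map_one _ (map_zero _) (map_one _)]
    · rw [← Matrix.map_mul, Matrix.mul_assoc, hV, Matrix.mul_one,
        map_map_of_comp lamFMod_comp_pF, map_map_of_comp lamFMod_comp_pF, ← Matrix.map_mul, hwG]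
  have hlift (s : Unit ⊕ k) := exists_lift (congrFun₂ hcomp () s) (congrFun₂ hcomp' () s)
  choose w₀ h₀C h₀F h₀G using hlift
  obtain ⟨w, hwC, hwF, hwG'⟩ : ∃ w : Matrix Unit (Unit ⊕ k) ZQ24, w.map pC = t.map pC * U ∧
      w.map pF = t.map pF * V ∧
        w.map pG = (fromCols (one1 l) (ρ.map pG) : Matrix Unit (Unit ⊕ k) _) * W :=
    ⟨of fun _ s => w₀ s, by ext1 ⟨⟩ s; exact h₀C s, by ext1 ⟨⟩ s; exact h₀F s,
      by ext1 ⟨⟩ s; exact h₀G s⟩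
  obtain ⟨X, hXP, hXQ⟩ := exists_left_inverse_PQ (fromCols c C) hP hQ
  obtain ⟨d, hd⟩ : ∃ d, d = t - w * fromCols c C := ⟨_, rfl⟩
  have hmap {B : Type} [Ring B] (f : ZQ24 →+* B)
      (h : w.map f * (fromCols c C).map f = t.map f) : d.map f = 0 := by
    rw [hd, Matrix.map_sub _ (map_sub f), Matrix.map_mul, h, sub_self]
  have hdC : d.map pC = 0 := hmap pC (by rw [hwC, Matrix.mul_assoc, hU, Matrix.mul_one])
  have hdF : d.map pF = 0 := hmap pF (by rw [hwF, Matrix.mul_assoc, hV, Matrix.mul_one])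
  have hdG : d.map pG = 0 := hmap pG (by rw [hwG', hwG])
  refine ⟨w + d * X, ?_⟩
  have h2 : d * (X * fromCols c C) - d = 0 := by
    have h3 {B : Type} [Ring B] (f : ZQ24 →+* B) : (d * (X * fromCols c C) - d).map f =
        d.map f * (X * fromCols c C).map f - d.map f := by
      rw [Matrix.map_sub _ (map_sub f), Matrix.map_mul]
    refine matrix_eq_zero_of_components ?_ ?_ ?_ ?_ ?_ <;> rw [h3]
    · rw [hdC, Matrix.zero_mul, sub_zero]
    · rw [hXP, Matrix.mul_one, sub_self]
    · rw [hXQ, Matrix.mul_one, sub_self]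
    · rw [hdF, Matrix.zero_mul, sub_zero]
    · rw [hdG, Matrix.zero_mul, sub_zero]
  rw [Matrix.add_mul, Matrix.mul_assoc, sub_eq_zero.1 h2, hd]
  abel

theorem exists_equiv_glueIdeal {P : ModuleCat.{0} ZQ24} (hP : IsStablyFreeOfRankOne P) :
    ∃ i, Nonempty (P ≃ₗ[ZQ24] glueIdeal (gam i)) := by
  obtain ⟨a, ⟨f₀⟩⟩ := hP
  obtain ⟨f⟩ : Nonempty ((P × (Fin a → ZQ24)) ≃ₗ[ZQ24] (Unit ⊕ Fin a → ZQ24)) :=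
    ⟨f₀.trans (LinearEquiv.funCongrLeft ZQ24 ZQ24
      (Fintype.equivOfCardEq (by simp [add_comm])))⟩
  obtain ⟨C, hC⟩ : ∃ C : Matrix (Unit ⊕ Fin a) (Fin a) ZQ24,
      ∀ w j, (f.symm w).2 j = ∑ s, w s * C s j := by
    refine ⟨of fun s j => (f.symm fun t => if s = t then 1 else 0).2 j, fun w j => ?_⟩
    exact LinearMap.pi_apply_eq_sum_univ ((LinearMap.proj j).comp
      ((LinearMap.snd ZQ24 P (Fin a → ZQ24)).comp f.symm.toLinearMap)) w
  obtain ⟨N, hN⟩ : ∃ N : Matrix (Fin a) (Unit ⊕ Fin a) ZQ24,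
      ∀ j s, N j s = f (0, Pi.single j 1) s :=
        ⟨of fun j s => f (0, Pi.single j 1) s, fun _ _ => rfl⟩
  have hNC : N * C = 1 := by
    ext1 j j'
    rw [Matrix.mul_apply]
    simp only [hN]
    rw [← hC, f.symm_apply_apply, Matrix.one_apply]
    simp [Pi.single_apply, eq_comm]
  obtain ⟨i, c, c', hNc, hdC, hdF, hG, hdG, hP, hQ⟩ := exists_good_column hNC
  let Φ : P →ₗ[ZQ24] ZQ24 := 
    { toFun := fun p => ∑ s, f (p, 0) s * c s ()
      map_add' := fun p q => by
        rw [← Finset.sum_add_distrib]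
        refine Finset.sum_congr rfl fun s _ => ?_
        rw [← _root_.add_mul, ← Pi.add_apply, ← map_add, Prod.mk_add_mk, add_zero]
      map_smul' := fun r p => by
        rw [RingHom.id_apply, smul_eq_mul, Finset.mul_sum]
        refine Finset.sum_congr rfl fun s _ => ?_
        rw [← _root_.mul_assoc, ← smul_eq_mul r, ← Pi.smul_apply, ← map_smul, Prod.smul_mk,
          smul_zero] }
  have hrow (p : P) : (of fun _ s => f (p, 0) s : Matrix Unit (Unit ⊕ Fin a) ZQ24) * C = 0 := by
    ext1 ⟨⟩ j
    rw [Matrix.mul_apply]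
    simp only [of_apply]
    rw [← hC, f.symm_apply_apply]
    rfl
  have hinj : Function.Injective Φ := by
    rw [injective_iff_map_eq_zero]
    intro p hp
    have h1 : (of fun _ s => f (p, 0) s : Matrix Unit (Unit ⊕ Fin a) ZQ24) = 0 :=
      row_eq_zero hdC hdF hG hdG hP hQ (by ext1 ⟨⟩ ⟨⟩; exact hp) (hrow p)
    have h2 : f (p, 0) = 0 := by ext1 s; exact congrFun₂ h1 () s
    simpa using h2
  have hrange : LinearMap.range Φ = glueIdeal (gam i) := by
    ext r
    rw [LinearMap.mem_range]
    constructor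
    · rintro ⟨p, rfl⟩
      refine ⟨∑ s, pG (f (p, 0) s) * c' s (), ?_⟩
      change pG (∑ s, f (p, 0) s * c s ()) = _
      rw [map_sum, Finset.sum_mul]
      refine Finset.sum_congr rfl fun s _ => ?_
      rw [map_mul, _root_.mul_assoc]
      congr 1
      have := congrFun₂ hG s ()
      rwa [Matrix.mul_apply, Finset.univ_unique, Finset.sum_singleton] at this
    · intro hr
      obtain ⟨w, hwc, hwC⟩ := exists_row hdC hdF hG hdG hP hQ hr 0
      refine ⟨(f.symm (w ())).1, ?_⟩
      have h1 : (f.symm (w ())).2 = 0 := by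
        ext1 j
        rw [hC]
        exact congrFun₂ hwC () j
      have h2 : ((f.symm (w ())).1, (0 : Fin a → ZQ24)) = f.symm (w ()) := by
        rw [← h1]
      change ∑ s, f ((f.symm (w ())).1, 0) s * c s () = r
      rw [h2, f.apply_symm_apply]
      exact congrFun₂ hwc () ()
  exact ⟨i, ⟨(LinearEquiv.ofInjective Φ hinj).trans (LinearEquiv.ofEq _ _ hrange)⟩⟩

end IsoIdeal

section StablyFree
open Matrix

theorem gam_eq (i : Fin 3) : ∃ u w m : Lam Zs srt, gam i = 1 + u * w ∧
    w * u = algebraMap Zs _ (2 * srt) * m := by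
  have key : ∀ i : Fin 3, ∃ u ∈ [0, lamU], ∃ w ∈ [lamW, -lamW],
      ∃ m ∈ [(0 : Lam Zs srt), ⟨0, 2, -2, 2 * srt⟩, -⟨0, 2, -2, 2 * srt⟩], gam i = 1 + u * w ∧
      w * u = algebraMap Zs _ (2 * srt) * m := by
    decide +kernel
  obtain ⟨u, -, w, -, m, -, h⟩ := key i
  exact ⟨u, w, m, h⟩

/-- An element of the group ring supported on the last component. -/
def lastElt : ZQ24 := (1 - gx ^ 4) * (gx ^ 4 + gx ^ 2 + 1) * gx ^ 11

theorem pC_lastElt : pC lastElt = 0 := by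
  simp only [lastElt, map_mul, map_sub, map_add, map_pow, map_one, pC_gx]; decide +kernel

theorem pF_lastElt : pF lastElt = 0 := by
  simp only [lastElt, map_mul, map_sub, map_add, map_pow, map_one, pF_gx]; decide +kernel

theorem pP_lastElt : pP lastElt = 0 := by
  simp only [lastElt, map_mul, map_sub, map_add, map_pow, map_one, pP_gx]; decide +kernel

theorem pQ_lastElt : pQ lastElt = 0 := by
  simp only [lastElt, map_mul, map_sub, map_add, map_pow, map_one, pQ_gx]; decide +kernel

theorem pG_lastElt : pG lastElt = algebraMap Zs _ (2 * srt) := by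
  simp only [lastElt, map_mul, map_sub, map_add, map_pow, map_one, pG_gx]; decide +kernel

theorem bdet_unitriangular {D A κ : Type*} [Ring D] [CommRing A] [Fintype κ] [DecidableEq κ]
    (ρ : D →+* Matrix κ κ A) (u w : D) :
    bdet ρ (fromBlocks 1 (one1 u) 0 1 * fromBlocks 1 0 (one1 w) 1 *
      (fromBlocks 1 (one1 (-u)) 0 1 * fromBlocks 1 0 (one1 (-w)) 1)) = 1 := by
  simp only [bdet_mul, bdet_fromBlocks_zero₁₂, bdet_fromBlocks_zero₂₁, bdet_one, one_mul]

theorem one1_one {D : Type*} [Ring D] : (1 : Matrix Unit Unit D) = one1 1 := by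
  ext1 ⟨⟩ ⟨⟩; rfl

theorem commutator_eq {D : Type*} [Ring D] (u w : D) :
    fromBlocks 1 (one1 u) 0 1 * fromBlocks 1 0 (one1 w) 1 *
      (fromBlocks 1 (one1 (-u)) 0 1 * fromBlocks 1 0 (one1 (-w)) 1) =
    (fromBlocks (one1 (1 + u * w + u * (w * u) * w)) (one1 (-(u * (w * u))))
      (one1 (w * u * w)) (one1 (1 - w * u)) : Matrix (Unit ⊕ Unit) (Unit ⊕ Unit) D) := by
  simp only [fromBlocks_multiply, fromBlocks_inj, Matrix.mul_one, Matrix.one_mul, Matrix.mul_zero,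
    Matrix.zero_mul, add_zero, zero_add, one1_one]
  refine ⟨?_, ?_, ?_, ?_⟩ <;> ext1 ⟨⟩ ⟨⟩ <;> simp [Matrix.mul_apply] <;> noncomm_ring

theorem exists_matrix_gam (i : Fin 3) : ∃ (c : Matrix (Unit ⊕ Unit) Unit ZQ24)
    (C : Matrix (Unit ⊕ Unit) Unit ZQ24) (c' : Matrix (Unit ⊕ Unit) Unit (Lam Zs srt)),
      ((fromCols c C).map pC).det = 1 ∧ bdet (quatRep.comp pF) (fromCols c C) = 1 ∧
      c.map pG = c' * one1 (gam i) ∧ bdet quatRep (fromCols c' (C.map pG)) = 1 ∧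
      bdet pP (fromCols c C) = 1 ∧ bdet pQ (fromCols c C) = 1 := by
  obtain ⟨u, w, m, hγ, hm⟩ := gam_eq i
  obtain ⟨u, rfl⟩ := pG_surjective u
  obtain ⟨w, rfl⟩ := pG_surjective w
  obtain ⟨m, rfl⟩ := pG_surjective m
  rw [← pG_lastElt] at hm
  obtain ⟨E, hE⟩ : ∃ E : Matrix (Unit ⊕ Unit) (Unit ⊕ Unit) ZQ24,
    E = fromBlocks 1 (one1 u) 0 1 * fromBlocks 1 0 (one1 w) 1 *
      (fromBlocks 1 (one1 (-u)) 0 1 * fromBlocks 1 0 (one1 (-w)) 1) := ⟨_, rfl⟩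
  obtain ⟨T, hT⟩ : ∃ T : Matrix (Unit ⊕ Unit) (Unit ⊕ Unit) ZQ24,
    T = fromBlocks (one1 (u * m * w)) (one1 (-(u * m))) (one1 (m * w)) (one1 (-m)) := ⟨_, rfl⟩
  have hbd {κ A : Type} [Fintype κ] [DecidableEq κ] [CommRing A] (ρ : ZQ24 →+* Matrix κ κ A)
      (h : ρ lastElt = 0) : bdet ρ (E - scalar _ lastElt * T) = 1 := by
    have h1 : (E - scalar _ lastElt * T).map ρ = E.map ρ := by
      rw [Matrix.map_sub _ (map_sub ρ), Matrix.map_mul]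
      have : ((scalar (Unit ⊕ Unit)) lastElt).map ρ = 0 := by
        ext1 s t; simp [diagonal_apply, apply_ite ρ, h]
      rw [this, Matrix.zero_mul, sub_zero]
    rw [← RingHom.id_comp ρ, bdet_comp, h1, ← bdet_comp, RingHom.id_comp, hE]
    exact bdet_unitriangular ρ u w
  have hG : (E - scalar _ lastElt * T).map pG = fromBlocks (one1 (gam i)) 0 0 1 := by
    have hcomm (x : Lam Zs srt) : x * pG lastElt = pG lastElt * x := by
      rw [pG_lastElt]
      exact (Algebra.commutes _ x).symm
    rw [hE, commutator_eq, hT, hγ]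
    ext1 (⟨⟩ | ⟨⟩) (⟨⟩ | ⟨⟩) <;>
      simp only [Matrix.map_apply, Matrix.sub_apply, scalar_apply, diagonal_mul,
        fromBlocks_apply₁₁, fromBlocks_apply₁₂, fromBlocks_apply₂₁, fromBlocks_apply₂₂, of_apply,
        map_sub, map_add, map_mul, map_neg, map_one, hm, Matrix.zero_apply, Matrix.one_apply_eq]
    · rw [← _root_.mul_assoc (pG u), hcomm]; noncomm_ring
    · rw [← _root_.mul_assoc (pG u), hcomm]; noncomm_ring
    · noncomm_ring
    · noncomm_ring
  refine ⟨(E - scalar _ lastElt * T).toCols₁, (E - scalar _ lastElt * T).toCols₂,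
    fromRows 1 0, ?_, ?_, ?_, ?_, ?_, ?_⟩
  · rw [fromCols_toCols, ← bdet_scalar, ← bdet_comp]
    exact hbd _ (by simp [pC_lastElt])
  · rw [fromCols_toCols]
    exact hbd _ (by simp [pF_lastElt])
  · have := congrArg Matrix.toCols₁ hG
    refine this.trans ?_
    ext1 (⟨⟩ | ⟨⟩) ⟨⟩ <;> simp [Matrix.mul_apply, toCols₁]
  · have : fromCols (fromRows 1 0) ((E - scalar _ lastElt * T).toCols₂.map pG) =
        (1 : Matrix (Unit ⊕ Unit) (Unit ⊕ Unit) (Lam Zs srt)) := by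
      have h1 : (E - scalar _ lastElt * T).toCols₂.map pG =
          toCols₂ (fromBlocks (one1 (gam i)) 0 0 1) := congrArg Matrix.toCols₂ hG
      rw [h1]
      ext1 (⟨⟩ | ⟨⟩) (⟨⟩ | ⟨⟩) <;> simp [toCols₂]
    rw [this, bdet_one]
  · rw [fromCols_toCols]
    exact hbd _ pP_lastElt
  · rw [fromCols_toCols]
    exact hbd _ pQ_lastElt

theorem isStablyFree_glueIdeal (i : Fin 3) :
    IsStablyFreeOfRankOne (ModuleCat.of ZQ24 (glueIdeal (gam i))) := by
  obtain ⟨c, C, c', hdC, hdF, hG, hdG, hP, hQ⟩ := exists_matrix_gam i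
  have hmem (w : Unit ⊕ Unit → ZQ24) : ∑ s, w s * c s () ∈ glueIdeal (gam i) := by
    refine ⟨∑ s, pG (w s) * c' s (), ?_⟩
    rw [map_sum, Finset.sum_mul]
    refine Finset.sum_congr rfl fun s _ => ?_
    rw [map_mul, _root_.mul_assoc]
    congr 1
    have := congrFun₂ hG s ()
    rwa [Matrix.mul_apply, Finset.univ_unique, Finset.sum_singleton] at this
  let Φ : (Unit ⊕ Unit → ZQ24) →ₗ[ZQ24] glueIdeal (gam i) × (Fin 1 → ZQ24) :=
    { toFun := fun w => (⟨∑ s, w s * c s (), hmem w⟩, fun _ => ∑ s, w s * C s ())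
      map_add' := fun v w => by
        refine Prod.ext (Subtype.ext ?_) (funext fun _ => ?_) <;>
          simp [add_mul] <;> abel
      map_smul' := fun r w => by
        refine Prod.ext (Subtype.ext ?_) (funext fun _ => ?_) <;>
          simp [mul_assoc, mul_add] }
  have hinj : Function.Injective Φ := by
    rw [injective_iff_map_eq_zero]
    intro w hw
    have h1 : (of fun _ s => w s : Matrix Unit (Unit ⊕ Unit) ZQ24) = 0 := by
      refine row_eq_zero hdC hdF hG hdG hP hQ ?_ ?_
      · ext1 ⟨⟩ ⟨⟩; exact congrArg (fun z => z.1.1) hw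
      · ext1 ⟨⟩ ⟨⟩; exact congrArg (fun z => z.2 0) hw
    ext1 s
    exact congrFun₂ h1 () s
  have hsurj : Function.Surjective Φ := by
    rintro ⟨⟨r, hr⟩, ρ⟩
    obtain ⟨w, hwc, hwC⟩ := exists_row hdC hdF hG hdG hP hQ hr (one1 (ρ 0))
    refine ⟨w (), Prod.ext (Subtype.ext (congrFun₂ hwc () ())) (funext fun j => ?_)⟩
    rw [Subsingleton.elim j 0]
    exact congrFun₂ hwC () ()
  exact ⟨1, ⟨(LinearEquiv.ofBijective Φ ⟨hinj, hsurj⟩).symm.trans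
    (LinearEquiv.funCongrLeft ZQ24 ZQ24 (Fintype.equivOfCardEq (by simp)))⟩⟩

end StablyFree

section Twists

/-- The ring endomorphism of `Lam A b` fixing `i` and mapping `j` to `i * j`. -/
def lamTwist (A : Type) [CommRing A] (b : A) : Lam A b →+* Lam A b where
  toFun q := ⟨q.re, q.imI, -q.imK, q.imJ + b * q.imK⟩
  map_one' := by ext <;> simp
  map_zero' := by ext <;> simp
  map_add' p q := by ext <;> simp <;> ring
  map_mul' p q := by ext <;> simp <;> ring

/-- The automorphism of `Q24` fixing the generator of order twelve and multiplying the
generator of order four by it. -/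
def shiftAut : Q24 ≃* Q24 where
  toFun
    | .a i => .a i
    | .xa i => .xa (i - 1)
  invFun
    | .a i => .a i
    | .xa i => .xa (i + 1)
  left_inv g := by cases g <;> simp
  right_inv g := by cases g <;> simp
  map_mul' g h := by
    cases g <;> cases h <;> simp <;> ring

theorem twistRingHom_shiftAut_gx : twistRingHom shiftAut gx = gx := by
  simp [twistRingHom, gx]
  rfl

theorem twistRingHom_shiftAut_gy : twistRingHom shiftAut gy = gx * gy := by
  simp [twistRingHom, gx, gy, MonoidAlgebra.single_mul_single]
  rfl

theorem pF_comp_twist : pF.comp (twistRingHom shiftAut) = (lamTwist ℤ 0).comp pF := by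
  refine ZQ24_hom_ext ?_ ?_
  · simp only [RingHom.comp_apply, twistRingHom_shiftAut_gx, pF_gx]; decide +kernel
  · simp only [RingHom.comp_apply, twistRingHom_shiftAut_gy, map_mul, pF_gx, pF_gy]; decide +kernel

theorem pG_comp_twist : pG.comp (twistRingHom shiftAut) = (lamTwist Zs srt).comp pG := by
  refine ZQ24_hom_ext ?_ ?_
  · simp only [RingHom.comp_apply, twistRingHom_shiftAut_gx, pG_gx]; decide +kernel
  · simp only [RingHom.comp_apply, twistRingHom_shiftAut_gy, map_mul, pG_gx, pG_gy]; decide +kernel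

theorem lamFMod_comp_lamTwist :
    lamFMod.comp (lamTwist ℤ 0) = (lamTwist (ZMod 3) 0).comp lamFMod := by
  ext z <;> simp [lamFMod, lamTwist, lamMap]

/-- The images of the units of the Lipschitz quaternions modulo three. -/
def quatUnits : List (Lam (ZMod 3) 0) :=
  [1, ⟨0, 1, 0, 0⟩, ⟨0, 0, 1, 0⟩, ⟨0, 0, 0, 1⟩, -1, ⟨0, -1, 0, 0⟩, ⟨0, 0, -1, 0⟩, ⟨0, 0, 0, -1⟩]

theorem int_unit_cases {a : Lam ℤ 0} (h : nr a = 1) :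
    lamFMod a ∈ quatUnits := by
  have key (x y z w : ℤ) (h : x * x + y * y + (z * z + w * w) = 1) :
      (x = 1 ∨ x = -1) ∧ y = 0 ∧ z = 0 ∧ w = 0 ∨ (y = 1 ∨ y = -1) ∧ x = 0 ∧ z = 0 ∧ w = 0 ∨
      (z = 1 ∨ z = -1) ∧ x = 0 ∧ y = 0 ∧ w = 0 ∨ (w = 1 ∨ w = -1) ∧ x = 0 ∧ y = 0 ∧ z = 0 := by
    have hb (x : ℤ) (h : x * x ≤ 1) : -1 ≤ x ∧ x ≤ 1 := by constructor <;> nlinarith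
    obtain ⟨h1, h2⟩ := hb x (by nlinarith)
    obtain ⟨h3, h4⟩ := hb y (by nlinarith)
    obtain ⟨h5, h6⟩ := hb z (by nlinarith)
    obtain ⟨h7, h8⟩ := hb w (by nlinarith)
    interval_cases x <;> interval_cases y <;> interval_cases z <;> interval_cases w <;> simp_all
  obtain ⟨x, y, z, w⟩ := a
  rw [nr_eq] at h
  obtain ⟨hx | hx, hy, hz, hw⟩ | ⟨hx | hx, hy, hz, hw⟩ | ⟨hx | hx, hy, hz, hw⟩ |
    ⟨hx | hx, hy, hz, hw⟩ := key x y z w (by simpa using h) <;>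
  subst hx hy hz hw <;> decide +kernel

theorem zs_nonneg_of_norm (α : Sq Zs srt) : 0 ≤ α.norm.re ∧ 0 ≤ α.norm.norm := by
  refine ⟨zs_re_nonneg fun f => ?_, zs_norm_norm_nonneg α⟩
  exact map_norm_nonneg f (zs_ringHom_sq f) α

theorem fst_eq_zero_or_snd_eq_zero {b : Lam Zs srt} (h : IsUnit b) :
    lamFst b = 0 ∨ lamSnd b = 0 := by
  rw [isUnit_lam_iff, nr] at h
  by_contra! h'
  obtain ⟨h1, h2⟩ := zs_nonneg_of_norm (lamFst b)
  obtain ⟨h3, h4⟩ := zs_nonneg_of_norm (lamSnd b)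
  have h5 := lt_of_le_of_ne h2 fun h => h'.1 (zs_norm_norm_eq_zero h.symm)
  have h6 := lt_of_le_of_ne h4 fun h => h'.2 (zs_norm_norm_eq_zero h.symm)
  have h7 := QuadraticAlgebra.isUnit_iff_norm_isUnit.1 h
  rw [Int.isUnit_iff] at h7
  generalize (lamFst b).norm = A at *
  generalize (lamSnd b).norm = B at *
  simp only [QuadraticAlgebra.norm_def, QuadraticAlgebra.re_add, QuadraticAlgebra.im_add] at *
  have h8 : 0 < A.re * B.re - 3 * A.im * B.im := by
    by_contra! h9
    have : (A.re * B.re) ^ 2 ≤ (3 * A.im * B.im) ^ 2 := by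
      have := mul_nonneg h1 h3
      nlinarith
    have h10 : 0 ≤ A.im ^ 2 * (B.re ^ 2 - 3 * B.im ^ 2) := mul_nonneg (sq_nonneg _) (by linarith)
    have h11 : 0 < B.re ^ 2 * (A.re ^ 2 - 3 * A.im ^ 2) :=
      mul_pos (by nlinarith [sq_nonneg B.im]) (by linarith)
    linarith
  rcases h7 with h7 | h7 <;> nlinarith

theorem lam_intCast_mul_cancel {A : Type*} [CommRing A] [IsDomain A] {b : A} {n : ℤ}
    (hn : (n : A) ≠ 0) {x y : Lam A b} (h : (n : Lam A b) * x = n * y) : x = y := by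
  have h' := QuaternionAlgebra.ext_iff.1 h
  simp [hn] at h'
  exact QuaternionAlgebra.ext h'.1 h'.2.1 h'.2.2.1 h'.2.2.2

/-- A surjective semilinear map between two of the ideals forces a congruence between units. -/
theorem exists_units_of_semilinear {σ : ZQ24 →+* ZQ24} {αF : Lam ℤ 0 →+* Lam ℤ 0}
    {αG : Lam Zs srt →+* Lam Zs srt} {α : Lam (ZMod 3) 0 →+* Lam (ZMod 3) 0}
    (hF : pF.comp σ = αF.comp pF) (hG : pG.comp σ = αG.comp pG)
    (hαF : lamFMod.comp αF = α.comp lamFMod)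
    {i j : Fin 3} (φ : glueIdeal (gam i) → glueIdeal (gam j)) (hφ : Function.Surjective φ)
    (hsmul : ∀ r p, φ (r • p) = σ r • φ p) :
    ∃ (a : Lam ℤ 0) (b : Lam Zs srt), IsUnit a ∧ IsUnit b ∧
      α (lamGMod (gam i)) * lamFMod a = lamGMod b * lamGMod (gam j) := by
  have hex (i : Fin 3) : ∃ p : glueIdeal (gam i), pF p = 1 := by
    obtain ⟨r, -, hr, hr'⟩ := exists_lift (x := 1) (y := 1) (z := star (gam i) * gam i)
      (by rw [map_one, map_one]) (by revert i; decide +kernel)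
    exact ⟨⟨r, _, hr'⟩, hr⟩
  have hex' (i : Fin 3) : ∃ p : glueIdeal (gam i), pG p = gam i := by
    obtain ⟨r, hr⟩ := pG_surjective (gam i)
    exact ⟨⟨r, 1, by rw [hr, one_mul]⟩, hr⟩
  obtain ⟨n, hn0, hn⟩ : ∃ n : ℤ, n ≠ 0 ∧ (n : ZQ24) ∈ glueIdeal (gam i) := by
    refine ⟨(nr (gam i)).norm, fun h => nr_gam_ne_zero i (zs_norm_eq_zero h),
      algebraMap Zs _ (star (nr (gam i))) * star (gam i), ?_⟩
    rw [mul_assoc, star_mul_eq_nr, ← map_mul, mul_comm, zs_star_mul_self, map_intCast, map_intCast]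
  obtain ⟨ν, hν⟩ : ∃ ν, ν = φ ⟨n, hn⟩ := ⟨_, rfl⟩
  have hcomm (p : glueIdeal (gam i)) : (n : ZQ24) * φ p = σ p * ν := by
    have h1 : (n : ZQ24) • p = (p : ZQ24) • (⟨n, hn⟩ : glueIdeal (gam i)) :=
      Subtype.ext (Int.cast_commute n (p : ZQ24)).eq
    have h2 := congrArg φ h1
    rw [hsmul, hsmul, map_intCast, ← hν] at h2
    exact congrArg Subtype.val h2
  have hF' (p : glueIdeal (gam i)) : (n : Lam ℤ 0) * pF (φ p) = αF (pF p) * pF ν := by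
    rw [← map_intCast pF, ← map_mul, hcomm, map_mul]
    exact congrArg (· * _) (RingHom.congr_fun hF p)
  have hG' (p : glueIdeal (gam i)) : (n : Lam Zs srt) * pG (φ p) = αG (pG p) * pG ν := by
    rw [← map_intCast pG, ← map_mul, hcomm, map_mul]
    exact congrArg (· * _) (RingHom.congr_fun hG p)
  have hnF {x y : Lam ℤ 0} (h : (n : Lam ℤ 0) * x = n * y) : x = y :=
    lam_intCast_mul_cancel (by simpa using hn0) h
  have hnG {x y : Lam Zs srt} (h : (n : Lam Zs srt) * x = n * y) : x = y :=
    lam_intCast_mul_cancel (fun h => hn0 (by simpa using congrArg QuadraticAlgebra.re h)) h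
  obtain ⟨p₁, hp₁⟩ := hex i
  obtain ⟨q₁, hq₁⟩ := hex' i
  obtain ⟨b, hb⟩ := (φ q₁).2
  have hFa (p : glueIdeal (gam i)) : pF (φ p) = αF (pF p) * pF (φ p₁) := by
    refine hnF ?_
    have h1 := hF' p₁
    rw [hp₁, map_one, one_mul] at h1
    rw [hF', ← h1, ← mul_assoc, ← mul_assoc, (Int.cast_commute n (αF (pF p))).eq]
  have hGb (p : glueIdeal (gam i)) {l} (hl : pG p = l * gam i) :
      pG (φ p) = αG l * b * gam j := by
    refine hnG ?_
    have h1 := hG' q₁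
    rw [hq₁, hb] at h1
    rw [hG', hl, map_mul, mul_assoc, ← h1, ← mul_assoc, ← (Int.cast_commute n (αG l)).eq]
    simp only [mul_assoc]
  refine ⟨pF (φ p₁), b, ?_, ?_, ?_⟩
  · obtain ⟨p₂, hp₂⟩ := hex j
    obtain ⟨p, rfl⟩ := hφ p₂
    rw [hFa] at hp₂
    exact ⟨⟨_, _, lam_mul_eq_one_comm _ _ hp₂, hp₂⟩, rfl⟩
  · obtain ⟨q₂, hq₂⟩ := hex' j
    obtain ⟨q, rfl⟩ := hφ q₂
    obtain ⟨l, hl⟩ := q.2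
    rw [hGb q hl] at hq₂
    have h1 : αG l * b = 1 := by
      rw [← sub_eq_zero]
      refine eq_zero_of_mul_gam (i := j) ?_
      rw [sub_mul, hq₂, one_mul, sub_self]
    exact ⟨⟨_, _, lam_mul_eq_one_comm _ _ h1, h1⟩, rfl⟩
  · have h1 := hFa q₁
    have h2 := RingHom.congr_fun lamFMod_comp_pF (φ q₁)
    have h3 := RingHom.congr_fun lamFMod_comp_pF q₁
    have h4 := RingHom.congr_fun hαF (pF q₁)
    simp only [RingHom.comp_apply] at h2 h3 h4
    rw [h1, map_mul, h4, h3, hq₁, hb, map_mul] at h2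
    exact h2

theorem nr_lamGMod_gam (i : Fin 3) : nr (lamGMod (gam i)) = 1 := by
  revert i
  decide +kernel

theorem exists_quaternions_mod_three {α : Lam (ZMod 3) 0 →+* Lam (ZMod 3) 0} {i j : Fin 3}
    (hα : nr (α (lamGMod (gam i))) = 1) {a : Lam ℤ 0} {b : Lam Zs srt} (ha : IsUnit a)
    (hb : IsUnit b) (h : α (lamGMod (gam i)) * lamFMod a = lamGMod b * lamGMod (gam j)) :
    ∃ a ∈ quatUnits,
      ∃ b ∈ quatUnits, α (lamGMod (gam i)) * a = b * lamGMod (gam j) := by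
  have ha1 : nr a = 1 := by
    rw [isUnit_lam_iff, Int.isUnit_iff] at ha
    refine ha.resolve_right fun h => ?_
    rw [nr_eq] at h
    nlinarith [mul_self_nonneg a.re, mul_self_nonneg a.imI, mul_self_nonneg a.imJ,
      mul_self_nonneg a.imK]
  refine ⟨_, int_unit_cases ha1, lamGMod b, ?_, h⟩
  have hn := congrArg nr h
  rw [nr_mul, nr_mul, hα, nr_lamGMod_gam, lamFMod, nr_lamMap, ha1, map_one, one_mul, mul_one] at hn
  have key : ∀ x y : ZMod 3, (nr (⟨x, y, 0, 0⟩ : Lam (ZMod 3) 0) = 1 → ⟨x, y, 0, 0⟩ ∈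
      quatUnits) ∧ (nr (⟨0, 0, x, y⟩ : Lam (ZMod 3) 0) = 1 →
      ⟨0, 0, x, y⟩ ∈ quatUnits) := by
    decide +kernel
  obtain ⟨x, y, z, w⟩ := b
  rcases fst_eq_zero_or_snd_eq_zero hb with h0 | h0
  · obtain ⟨rfl, rfl⟩ : x = 0 ∧ y = 0 := by simpa [lamFst, QuadraticAlgebra.ext_iff] using h0
    exact (key (zsMod z) (zsMod w)).2 hn.symm
  · obtain ⟨rfl, rfl⟩ : z = 0 ∧ w = 0 := by simpa [lamSnd, QuadraticAlgebra.ext_iff] using h0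
    exact (key (zsMod x) (zsMod y)).1 hn.symm

theorem eq_of_quatUnits : ∀ i j : Fin 3, (∃ a ∈ quatUnits, ∃ b ∈ quatUnits,
    lamGMod (gam i) * a = b * lamGMod (gam j)) → i = j := by
  decide +kernel

theorem eq_two_of_quatUnits : ∀ j : Fin 3, (∃ a ∈ quatUnits, ∃ b ∈ quatUnits,
    lamTwist (ZMod 3) 0 (lamGMod (gam 1)) * a = b * lamGMod (gam j)) → j = 2 := by
  decide +kernel

theorem nr_lamTwist_gam_one : nr (lamTwist (ZMod 3) 0 (lamGMod (gam 1))) = 1 := by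
  decide +kernel

theorem eq_of_linearEquiv {i j : Fin 3} (φ : glueIdeal (gam i) ≃ₗ[ZQ24] glueIdeal (gam j)) :
    i = j := by
  obtain ⟨a, b, ha, hb, h⟩ := exists_units_of_semilinear (σ := RingHom.id ZQ24)
    (αF := RingHom.id (Lam ℤ 0)) (αG := RingHom.id (Lam Zs srt)) (α := RingHom.id (Lam (ZMod 3) 0))
    (by rw [RingHom.id_comp, RingHom.comp_id]) (by rw [RingHom.id_comp, RingHom.comp_id])
    (by rw [RingHom.id_comp, RingHom.comp_id])
    φ φ.surjective fun r p => map_smul φ r p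
  have h1 := exists_quaternions_mod_three (by rw [RingHom.id_apply]; exact nr_lamGMod_gam i) ha hb h
  simp only [RingHom.id_apply] at h1
  exact eq_of_quatUnits i j h1

theorem eq_two_of_linearEquiv_twist {j : Fin 3}
    (φ : glueIdeal (gam 1) ≃ₗ[ZQ24] Twist shiftAut (glueIdeal (gam j))) : j = 2 := by
  obtain ⟨a, b, ha, hb, h⟩ := exists_units_of_semilinear pF_comp_twist pG_comp_twist
    lamFMod_comp_lamTwist (i := 1) (j := j)
    φ φ.surjective fun r p => map_smul φ r p
  exact eq_two_of_quatUnits j (exists_quaternions_mod_three nr_lamTwist_gam_one ha hb h)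

end Twists

section Assembly

theorem twistRingHom_refl : twistRingHom (MulEquiv.refl Q24) = RingHom.id ZQ24 :=
  ZQ24_hom_ext (by simp [twistRingHom, gx]) (by simp [twistRingHom, gy])

theorem twistRingHom_twistRingHom_symm (θ : Q24 ≃* Q24) (z : ZQ24) :
    twistRingHom θ (twistRingHom θ.symm z) = z := by
  have : (twistRingHom θ).comp (twistRingHom θ.symm) = RingHom.id ZQ24 :=
    ZQ24_hom_ext (by simp [twistRingHom, gx]) (by simp [twistRingHom, gy])
  exact RingHom.congr_fun this z

theorem twistRingHom_symm_twistRingHom (θ : Q24 ≃* Q24) (z : ZQ24) :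
    twistRingHom θ.symm (twistRingHom θ z) = z :=
  twistRingHom_twistRingHom_symm θ.symm z

/-- The ring automorphism of `ℤQ₂₄` induced by an automorphism of the group. -/
def twistRingEquiv (θ : Q24 ≃* Q24) : ZQ24 ≃+* ZQ24 :=
  { twistRingHom θ with
    invFun := twistRingHom θ.symm
    left_inv := twistRingHom_symm_twistRingHom θ
    right_inv := twistRingHom_twistRingHom_symm θ }

variable {M M' : Type} [AddCommGroup M] [Module ZQ24 M] [AddCommGroup M'] [Module ZQ24 M']

/-- The identity map from a twisted module to the original one. -/
def untwist (θ : Q24 ≃* Q24) (M : Type) [AddCommGroup M] [Module ZQ24 M] : Twist θ M ≃+ M :=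
  AddEquiv.refl M

theorem untwist_smul (θ : Q24 ≃* Q24) (r : ZQ24) (p : Twist θ M) :
    untwist θ M (r • p) = twistRingEquiv θ r • untwist θ M p := rfl

/-- Twisting by the identity does not change the module. -/
def twistRefl : M ≃ₗ[ZQ24] Twist (.refl Q24) M :=
  { (untwist (.refl Q24) M).symm with
    map_smul' := fun r p => (untwist (.refl Q24) M).injective (by
      have h : twistRingEquiv (.refl Q24) r = r := RingHom.congr_fun twistRingHom_refl r
      simp [untwist_smul, h]) }

theorem isStablyFree_twist (θ : Q24 ≃* Q24)
    (h : IsStablyFreeOfRankOne (ModuleCat.of ZQ24 M)) :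
    IsStablyFreeOfRankOne (ModuleCat.of ZQ24 (Twist θ M)) := by
  obtain ⟨a, ⟨f⟩⟩ := h
  replace f : (M × (Fin a → ZQ24)) ≃ₗ[ZQ24] (Fin (a + 1) → ZQ24) := f
  let e : (Twist θ M × (Fin a → ZQ24)) ≃+ (M × (Fin a → ZQ24)) :=
    (untwist θ M).prodCongr (AddEquiv.piCongrRight fun _ => (twistRingEquiv θ).toAddEquiv)
  have he (r : ZQ24) (p : Twist θ M × (Fin a → ZQ24)) : e (r • p) = twistRingEquiv θ r • e p :=
    Prod.ext (untwist_smul θ r p.1) (funext fun j => map_mul (twistRingEquiv θ) r (p.2 j))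
  let e' : (Fin (a + 1) → ZQ24) ≃+ (Fin (a + 1) → ZQ24) :=
    AddEquiv.piCongrRight fun _ => (twistRingEquiv θ).symm.toAddEquiv
  have he' (r : ZQ24) (v : Fin (a + 1) → ZQ24) : e' (twistRingEquiv θ r • v) = r • e' v :=
    funext fun i => by simp [e']
  let φ : (Twist θ M × (Fin a → ZQ24)) ≃ₗ[ZQ24] (Fin (a + 1) → ZQ24) :=
    { (e.trans f.toAddEquiv).trans e' with
      map_smul' := fun r p => by
        change e' (f (e (r • p))) = r • e' (f (e p))
        rw [he, map_smul, he'] }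
  exact ⟨a, ⟨φ⟩⟩

/-- A module generated freely by one element. -/
def IsFreeCyclic (M : Type) [AddCommGroup M] [Module ZQ24 M] : Prop :=
  ∃ p : M, Function.Bijective fun r : ZQ24 => r • p

theorem IsFreeCyclic.of_equiv (φ : M ≃ₗ[ZQ24] M') (h : IsFreeCyclic M) : IsFreeCyclic M' := by
  obtain ⟨p, hp⟩ := h
  refine ⟨φ p, ?_⟩
  simp_rw [← map_smul]
  exact φ.bijective.comp hp

theorem isFreeCyclic_twist_iff (θ : Q24 ≃* Q24) : IsFreeCyclic (Twist θ M) ↔ IsFreeCyclic M := by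
  refine (untwist θ M).exists_congr_left.trans (exists_congr fun p => ?_)
  rw [← (untwist θ M).comp_bijective,
    ← Function.Bijective.of_comp_iff (fun r : ZQ24 => r • p) (twistRingEquiv θ).bijective]
  exact Iff.rfl

theorem isFreeCyclic_glueIdeal_iff {i : Fin 3} : IsFreeCyclic (glueIdeal (gam i)) ↔ i = 0 := by
  have h0 : glueIdeal (gam 0) = ⊤ := by
    ext r
    exact ⟨fun _ => trivial, fun _ => ⟨pG r, (mul_one _).symm⟩⟩
  constructor
  · rintro ⟨p, hp⟩
    let φ : ZQ24 ≃ₗ[ZQ24] glueIdeal (gam i) :=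
      LinearEquiv.ofBijective (LinearMap.toSpanSingleton ZQ24 _ p) hp
    exact eq_of_linearEquiv (φ.symm.trans ((LinearEquiv.ofTop _ h0).symm))
  · rintro rfl
    refine .of_equiv (LinearEquiv.ofTop _ h0).symm ⟨1, ?_⟩
    simp only [smul_eq_mul, mul_one]
    exact Function.bijective_id

theorem nonempty_equiv_twist :
    Nonempty (glueIdeal (gam 2) ≃ₗ[ZQ24] Twist shiftAut (glueIdeal (gam 1))) := by
  obtain ⟨k, ⟨φ⟩⟩ := exists_equiv_glueIdeal (isStablyFree_twist shiftAut (isStablyFree_glueIdeal 1))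
  replace φ : Twist shiftAut (glueIdeal (gam 1)) ≃ₗ[ZQ24] glueIdeal (gam k) := φ
  have h0 : k ≠ 0 := fun h => by
    have h1 := (isFreeCyclic_glueIdeal_iff.2 h).of_equiv φ.symm
    rw [isFreeCyclic_twist_iff, isFreeCyclic_glueIdeal_iff] at h1
    exact absurd h1 (by decide)
  have h1 : k ≠ 1 := by
    rintro rfl
    exact absurd (eq_two_of_linearEquiv_twist φ.symm) (by decide)
  obtain rfl : k = 2 := by omega
  exact ⟨φ.symm⟩

theorem card_quot_eq {X : Type*} {r : X → X → Prop} {n : ℕ} (f : X → Fin n)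
    (hf : Function.Surjective f) (h : ∀ x y, r x y → f x = f y)
    (h' : ∀ x y, f x = f y → Quot.mk r x = Quot.mk r y) : Nat.card (Quot r) = n := by
  have hb : Function.Bijective (Quot.lift f h) := by
    refine ⟨?_, fun i => ?_⟩
    · rintro ⟨x⟩ ⟨y⟩ hxy
      exact h' x y hxy
    · obtain ⟨x, rfl⟩ := hf i
      exact ⟨Quot.mk r x, rfl⟩
  rw [Nat.card_congr (Equiv.ofBijective _ hb), Nat.card_fin]

end Assembly

/-- The stably free rank one `ℤQ₂₄`-modules fall into exactly 2 classes under the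
equivalence relation generated by twisting by automorphisms of `Q₂₄`, while they fall
into exactly 3 classes up to isomorphism; in particular the twisting action of
`Aut(Q₂₄)` on the 3 isomorphism classes is non-trivial, i.e. some stably free rank one
module is not isomorphic to one of its twists. -/
theorem stablyFree_rank_one_ZQ24_two_classes_up_to_aut :
    Nat.card (Quot (fun (P Q : {P : ModuleCat.{0} ZQ24 // IsStablyFreeOfRankOne P}) =>
      ∃ θ : Q24 ≃* Q24, Nonempty (↥Q.1 ≃ₗ[ZQ24] Twist θ ↥P.1))) = 2 ∧
    Nat.card (Quot (fun (P Q : {P : ModuleCat.{0} ZQ24 // IsStablyFreeOfRankOne P}) =>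
      Nonempty (↥P.1 ≃ₗ[ZQ24] ↥Q.1))) = 3 ∧
    ∃ (P : ModuleCat.{0} ZQ24) (θ : Q24 ≃* Q24), IsStablyFreeOfRankOne P ∧
      ¬ Nonempty (↥P ≃ₗ[ZQ24] Twist θ ↥P) := by
  choose cls hcls using fun P : {P : ModuleCat.{0} ZQ24 // IsStablyFreeOfRankOne P} =>
    exists_equiv_glueIdeal P.2
  let J (i : Fin 3) : {P : ModuleCat.{0} ZQ24 // IsStablyFreeOfRankOne P} :=
    ⟨_, isStablyFree_glueIdeal i⟩
  have hJ (i : Fin 3) : cls (J i) = i := by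
    obtain ⟨φ⟩ := hcls (J i)
    exact (eq_of_linearEquiv φ).symm
  have hiso {P Q : {P : ModuleCat.{0} ZQ24 // IsStablyFreeOfRankOne P}} :
      Nonempty (↥P.1 ≃ₗ[ZQ24] ↥Q.1) ↔ cls P = cls Q := by
    obtain ⟨φ⟩ := hcls P
    obtain ⟨ψ⟩ := hcls Q
    refine ⟨fun ⟨χ⟩ => eq_of_linearEquiv ((φ.symm.trans χ).trans ψ), fun h => ?_⟩
    rw [h] at φ
    exact ⟨φ.trans ψ.symm⟩
  have hfree (P : {P : ModuleCat.{0} ZQ24 // IsStablyFreeOfRankOne P}) :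
      IsFreeCyclic P.1 ↔ cls P = 0 := by
    obtain ⟨φ⟩ := hcls P
    rw [← isFreeCyclic_glueIdeal_iff]
    exact ⟨.of_equiv φ, .of_equiv φ.symm⟩
  refine ⟨?_, ?_, ModuleCat.of ZQ24 (glueIdeal (gam 1)), shiftAut, isStablyFree_glueIdeal 1, ?_⟩
  · refine card_quot_eq (fun P => if cls P = 0 then 0 else 1) ?_ ?_ ?_
    · intro i
      fin_cases i
      · exact ⟨J 0, by simp [hJ]⟩
      · exact ⟨J 1, by simp [hJ]⟩
    · rintro P Q ⟨θ, ⟨φ⟩⟩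
      have : cls P = 0 ↔ cls Q = 0 := by
        rw [← hfree, ← hfree, ← isFreeCyclic_twist_iff θ]
        exact ⟨.of_equiv φ.symm, .of_equiv φ⟩
      simp only [this]
    · intro P Q h
      have hmk {P Q : {P : ModuleCat.{0} ZQ24 // IsStablyFreeOfRankOne P}}
          (h : cls P = cls Q) : Quot.mk (fun (P Q : {P : ModuleCat.{0} ZQ24 //
            IsStablyFreeOfRankOne P}) => ∃ θ : Q24 ≃* Q24,
              Nonempty (↥Q.1 ≃ₗ[ZQ24] Twist θ ↥P.1)) P = Quot.mk _ Q := by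
        obtain ⟨φ⟩ := hiso.2 h
        exact Quot.sound ⟨.refl Q24, ⟨φ.symm.trans twistRefl⟩⟩
      have h12 : Quot.mk (fun (P Q : {P : ModuleCat.{0} ZQ24 //
            IsStablyFreeOfRankOne P}) => ∃ θ : Q24 ≃* Q24,
              Nonempty (↥Q.1 ≃ₗ[ZQ24] Twist θ ↥P.1)) (J 1) = Quot.mk _ (J 2) :=
        Quot.sound ⟨shiftAut, nonempty_equiv_twist⟩
      by_cases hPQ : cls P = cls Q
      · exact hmk hPQ
      · have h3 : cls P = 1 ∧ cls Q = 2 ∨ cls P = 2 ∧ cls Q = 1 := by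
          generalize cls P = i at *
          generalize cls Q = j at *
          revert i j
          decide
        rcases h3 with ⟨hP, hQ⟩ | ⟨hP, hQ⟩
        · rw [hmk (hP.trans (hJ 1).symm), hmk (hQ.trans (hJ 2).symm), h12]
        · rw [hmk (hP.trans (hJ 2).symm), hmk (hQ.trans (hJ 1).symm), h12]
  · refine card_quot_eq cls (fun i => ⟨J i, hJ i⟩) (fun P Q h => hiso.1 h)
      fun P Q h => Quot.sound (hiso.2 h)
  · rintro ⟨φ⟩
    exact absurd (eq_two_of_linearEquiv_twist φ) (by decide)

end
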